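/- arXiv:math/0502211 — 2 statements merged into one kernel-verified Lean document; each statement's English description precedes it below -/
import Mathlib

section
/- Let A and D be separable C*-algebras with D unital, strongly self-absorbing and K₁-injective. Then A is isomorphic to A ⊗ D if and only if there is a *-homomorphism σ : A ⊗ D → Q(A) with σ(a ⊗ 1_D) = a for all a ∈ A (identifying A with its image in Q(A) via constant sequences). Moreover, in this case the isomorphism φ : A → A ⊗ D can be chosen approximately unitarily equivalent to id_A ⊗ 1_D. -/
open scoped MultiplierAlgebra TensorProduct
open Filter Topology

noncomputable section

universe u v w x

/-- Approximate unitary equivalence of two maps `φ ψ : A → B`, witnessed by a sequence of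
unitaries in the multiplier algebra `𝓜(ℂ, B)` (in which `B` embeds canonically). -/
def ApproxUnitaryEquiv {A : Type u} {B : Type v} [NonUnitalCStarAlgebra B]
    (φ ψ : A → B) : Prop :=
  ∃ v : ℕ → 𝓜(ℂ, B), (∀ n, v n ∈ unitary 𝓜(ℂ, B)) ∧
    ∀ a : A, Tendsto
      (fun n => ‖star (v n) * (φ a : 𝓜(ℂ, B)) * v n - (ψ a : 𝓜(ℂ, B))‖)
      atTop (𝓝 (0 : ℝ))

/-- Data exhibiting `T` as a C*-tensor product of `A` and `B`: a bilinear, multiplicative,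
star-preserving, cross-normed map `A × B → T` with dense span. -/
structure CStarTensor (A : Type u) (B : Type v) (T : Type w) [NonUnitalCStarAlgebra A]
    [NonUnitalCStarAlgebra B] [NonUnitalCStarAlgebra T] where
  tmul : A → B → T
  add_left : ∀ a a' b, tmul (a + a') b = tmul a b + tmul a' b
  add_right : ∀ a b b', tmul a (b + b') = tmul a b + tmul a b'
  smul_left : ∀ (c : ℂ) a b, tmul (c • a) b = c • tmul a b
  smul_right : ∀ (c : ℂ) a b, tmul a (c • b) = c • tmul a b
  mul_tmul : ∀ a a' b b', tmul a b * tmul a' b' = tmul (a * a') (b * b')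
  star_tmul : ∀ a b, star (tmul a b) = tmul (star a) (star b)
  norm_tmul : ∀ a b, ‖tmul a b‖ = ‖a‖ * ‖b‖
  dense_span : Dense ((Submodule.span ℂ {t : T | ∃ a b, tmul a b = t} : Submodule ℂ T) : Set T)

/-- Data exhibiting `T` as *the minimal (spatial) tensor product* of `A` and `B`: a C*-tensor
product which is dominated by every other C*-tensor product of `A` and `B` (i.e., it carries
the smallest C*-norm). -/
structure MinTensor (A : Type u) (B : Type v) (T : Type w) [NonUnitalCStarAlgebra A]
    [NonUnitalCStarAlgebra B] [NonUnitalCStarAlgebra T] extends CStarTensor A B T where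
  minimal : ∀ (T' : Type (max u v)) [NonUnitalCStarAlgebra T'] (h : CStarTensor A B T'),
    ∃ π : T' →⋆ₙₐ[ℂ] T, ∀ a b, π (h.tmul a b) = tmul a b

/-- The first-factor unital embedding `d ↦ d ⊗ 1`. -/
def MinTensor.fst {D : Type u} {E : Type v} {T : Type w} [CStarAlgebra D] [CStarAlgebra E]
    [CStarAlgebra T] (h : MinTensor D E T) : D → T := fun d => h.tmul d 1

/-- The second-factor unital embedding `d ↦ 1 ⊗ d`. -/
def MinTensor.snd {D : Type u} {E : Type v} {T : Type w} [CStarAlgebra D] [CStarAlgebra E]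
    [CStarAlgebra T] (h : MinTensor D E T) : E → T := fun d => h.tmul 1 d

/-- A unital C*-algebra `D` has *approximately inner half flip* (with respect to a
realization `T` of the minimal tensor product `D ⊗ D`) if the two factor embeddings
`id_D ⊗ 1_D` and `1_D ⊗ id_D` of `D` into `D ⊗ D` are approximately unitarily equivalent. -/
def HasApproxInnerHalfFlip {D : Type u} {T : Type w} [CStarAlgebra D] [CStarAlgebra T]
    (h : MinTensor D D T) : Prop :=
  ApproxUnitaryEquiv h.fst h.snd

/-- A unital C*-algebra `D` has *approximately inner flip* (with respect to a realization
`T` of `D ⊗ D`) if the flip automorphism `σ_D : a ⊗ b ↦ b ⊗ a` of `D ⊗ D` is approximately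
unitarily equivalent to the identity map. -/
def HasApproxInnerFlip {D : Type u} {T : Type w} [CStarAlgebra D] [CStarAlgebra T]
    (h : MinTensor D D T) : Prop :=
  ∃ σ : T ≃⋆ₐ[ℂ] T, (∀ a b, σ (h.tmul a b) = h.tmul b a) ∧
    ApproxUnitaryEquiv (⇑σ) (id : T → T)

/-- A unital C*-algebra `D ≇ ℂ` is *strongly self-absorbing* (with respect to a realization
`T` of the minimal tensor product `D ⊗ D`) if there is an isomorphism `φ : D → D ⊗ D` which
is approximately unitarily equivalent to `id_D ⊗ 1_D`. -/
def IsStronglySelfAbsorbing {D : Type u} {T : Type w} [CStarAlgebra D] [CStarAlgebra T]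
    (h : MinTensor D D T) : Prop :=
  IsEmpty (D ≃⋆ₐ[ℂ] ℂ) ∧ ∃ φ : D ≃⋆ₐ[ℂ] T, ApproxUnitaryEquiv (⇑φ) h.fst

/-- The image of `u` under the upper-left-corner stabilization `u ↦ diag(u, 1, …, 1)`
into `M_{n+1}(A)`. -/
def stabUnitary {A : Type u} [CStarAlgebra A] (n : ℕ) (u : A) :
    Matrix (Fin (n + 1)) (Fin (n + 1)) A :=
  Matrix.diagonal (fun i => if i = 0 then u else 1)

/-- A unitary `u` represents `0` in `K₁(A)`: some matrix stabilization `diag(u, 1, …, 1)`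
is connected to the identity through the unitary group of a matrix algebra over `A`. -/
def RepresentsZeroInK1 {A : Type u} [CStarAlgebra A] (u : A) : Prop :=
  ∃ n : ℕ, ∃ h : stabUnitary n u ∈ unitary (Matrix (Fin (n + 1)) (Fin (n + 1)) A),
    Joined (⟨stabUnitary n u, h⟩ : ↥(unitary (Matrix (Fin (n + 1)) (Fin (n + 1)) A))) 1

/-- A unital C*-algebra is `K₁`-injective if the canonical map `U(A)/U₀(A) → K₁(A)` is
injective, i.e. every unitary representing `0` in `K₁(A)` lies in the connected component
of the unit of `U(A)`. -/
def K1Injective (A : Type u) [CStarAlgebra A] : Prop :=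
  ∀ u : ↥(unitary A), RepresentsZeroInK1 (u : A) → Joined u 1

/-- The *-subalgebra `∏_ℕ A` of bounded sequences inside `ℕ → A`. -/
def boundedSeqs (A : Type u) [NonUnitalCStarAlgebra A] :
    NonUnitalStarSubalgebra ℂ (ℕ → A) where
  carrier := {f | ∃ C, ∀ n, ‖f n‖ ≤ C}
  add_mem' := by
    rintro f g ⟨C, hC⟩ ⟨D, hD⟩
    exact ⟨C + D, fun n => (norm_add_le _ _).trans (add_le_add (hC n) (hD n))⟩
  zero_mem' := ⟨0, fun n => by simp⟩
  mul_mem' := by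
    rintro f g ⟨C, hC⟩ ⟨D, hD⟩
    refine ⟨C * D, fun n => (norm_mul_le _ _).trans ?_⟩
    exact mul_le_mul (hC n) (hD n) (norm_nonneg _) ((norm_nonneg (f n)).trans (hC n))
  smul_mem' := by
    rintro c f ⟨C, hC⟩
    exact ⟨‖c‖ * C, fun n => by
      rw [Pi.smul_apply, norm_smul]
      exact mul_le_mul_of_nonneg_left (hC n) (norm_nonneg c)⟩
  star_mem' := by
    rintro f ⟨C, hC⟩
    exact ⟨C, fun n => by simpa using hC n⟩

/-- The constant sequence, as a bounded sequence. -/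
def constSeq {A : Type u} [NonUnitalCStarAlgebra A] (a : A) : boundedSeqs A :=
  ⟨fun _ => a, ⟨‖a‖, fun _ => le_rfl⟩⟩

/-- Data exhibiting `QA` as the sequence algebra `Q(A) = (∏_ℕ A) / (⊕_ℕ A)`: a surjective
*-homomorphism from the algebra of bounded sequences whose kernel is exactly the ideal of
sequences converging to zero in norm. -/
structure IsSeqCorona (A : Type u) [NonUnitalCStarAlgebra A] (QA : Type v)
    [NonUnitalCStarAlgebra QA] where
  q : boundedSeqs A →⋆ₙₐ[ℂ] QA
  surjective : Function.Surjective q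
  ker_iff : ∀ f : boundedSeqs A,
    q f = 0 ↔ Tendsto (fun n => ‖(f : ℕ → A) n‖) atTop (𝓝 (0 : ℝ))

/-- The canonical embedding `A → Q(A)` via constant sequences. -/
def IsSeqCorona.incl {A : Type u} [NonUnitalCStarAlgebra A] {QA : Type v}
    [NonUnitalCStarAlgebra QA] (h : IsSeqCorona A QA) : A → QA :=
  fun a => h.q (constSeq a)

section TensorBasics

variable {A : Type u} {B : Type v} {T : Type w} {E : Type x}
  [NonUnitalCStarAlgebra A] [NonUnitalCStarAlgebra B]
  [NonUnitalCStarAlgebra T] [NonUnitalCStarAlgebra E]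

/-- The *-homomorphism on the algebraic tensor product induced by a multiplicative,
star-preserving bilinear map. -/
def tensorStarHom (β : A →ₗ[ℂ] B →ₗ[ℂ] E)
    (hmul : ∀ a a' b b', β a b * β a' b' = β (a * a') (b * b'))
    (hstar : ∀ a b, star (β a b) = β (star a) (star b)) : A ⊗[ℂ] B →⋆ₙₐ[ℂ] E where
  toFun := TensorProduct.lift β
  map_smul' c p := by simp
  map_zero' := by simp
  map_add' := by simp
  map_mul' p q := by
    induction p with
    | zero => simp
    | add p₁ p₂ h₁ h₂ => simp [add_mul, h₁, h₂]
    | tmul a b =>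
      induction q with
      | zero => simp
      | add q₁ q₂ h₁ h₂ => simp [mul_add, h₁, h₂]
      | tmul a' b' => simp [hmul]
  map_star' p := by
    induction p with
    | zero => simp
    | add p₁ p₂ h₁ h₂ => simp [h₁, h₂]
    | tmul a b => simp [hstar]

@[simp]
theorem tensorStarHom_tmul (β : A →ₗ[ℂ] B →ₗ[ℂ] E)
    (hmul : ∀ a a' b b', β a b * β a' b' = β (a * a') (b * b'))
    (hstar : ∀ a b, star (β a b) = β (star a) (star b)) (a : A) (b : B) :
    tensorStarHom β hmul hstar (a ⊗ₜ b) = β a b := by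
  simp [tensorStarHom]

namespace CStarTensor

variable (h : CStarTensor A B T)

/-- The bilinear map underlying a C*-tensor product. -/
def bil : A →ₗ[ℂ] B →ₗ[ℂ] T :=
  LinearMap.mk₂ ℂ h.tmul h.add_left h.smul_left h.add_right h.smul_right

@[simp] theorem bil_apply (a : A) (b : B) : h.bil a b = h.tmul a b := rfl

/-- The canonical *-homomorphism from the algebraic tensor product. -/
def lift : A ⊗[ℂ] B →⋆ₙₐ[ℂ] T :=
  tensorStarHom h.bil h.mul_tmul h.star_tmul

@[simp] theorem lift_tmul (a : A) (b : B) : h.lift (a ⊗ₜ b) = h.tmul a b :=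
  tensorStarHom_tmul ..

theorem denseRange_lift : DenseRange h.lift := by
  refine h.dense_span.mono ?_
  have : Submodule.span ℂ {t : T | ∃ a b, h.tmul a b = t} ≤
      LinearMap.range (h.lift : A ⊗[ℂ] B →ₗ[ℂ] T) := by
    refine Submodule.span_le.2 ?_
    rintro _ ⟨a, b, rfl⟩
    exact ⟨a ⊗ₜ b, by simp⟩
  exact this

theorem exists_lift_near (t : T) {ε : ℝ} (hε : 0 < ε) : ∃ p, ‖h.lift p - t‖ < ε := by
  obtain ⟨p, hp⟩ := h.denseRange_lift.exists_dist_lt t hε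
  exact ⟨p, by rwa [dist_comm, dist_eq_norm] at hp⟩

theorem tmul_zero (a : A) : h.tmul a 0 = 0 := (h.bil a).map_zero

theorem zero_tmul (b : B) : h.tmul 0 b = 0 := by
  rw [← h.bil_apply, map_zero, LinearMap.zero_apply]

theorem sub_tmul (a a' : A) (b : B) : h.tmul (a - a') b = h.tmul a b - h.tmul a' b := by
  simp only [← h.bil_apply, map_sub, LinearMap.sub_apply]

theorem tmul_sub (a : A) (b b' : B) : h.tmul a (b - b') = h.tmul a b - h.tmul a b' := by
  simp only [← h.bil_apply, map_sub]

/-- The continuous bilinear map underlying a C*-tensor product. -/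
def clm : A →L[ℂ] B →L[ℂ] T :=
  h.bil.mkContinuous₂ 1 fun a b => by simp [h.norm_tmul]

@[simp] theorem clm_apply (a : A) (b : B) : h.clm a b = h.tmul a b := rfl

theorem continuous_tmul : Continuous fun p : A × B => h.tmul p.1 p.2 :=
  h.clm.continuous₂

/-- A *-homomorphism on the algebraic tensor product dominated by the norm of a C*-tensor
product extends to the latter. -/
theorem exists_extend (Φ : A ⊗[ℂ] B →⋆ₙₐ[ℂ] E) (hΦ : ∀ p, ‖Φ p‖ ≤ ‖h.lift p‖) :
    ∃ ρ : T →⋆ₙₐ[ℂ] E, ∀ p, ρ (h.lift p) = Φ p := by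
  let f : T →L[ℂ] E :=
    (Φ : A ⊗[ℂ] B →ₗ[ℂ] E).extendOfNorm (h.lift : A ⊗[ℂ] B →ₗ[ℂ] T)
  have hf : ∀ p, f (h.lift p) = Φ p := fun p =>
    LinearMap.extendOfNorm_eq (f := (Φ : A ⊗[ℂ] B →ₗ[ℂ] E))
      (e := (h.lift : A ⊗[ℂ] B →ₗ[ℂ] T)) h.denseRange_lift
      ⟨1, fun p => by simpa using hΦ p⟩ p
  refine ⟨{ toFun := f, map_smul' := by simp, map_zero' := by simp, map_add' := by simp,
            map_mul' := ?_, map_star' := ?_ }, hf⟩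
  · intro s t
    induction s using h.denseRange_lift.induction_on with
    | hp => exact isClosed_eq (by fun_prop) (by fun_prop)
    | ih p =>
      induction t using h.denseRange_lift.induction_on with
      | hp => exact isClosed_eq (by fun_prop) (by fun_prop)
      | ih q => rw [← map_mul, hf, hf, hf, map_mul]
  · intro s
    induction s using h.denseRange_lift.induction_on with
    | hp => exact isClosed_eq (by fun_prop) (by fun_prop)
    | ih p => rw [← map_star, hf, hf, map_star]

end CStarTensor

end TensorBasics

section MatrixFactorization

open scoped ComplexOrder MatrixOrder in
theorem exists_conjTranspose_mul_self {ι : Type*} [Fintype ι] (G : Matrix ι ι ℂ)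
    (hG : ∀ s t, star (G s t) = G t s)
    (hpos : ∀ z : ι → ℂ, ∃ r : ℝ, 0 ≤ r ∧ ∑ s, ∑ t, star (z s) * G s t * z t = r) :
    ∃ M : Matrix ι ι ℂ, ∀ s t, G s t = ∑ m, star (M m s) * M m t := by
  classical
  have hpsd : G.PosSemidef := by
    refine Matrix.PosSemidef.of_dotProduct_mulVec_nonneg
      (Matrix.IsHermitian.ext fun i j => hG j i) fun z => ?_
    obtain ⟨r, hr, hz⟩ := hpos z
    have : star z ⬝ᵥ G.mulVec z = (r : ℂ) := by
      rw [← hz]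
      simp only [dotProduct, Matrix.mulVec, Finset.mul_sum, Pi.star_apply, mul_assoc]
    rw [this]
    exact_mod_cast hr
  let _ : NormedRing (Matrix ι ι ℂ) := Matrix.instL2OpNormedRing
  let _ : CStarAlgebra (Matrix ι ι ℂ) := Matrix.instCStarAlgebra
  obtain ⟨M, hM⟩ := CStarAlgebra.nonneg_iff_eq_star_mul_self.1 hpsd.nonneg
  refine ⟨M, fun s t => ?_⟩
  rw [hM, Matrix.mul_apply]
  rfl

end MatrixFactorization

section Order

attribute [local instance] CStarAlgebra.spectralOrder CStarAlgebra.spectralOrderedRing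

section TensorBounds

variable {A : Type u} {B : Type v} {T : Type w} {E : Type x}
  [NonUnitalCStarAlgebra A] [CStarAlgebra B]
  [NonUnitalCStarAlgebra T] [NonUnitalCStarAlgebra E]

/-- *-homomorphisms on an algebraic tensor product are contractive on elementary tensors. -/
theorem norm_starHom_tmul_le (Φ : A ⊗[ℂ] B →⋆ₙₐ[ℂ] E) (a : A) (b : B) :
    ‖Φ (a ⊗ₜ b)‖ ≤ ‖a‖ * ‖b‖ := by
  let Ψ : A →⋆ₙₐ[ℂ] E :=
    { toFun := fun c => Φ (c ⊗ₜ (1 : B))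
      map_smul' := fun c x => by rw [← TensorProduct.smul_tmul', map_smul]; rfl
      map_zero' := by simp
      map_add' := fun x y => by rw [TensorProduct.add_tmul, map_add]
      map_mul' := fun x y => by rw [← map_mul]; simp
      map_star' := fun x => by rw [← map_star]; simp }
  have hΨ : ∀ c, Φ (c ⊗ₜ (1 : B)) = Ψ c := fun _ => rfl
  obtain ⟨z, hz⟩ := CStarAlgebra.nonneg_iff_eq_star_mul_self.1
    (sub_nonneg.2 (CStarAlgebra.star_mul_le_algebraMap_norm_sq (a := b)))
  have key : star (Φ (a ⊗ₜ b)) * Φ (a ⊗ₜ b) + star (Φ (a ⊗ₜ z)) * Φ (a ⊗ₜ z) =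
      ((‖b‖ ^ 2 : ℝ) : ℂ) • Ψ (star a * a) := by
    simp only [← map_star, ← map_mul, ← map_add, ← hΨ, TensorProduct.star_tmul,
      Algebra.TensorProduct.tmul_mul_tmul, ← TensorProduct.tmul_add, ← hz, ← map_smul]
    rw [add_sub_cancel, ← TensorProduct.tmul_smul]
    congr 2
    rw [Algebra.algebraMap_eq_smul_one, Complex.coe_smul]
  have h1 : ‖star (Φ (a ⊗ₜ b)) * Φ (a ⊗ₜ b)‖ ≤ ‖((‖b‖ ^ 2 : ℝ) : ℂ) • Ψ (star a * a)‖ := by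
    refine CStarAlgebra.norm_le_norm_of_nonneg_of_le (star_mul_self_nonneg _) ?_
    rw [← key]
    exact le_add_of_nonneg_right (star_mul_self_nonneg _)
  rw [CStarRing.norm_star_mul_self, norm_smul] at h1
  have h2 : ‖Ψ (star a * a)‖ ≤ ‖a‖ * ‖a‖ := by
    simpa [CStarRing.norm_star_mul_self] using NonUnitalStarAlgHom.norm_apply_le Ψ (star a * a)
  have h3 : ‖((‖b‖ ^ 2 : ℝ) : ℂ)‖ = ‖b‖ ^ 2 := by
    rw [Complex.norm_real, Real.norm_of_nonneg (by positivity)]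
  rw [h3] at h1
  have := mul_le_mul_of_nonneg_left h2 (sq_nonneg ‖b‖)
  refine abs_le_of_sq_le_sq' ?_ (by positivity) |>.2
  nlinarith

instance approximateUnit_neBot (A : Type*) [NonUnitalCStarAlgebra A] :
    (CStarAlgebra.approximateUnit A).NeBot :=
  (CStarAlgebra.increasingApproximateUnit A).neBot

theorem tendsto_approximateUnit_mul (a : A) :
    Tendsto (fun f => f * a) (CStarAlgebra.approximateUnit A) (𝓝 a) :=
  (CStarAlgebra.increasingApproximateUnit A).tendsto_mul_right a

theorem tendsto_mul_approximateUnit (a : A) :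
    Tendsto (fun f => a * f) (CStarAlgebra.approximateUnit A) (𝓝 a) :=
  (CStarAlgebra.increasingApproximateUnit A).tendsto_mul_left a

theorem eventually_approximateUnit (A : Type*) [NonUnitalCStarAlgebra A] :
    ∀ᶠ f in CStarAlgebra.approximateUnit A, star f = f ∧ ‖f‖ ≤ 1 := by
  have h := CStarAlgebra.increasingApproximateUnit A
  filter_upwards [h.eventually_nonneg, h.eventually_norm] with f hf hf'
  exact ⟨(IsSelfAdjoint.of_nonneg hf).star_eq, hf'⟩

namespace CStarTensor

variable (h : CStarTensor A B T)

theorem tendsto_lift_approximateUnit_mul (c : B) (p : A ⊗[ℂ] B) :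
    Tendsto (fun f => h.lift ((f ⊗ₜ c) * p)) (CStarAlgebra.approximateUnit A)
      (𝓝 (h.lift ((LinearMap.mulLeft ℂ c).lTensor A p))) := by
  induction p with
  | zero => simp
  | add p q hp hq => simpa [mul_add] using hp.add hq
  | tmul a b =>
    simp only [Algebra.TensorProduct.tmul_mul_tmul, lift_tmul, LinearMap.lTensor_tmul,
      LinearMap.mulLeft_apply]
    exact (h.continuous_tmul.tendsto (a, c * b)).comp
      ((tendsto_approximateUnit_mul a).prodMk_nhds tendsto_const_nhds)

theorem tendsto_lift_mul_approximateUnit (c : B) (p : A ⊗[ℂ] B) :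
    Tendsto (fun f => h.lift (p * (f ⊗ₜ c))) (CStarAlgebra.approximateUnit A)
      (𝓝 (h.lift ((LinearMap.mulRight ℂ c).lTensor A p))) := by
  induction p with
  | zero => simp
  | add p q hp hq => simpa [add_mul] using hp.add hq
  | tmul a b =>
    simp only [Algebra.TensorProduct.tmul_mul_tmul, lift_tmul, LinearMap.lTensor_tmul,
      LinearMap.mulRight_apply]
    exact (h.continuous_tmul.tendsto (a, b * c)).comp
      ((tendsto_mul_approximateUnit a).prodMk_nhds tendsto_const_nhds)

theorem norm_lift_mulLeft_le (c : B) (p : A ⊗[ℂ] B) :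
    ‖h.lift ((LinearMap.mulLeft ℂ c).lTensor A p)‖ ≤ ‖c‖ * ‖h.lift p‖ := by
  refine le_of_tendsto (h.tendsto_lift_approximateUnit_mul c p).norm ?_
  filter_upwards [eventually_approximateUnit A] with f hf
  rw [map_mul, lift_tmul]
  refine (norm_mul_le _ _).trans (mul_le_mul_of_nonneg_right ?_ (norm_nonneg _))
  rw [h.norm_tmul]
  exact mul_le_of_le_one_left (norm_nonneg _) hf.2

theorem norm_lift_mulRight_le (c : B) (p : A ⊗[ℂ] B) :
    ‖h.lift ((LinearMap.mulRight ℂ c).lTensor A p)‖ ≤ ‖c‖ * ‖h.lift p‖ := by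
  refine le_of_tendsto (h.tendsto_lift_mul_approximateUnit c p).norm ?_
  filter_upwards [eventually_approximateUnit A] with f hf
  rw [map_mul, lift_tmul, mul_comm]
  refine (norm_mul_le _ _).trans (mul_le_mul_of_nonneg_left ?_ (norm_nonneg _))
  rw [h.norm_tmul]
  exact mul_le_of_le_one_left (norm_nonneg _) hf.2

end CStarTensor

end TensorBounds

section Excision

variable {D : Type u} [CStarAlgebra D]

/-- Spectral bumps near the norm of a positive element. -/
theorem exists_bump {k : D} (hk : 0 ≤ k) {t : ℝ} (ht0 : 0 < t) (ht : t < ‖k‖) :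
    ∃ g g' ξ : D, 0 ≤ g ∧ g * g ≤ g ∧ g ≤ 1 ∧ 0 ≤ g' ∧ ‖g'‖ = 1 ∧ g * g' = g' ∧
      g = k * ξ ∧ t • (g * g) ≤ g * k * g := by
  have hsa : IsSelfAdjoint k := IsSelfAdjoint.of_nonneg hk
  have : Nontrivial D := ⟨k, 0, fun h0 => by simp [h0] at ht; linarith⟩
  set κ := ‖k‖ with hκ
  set m := (t + κ) / 2 with hm
  have hmt : t < m := by rw [hm]; linarith
  have hmκ : m < κ := by rw [hm]; linarith
  let f1 : ℝ → ℝ := fun s => max 0 (min 1 ((s - t) / (m - t)))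
  let f2 : ℝ → ℝ := fun s => max 0 (min 1 ((s - m) / (κ - m)))
  let f3 : ℝ → ℝ := fun s => f1 s / max s t
  have c1 : Continuous f1 := by fun_prop
  have c2 : Continuous f2 := by fun_prop
  have hmax : ∀ s, max s t ≠ 0 := fun s => (lt_max_of_lt_right ht0).ne'
  have c3 : Continuous f3 := c1.div (by fun_prop) hmax
  have f1nn : ∀ s, 0 ≤ f1 s := fun s => le_max_left _ _
  have f1le : ∀ s, f1 s ≤ 1 := fun s => max_le zero_le_one (min_le_left _ _)
  have f2nn : ∀ s, 0 ≤ f2 s := fun s => le_max_left _ _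
  have f2le : ∀ s, f2 s ≤ 1 := fun s => max_le zero_le_one (min_le_left _ _)
  have f1z : ∀ s, s ≤ t → f1 s = 0 := fun s hs =>
    max_eq_left ((min_le_right _ _).trans
      (div_nonpos_of_nonpos_of_nonneg (by linarith) (by linarith)))
  have f2z : ∀ s, s ≤ m → f2 s = 0 := fun s hs =>
    max_eq_left ((min_le_right _ _).trans
      (div_nonpos_of_nonpos_of_nonneg (by linarith) (by linarith)))
  have f1one : ∀ s, m ≤ s → f1 s = 1 := fun s hs => by
    have : 1 ≤ (s - t) / (m - t) := by rw [le_div_iff₀ (by linarith)]; linarith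
    simp [f1, min_eq_left this]
  have f2κ : f2 κ = 1 := by
    have : (κ - m) / (κ - m) = 1 := div_self (by linarith)
    simp [f2, this]
  have hf3 : ∀ s, s * f3 s = f1 s := fun s => by
    rcases le_total s t with hs | hs
    · simp [f3, f1z s hs]
    · simp only [f3, max_eq_left hs]
      field_simp [(ht0.trans_le hs).ne']
  clear_value f3 f2 f1
  have o1 := c1.continuousOn (s := spectrum ℝ k)
  have o2 := c2.continuousOn (s := spectrum ℝ k)
  have o3 := c3.continuousOn (s := spectrum ℝ k)
  refine ⟨cfc f1 k, cfc f2 k, cfc f3 k, cfc_nonneg fun s _ => f1nn s, ?_,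
    cfc_le_one _ _ fun s _ => f1le s, cfc_nonneg fun s _ => f2nn s, ?_, ?_, ?_, ?_⟩
  · rw [← cfc_mul f1 f1 k]
    exact cfc_mono fun s _ => mul_le_of_le_one_left (f1nn s) (f1le s)
  · refine le_antisymm (norm_cfc_le zero_le_one fun s _ => ?_) ?_
    · rw [Real.norm_of_nonneg (f2nn s)]; exact f2le s
    · have := norm_apply_le_norm_cfc f2 k (CStarAlgebra.norm_mem_spectrum_of_nonneg hk)
      rwa [← hκ, f2κ, norm_one] at this
  · rw [← cfc_mul f1 f2 k]
    congr 1
    funext s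
    rcases le_total s m with hs | hs
    · simp [f2z s hs]
    · simp [f1one s hs]
  · nth_rewrite 2 [← cfc_id ℝ k]
    rw [← cfc_mul id f3 k]
    congr 1
    funext s
    exact (hf3 s).symm
  · nth_rewrite 4 [← cfc_id ℝ k]
    rw [← cfc_mul f1 f1 k, ← cfc_mul f1 id k, ← cfc_mul _ f1 k, ← cfc_smul t _ k]
    refine cfc_mono fun s _ => ?_
    rcases le_total s t with hs | hs
    · simp [f1z s hs]
    · simp only [id, smul_eq_mul]
      nlinarith [mul_nonneg (f1nn s) (f1nn s)]

/-- A self-adjoint element acting as the identity on some positive element of norm one. -/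
def HasCore (g : D) : Prop :=
  IsSelfAdjoint g ∧ ∃ e, 0 ≤ e ∧ ‖e‖ = 1 ∧ g * e = e

theorem HasCore.exists_sub {g : D} (hg : HasCore g) :
    ∃ e, 0 ≤ e ∧ e * e ≤ e ∧ e ≤ 1 ∧ g * e = e ∧ HasCore e := by
  obtain ⟨-, e, he, hen, hge⟩ := hg
  obtain ⟨f, f', ξ, hf, hff, hf1, hf', hfn', hff', hfξ, -⟩ :=
    exists_bump he (t := 1 / 2) (by norm_num) (by rw [hen]; norm_num)
  exact ⟨f, hf, hff, hf1, by rw [hfξ, ← mul_assoc, hge], IsSelfAdjoint.of_nonneg hf, f', hf',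
    hfn', hff'⟩

theorem norm_le_of_smul_bounds {a b : D} {s t : ℝ} (hst : s ≤ t)
    (h₁ : s • b ≤ a) (h₂ : a ≤ t • b) : ‖a - s • b‖ ≤ (t - s) * ‖b‖ := by
  have h : a - s • b ≤ (t - s) • b := by rw [sub_smul]; exact sub_le_sub_right h₂ _
  refine (CStarAlgebra.norm_le_norm_of_nonneg_of_le (sub_nonneg.2 h₁) h).trans ?_
  rw [norm_smul, Real.norm_of_nonneg (by linarith)]

theorem exists_excision_of_one_le {g d : D} (hg : HasCore g) (hd : 1 ≤ d) {δ : ℝ} (hδ : 0 < δ) :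
    ∃ g', HasCore g' ∧ g * g' = g' ∧ ∃ c : ℝ, ∀ x, IsSelfAdjoint x → g' * x = x →
      ‖x * d * x - c • (x * x)‖ ≤ δ * ‖x‖ ^ 2 := by
  have hd0 : (0 : D) ≤ d := zero_le_one.trans hd
  set S : Set ℝ := {r | ∃ g₀, HasCore g₀ ∧ g * g₀ = g₀ ∧ r = ‖g₀ * d * g₀‖} with hS
  have hSne : S.Nonempty := by
    obtain ⟨e, -, -, -, hge, hec⟩ := hg.exists_sub
    exact ⟨_, e, hec, hge, rfl⟩
  have hS1 : ∀ r ∈ S, 1 ≤ r := by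
    rintro _ ⟨g₀, ⟨hsa, e, he, hen, hge⟩, -, rfl⟩
    have h1 : 1 ≤ ‖g₀‖ := by
      have := norm_mul_le g₀ e
      rwa [hge, hen, mul_one] at this
    have h2 : ‖g₀ * g₀‖ ≤ ‖g₀ * d * g₀‖ := by
      have h3 := hsa.conjugate_le_conjugate hd
      rw [mul_one] at h3
      refine CStarAlgebra.norm_le_norm_of_nonneg_of_le ?_ h3
      nth_rewrite 1 [← hsa.star_eq]
      exact star_mul_self_nonneg _
    rw [hsa.norm_mul_self] at h2
    nlinarith
  set M := sInf S with hM
  have hM1 : 1 ≤ M := le_csInf hSne hS1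
  have hMle : ∀ r ∈ S, M ≤ r := fun r hr => csInf_le ⟨1, hS1⟩ hr
  set r := δ / (4 * (‖d‖ + 1)) with hr
  have hr0 : 0 < r := by positivity
  set η := min (r ^ 2 / 2) (min (δ / 8) (1 / 2)) with hη
  have hη0 : 0 < η := by positivity
  have hη1 : η ≤ r ^ 2 / 2 := min_le_left _ _
  have hη2 : η ≤ δ / 8 := (min_le_right _ _).trans (min_le_left _ _)
  have hη3 : η ≤ 1 / 2 := (min_le_right _ _).trans (min_le_right _ _)
  obtain ⟨_, ⟨g₀, hg₀, hgg₀, rfl⟩, hg₀M⟩ := Real.lt_sInf_add_pos hSne hη0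
  rw [← hM] at hg₀M
  obtain ⟨e, he, hee, he1, hge, hec⟩ := hg₀.exists_sub
  have hesa := IsSelfAdjoint.of_nonneg he
  set k := e * d * e with hk
  have hk0 : 0 ≤ k := hesa.conjugate_nonneg hd0
  have hkM : M ≤ ‖k‖ := hMle _ ⟨e, hec, by rw [← hge, ← mul_assoc, hgg₀], rfl⟩
  obtain ⟨f, f', ξ, hf, -, -, hf', hfn', hff', hfξ, hft⟩ :=
    exists_bump hk0 (t := M - η) (by linarith) (by linarith)
  have hfsa := IsSelfAdjoint.of_nonneg hf
  have hef : g₀ * f = f := by rw [hfξ, hk, ← mul_assoc, ← mul_assoc, ← mul_assoc, hge]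
  refine ⟨f, ⟨hfsa, f', hf', hfn', hff'⟩, by rw [← hef, ← mul_assoc, hgg₀], M, ?_⟩
  intro x hx hfx
  have hxf : x * f = x := by
    have := congrArg star hfx
    rwa [star_mul, hx.star_eq, hfsa.star_eq] at this
  have hg₀x : g₀ * x = x := by rw [← hfx, ← mul_assoc, hef]
  have hxg₀ : x * g₀ = x := by
    have := congrArg star hg₀x
    rwa [star_mul, hx.star_eq, hg₀.1.star_eq] at this
  have heg : e * g₀ = e := by
    have := congrArg star hge
    rwa [star_mul, hesa.star_eq, hg₀.1.star_eq] at this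
  have hle : g₀ * d * g₀ ≤ (M + η) • (1 : D) := by
    have hsa : IsSelfAdjoint (g₀ * d * g₀) :=
      IsSelfAdjoint.of_nonneg (hg₀.1.conjugate_nonneg hd0)
    refine (hsa.le_algebraMap_norm_self).trans ?_
    rw [Algebra.algebraMap_eq_smul_one]
    exact smul_le_smul_of_nonneg_right hg₀M.le zero_le_one
  have hke : k ≤ (M + η) • (e * e) := by
    have := hesa.conjugate_le_conjugate hle
    rw [mul_smul_comm, smul_mul_assoc, mul_one] at this
    refine le_trans (le_of_eq ?_) this
    simp only [hk, ← mul_assoc, heg]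
    rw [mul_assoc _ g₀ e, hge]
  have hxx : 0 ≤ x * x := by
    nth_rewrite 1 [← hx.star_eq]; exact star_mul_self_nonneg _
  have hlow : (M - η) • (x * x) ≤ x * k * x := by
    have := hx.conjugate_le_conjugate hft
    rw [mul_smul_comm, smul_mul_assoc] at this
    simp only [← mul_assoc, hxf] at this
    rwa [mul_assoc (x * k) f x, hfx] at this
  have hup : x * k * x ≤ (M + η) • (x * (e * e) * x) := by
    have := hx.conjugate_le_conjugate hke
    rwa [mul_smul_comm, smul_mul_assoc] at this
  have hee1 : e * e ≤ 1 := hee.trans he1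
  have hexx : x * (e * e) * x ≤ x * x := by
    simpa using hx.conjugate_le_conjugate hee1
  have hup' : x * k * x ≤ (M + η) • (x * x) :=
    hup.trans (smul_le_smul_of_nonneg_left hexx (by linarith))
  have hxn : ‖x * x‖ = ‖x‖ ^ 2 := hx.norm_mul_self
  have hM' : ‖x * k * x - M • (x * x)‖ ≤ 3 * η * ‖x‖ ^ 2 := by
    have h1 := norm_le_of_smul_bounds (by linarith) hlow hup'
    have h2 : x * k * x - M • (x * x) =
        (x * k * x - (M - η) • (x * x)) - η • (x * x) := by
      rw [sub_smul]; abel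
    rw [h2]
    refine (norm_sub_le _ _).trans ?_
    rw [norm_smul, Real.norm_of_nonneg hη0.le]
    rw [hxn] at h1 ⊢
    linarith
  have hsmall : ‖x - e * x‖ ^ 2 ≤ 2 * η * ‖x‖ ^ 2 := by
    have h1 : star (x - e * x) * (x - e * x) = x * ((1 - e) * (1 - e)) * x := by
      rw [star_sub, star_mul, hx.star_eq, hesa.star_eq]; noncomm_ring
    have h2 : (1 - e) * (1 - e) ≤ 1 - e * e := by
      rw [← sub_nonneg]
      have : 1 - e * e - (1 - e) * (1 - e) = (e - e * e) + (e - e * e) := by noncomm_ring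
      rw [this]
      exact add_nonneg (sub_nonneg.2 hee) (sub_nonneg.2 hee)
    have h3 : ‖x - e * x‖ ^ 2 ≤ ‖x * (1 - e * e) * x‖ := by
      rw [sq, ← CStarRing.norm_star_mul_self, h1]
      refine CStarAlgebra.norm_le_norm_of_nonneg_of_le ?_ (hx.conjugate_le_conjugate h2)
      rw [← h1]; exact star_mul_self_nonneg _
    have h4 : (M + η) • (x * (1 - e * e) * x) ≤ (2 * η) • (x * x) := by
      have h5 := hlow.trans hup
      have h6 : x * (1 - e * e) * x = x * x - x * (e * e) * x := by noncomm_ring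
      rw [h6, smul_sub, sub_le_iff_le_add]
      have h7 : (M + η) • (x * x) = (2 * η) • (x * x) + (M - η) • (x * x) := by
        rw [← add_smul]; congr 1; ring
      rw [h7]
      exact add_le_add_right h5 _
    have h5 : 0 ≤ x * (1 - e * e) * x := hx.conjugate_nonneg (sub_nonneg.2 hee1)
    have h6 := CStarAlgebra.norm_le_norm_of_nonneg_of_le
      (smul_nonneg (by linarith : (0 : ℝ) ≤ M + η) h5) h4
    rw [norm_smul, norm_smul, Real.norm_of_nonneg (by linarith),
      Real.norm_of_nonneg (by linarith), hxn] at h6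
    nlinarith [norm_nonneg (x * (1 - e * e) * x)]
  have hsmall' : ‖x - e * x‖ ≤ r * ‖x‖ := by
    refine abs_le_of_sq_le_sq' ?_ (by positivity) |>.2
    rw [mul_pow]
    nlinarith [sq_nonneg ‖x‖]
  have he1' : ‖e * x‖ ≤ ‖x‖ := by
    have : ‖e‖ ≤ 1 := by
      exact (CStarAlgebra.norm_le_one_iff_of_nonneg e he).2 he1
    exact (norm_mul_le _ _).trans (mul_le_of_le_one_left (norm_nonneg _) this)
  have hdiff : ‖x * d * x - x * k * x‖ ≤ 2 * ‖d‖ * r * ‖x‖ ^ 2 := by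
    have h1 : x * d * x - x * k * x =
        x * d * (x - e * x) + star (x - e * x) * d * (e * x) := by
      rw [star_sub, star_mul, hx.star_eq, hesa.star_eq, hk]; noncomm_ring
    rw [h1]
    refine (norm_add_le _ _).trans ?_
    have h2 : ‖x * d * (x - e * x)‖ ≤ ‖x‖ * ‖d‖ * (r * ‖x‖) :=
      (norm_mul_le _ _).trans (mul_le_mul (norm_mul_le _ _) hsmall' (norm_nonneg _)
        (by positivity))
    have h3 : ‖star (x - e * x) * d * (e * x)‖ ≤ (r * ‖x‖) * ‖d‖ * ‖x‖ := by
      refine (norm_mul_le _ _).trans (mul_le_mul ?_ he1' (norm_nonneg _) (by positivity))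
      refine (norm_mul_le _ _).trans (mul_le_mul_of_nonneg_right ?_ (norm_nonneg _))
      rwa [norm_star]
    nlinarith
  have hrd : 2 * ‖d‖ * r ≤ δ / 2 := by
    rw [hr, mul_div_assoc', div_le_div_iff₀ (by positivity) (by norm_num)]
    nlinarith [norm_nonneg d]
  have htri : ‖x * d * x - M • (x * x)‖ ≤
      ‖x * d * x - x * k * x‖ + ‖x * k * x - M • (x * x)‖ := norm_sub_le_norm_sub_add_norm_sub ..
  nlinarith [sq_nonneg ‖x‖]

end Excision

section SliceState

variable {D : Type u} [CStarAlgebra D]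

theorem exists_excision_of_isSelfAdjoint {g d : D} (hg : HasCore g) (hd : IsSelfAdjoint d) {δ : ℝ}
    (hδ : 0 < δ) :
    ∃ g', HasCore g' ∧ g * g' = g' ∧ ∃ c : ℝ, ∀ x, IsSelfAdjoint x → g' * x = x →
      ‖x * d * x - c • (x * x)‖ ≤ δ * ‖x‖ ^ 2 := by
  have h1 : 1 ≤ d + (‖d‖ + 1) • (1 : D) := by
    have := hd.neg_algebraMap_norm_le_self
    rw [Algebra.algebraMap_eq_smul_one, neg_le_iff_add_nonneg'] at this
    rw [add_smul, one_smul, ← add_assoc, add_comm]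
    exact le_add_of_nonneg_right (by rwa [add_comm])
  obtain ⟨g', hg', hgg', c, hc⟩ := exists_excision_of_one_le hg h1 hδ
  refine ⟨g', hg', hgg', c - (‖d‖ + 1), fun x hx hgx => ?_⟩
  have := hc x hx hgx
  rw [mul_add, add_mul, mul_smul_comm, mul_one, smul_mul_assoc] at this
  rw [sub_smul]
  convert this using 2
  abel

theorem exists_excision {g : D} (hg : HasCore g) (d : D) {δ : ℝ} (hδ : 0 < δ) :
    ∃ g', HasCore g' ∧ g * g' = g' ∧ ∃ c : ℂ, ∀ x, IsSelfAdjoint x → g' * x = x →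
      ‖x * d * x - c • (x * x)‖ ≤ δ * ‖x‖ ^ 2 := by
  obtain ⟨g₁, hg₁, hgg₁, c₁, hc₁⟩ :=
    exists_excision_of_isSelfAdjoint hg (realPart d).2 (half_pos hδ)
  obtain ⟨g₂, hg₂, hgg₂, c₂, hc₂⟩ :=
    exists_excision_of_isSelfAdjoint hg₁ (imaginaryPart d).2 (half_pos hδ)
  refine ⟨g₂, hg₂, by rw [← hgg₂, ← mul_assoc, hgg₁], c₁ + Complex.I * c₂, fun x hx hgx => ?_⟩
  have e₁ := hc₁ x hx (by rw [← hgx, ← mul_assoc, hgg₂])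
  have e₂ := hc₂ x hx hgx
  have hd := realPart_add_I_smul_imaginaryPart d
  have : x * d * x - ((c₁ : ℂ) + Complex.I * c₂) • (x * x) =
      (x * (realPart d : D) * x - c₁ • (x * x)) +
        Complex.I • (x * (imaginaryPart d : D) * x - c₂ • (x * x)) := by
    nth_rewrite 1 [← hd]
    rw [mul_add, add_mul, mul_smul_comm, smul_mul_assoc, add_smul, smul_sub, mul_smul,
      Complex.coe_smul, Complex.coe_smul]
    abel
  rw [this]
  refine (norm_add_le _ _).trans ?_
  rw [norm_smul, Complex.norm_I, one_mul]
  linarith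

theorem exists_excision_finset [Nontrivial D] (F : Finset D) {δ : ℝ} (hδ : 0 < δ) :
    ∃ g : D, HasCore g ∧ ∀ d ∈ F, ∃ c : ℂ, ∀ x, IsSelfAdjoint x → g * x = x →
      ‖x * d * x - c • (x * x)‖ ≤ δ * ‖x‖ ^ 2 := by
  classical
  induction F using Finset.induction_on with
  | empty =>
    exact ⟨1, ⟨IsSelfAdjoint.one D, 1, zero_le_one, CStarRing.norm_one, by simp⟩, by simp⟩
  | insert d s _ ih =>
    obtain ⟨g, hg, h⟩ := ih
    obtain ⟨g', hg', hgg', hc⟩ := exists_excision hg d hδ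
    refine ⟨g', hg', fun d' hd' => ?_⟩
    rcases Finset.mem_insert.1 hd' with rfl | hd'
    · exact hc
    · obtain ⟨c, hc⟩ := h d' hd'
      exact ⟨c, fun x hx hgx => hc x hx (by rw [← hgx, ← mul_assoc, hgg'])⟩

/-- A linear functional excised by self-adjoint elements of norm one. -/
structure SliceState (D : Type u) [CStarAlgebra D] where
  ψ : D →ₗ[ℂ] ℂ
  l : Filter D
  neBot : l.NeBot
  eventually : ∀ᶠ e in l, IsSelfAdjoint e ∧ ‖e‖ = 1
  tendsto : ∀ d, Tendsto (fun e => e * d * e - ψ d • (e * e)) l (𝓝 0)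

theorem norm_sub_le_of_excised {e d : D} (he : IsSelfAdjoint e) (hen : ‖e‖ = 1) (c c' : ℂ) :
    ‖c - c'‖ ≤ ‖e * d * e - c • (e * e)‖ + ‖e * d * e - c' • (e * e)‖ := by
  have h1 : ‖(c - c') • (e * e)‖ = ‖c - c'‖ := by
    rw [norm_smul, he.norm_mul_self, hen]; simp
  rw [← h1]
  have h2 : (c - c') • (e * e) =
      (e * d * e - c' • (e * e)) - (e * d * e - c • (e * e)) := by
    rw [sub_smul]; abel
  rw [h2, add_comm]
  exact norm_sub_le _ _

theorem eq_of_tendsto_excised {l : Filter D} [l.NeBot]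
    (hl : ∀ᶠ e in l, IsSelfAdjoint e ∧ ‖e‖ = 1) {d : D} {c c' : ℂ}
    (h : Tendsto (fun e => e * d * e - c • (e * e)) l (𝓝 0))
    (h' : Tendsto (fun e => e * d * e - c' • (e * e)) l (𝓝 0)) : c = c' := by
  have h0 := h.norm.add h'.norm
  simp only [norm_zero, add_zero] at h0
  have : ‖c - c'‖ ≤ 0 := by
    refine ge_of_tendsto h0 ?_
    filter_upwards [hl] with e he
    exact norm_sub_le_of_excised he.1 he.2 c c'
  exact sub_eq_zero.1 (norm_le_zero_iff.1 this)

theorem exists_sliceState (D : Type u) [CStarAlgebra D] [Nontrivial D] :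
    Nonempty (SliceState D) := by
  classical
  have hex : ∀ i : Finset D × ℕ, ∃ e : D, (IsSelfAdjoint e ∧ ‖e‖ = 1) ∧ ∀ d ∈ i.1, ∃ c : ℂ,
      ‖e * d * e - c • (e * e)‖ ≤ 1 / ((i.2 : ℝ) + 1) := by
    rintro ⟨F, n⟩
    obtain ⟨g, ⟨-, e, he, hen, hge⟩, h⟩ :=
      exists_excision_finset F (Nat.one_div_pos_of_nat (α := ℝ) (n := n))
    refine ⟨e, ⟨IsSelfAdjoint.of_nonneg he, hen⟩, fun d hd => ?_⟩
    obtain ⟨c, hc⟩ := h d hd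
    refine ⟨c, ?_⟩
    simpa [hen] using hc e (IsSelfAdjoint.of_nonneg he) hge
  choose e he hc using hex
  let U : Ultrafilter (Finset D × ℕ) := Ultrafilter.of atTop
  have hU : (U : Filter (Finset D × ℕ)) ≤ atTop := Ultrafilter.of_le _
  have hlim : ∀ d, ∃ c : ℂ,
      Tendsto (fun i => e i * d * e i - c • (e i * e i)) U (𝓝 0) := by
    intro d
    have hc' : ∀ i, ∃ c : ℂ, ({d} : Finset D) ≤ i.1 →
        ‖e i * d * e i - c • (e i * e i)‖ ≤ 1 / ((i.2 : ℝ) + 1) := by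
      intro i
      by_cases hi : ({d} : Finset D) ≤ i.1
      · obtain ⟨c, hc⟩ := hc i d (hi (Finset.mem_singleton_self d))
        exact ⟨c, fun _ => hc⟩
      · exact ⟨0, fun h => absurd h hi⟩
    choose c hc' using hc'
    have hev : ∀ᶠ i in (U : Filter (Finset D × ℕ)), ({d} : Finset D) ≤ i.1 := by
      refine hU ?_
      filter_upwards [eventually_ge_atTop (({d} : Finset D), 0)] with i hi
      exact hi.1
    have hsmall : Tendsto (fun i => e i * d * e i - c i • (e i * e i)) U (𝓝 0) := by
      rw [tendsto_zero_iff_norm_tendsto_zero]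
      have h2 : Tendsto (fun i : Finset D × ℕ => 1 / ((i.2 : ℝ) + 1)) U (𝓝 0) :=
        (tendsto_one_div_add_atTop_nhds_zero_nat.comp
          (tendsto_snd.mono_left (prod_atTop_atTop_eq (α := Finset D) (β := ℕ)).ge)).mono_left hU
      refine squeeze_zero' (Eventually.of_forall fun _ => norm_nonneg _) ?_ h2
      filter_upwards [hev] with i hi using hc' i hi
    have hbound : ∀ᶠ i in (U : Filter (Finset D × ℕ)),
        c i ∈ Metric.closedBall (0 : ℂ) (1 + ‖d‖) := by
      filter_upwards [hev] with i hi
      have h1 := hc' i hi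
      have h2 : (1 : ℝ) / ((i.2 : ℝ) + 1) ≤ 1 := by
        rw [div_le_one (by positivity)]
        have : (0 : ℝ) ≤ i.2 := by positivity
        linarith
      have h3 : ‖c i • (e i * e i)‖ = ‖c i‖ := by
        rw [norm_smul, (he i).1.norm_mul_self, (he i).2]; simp
      have h4 : ‖e i * d * e i‖ ≤ ‖d‖ := by
        refine (norm_mul_le _ _).trans ?_
        rw [(he i).2, mul_one]
        refine (norm_mul_le _ _).trans ?_
        rw [(he i).2, one_mul]
      have h5 := norm_sub_le (e i * d * e i) (e i * d * e i - c i • (e i * e i))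
      rw [sub_sub_cancel, h3] at h5
      rw [mem_closedBall_zero_iff]
      linarith
    obtain ⟨c₀, -, hc₀⟩ := (isCompact_closedBall (0 : ℂ) (1 + ‖d‖)).ultrafilter_le_nhds (U.map c)
      (by rw [le_principal_iff]; exact hbound)
    refine ⟨c₀, ?_⟩
    have h6 : Tendsto (fun i => (c i - c₀) • (e i * e i)) U (𝓝 0) := by
      rw [tendsto_zero_iff_norm_tendsto_zero]
      have : Tendsto (fun i => c i - c₀) U (𝓝 0) := by
        have h7 : Tendsto c U (𝓝 c₀) := hc₀
        simpa using h7.sub_const c₀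
      refine (tendsto_zero_iff_norm_tendsto_zero.1 this).congr fun i => ?_
      rw [norm_smul, (he i).1.norm_mul_self, (he i).2]; simp
    have h8 := hsmall.add h6
    rw [add_zero] at h8
    refine h8.congr fun i => ?_
    rw [sub_smul]; abel
  have hl : ∀ᶠ x in (U : Filter (Finset D × ℕ)).map e, IsSelfAdjoint x ∧ ‖x‖ = 1 := by
    rw [eventually_map]; exact Eventually.of_forall he
  choose ψ hψ using hlim
  have hψ' : ∀ d, Tendsto (fun x => x * d * x - ψ d • (x * x))
      ((U : Filter (Finset D × ℕ)).map e) (𝓝 0) := fun d => tendsto_map'_iff.2 (hψ d)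
  refine ⟨{ ψ := { toFun := ψ, map_add' := ?_, map_smul' := ?_ }
            l := (U : Filter (Finset D × ℕ)).map e
            neBot := inferInstance
            eventually := hl
            tendsto := hψ' }⟩
  · intro d d'
    refine eq_of_tendsto_excised hl (hψ' _) ?_
    have := (hψ' d).add (hψ' d')
    rw [add_zero] at this
    refine this.congr fun x => ?_
    rw [mul_add, add_mul, add_smul]; abel
  · intro c d
    refine eq_of_tendsto_excised hl (hψ' _) ?_
    have := (hψ' d).const_smul c
    rw [smul_zero] at this
    refine this.congr fun x => ?_
    rw [mul_smul_comm, smul_mul_assoc, smul_sub, RingHom.id_apply, smul_smul, smul_eq_mul]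

namespace SliceState

variable (S : SliceState D)

theorem apply_one : S.ψ 1 = 1 := by
  have := S.neBot
  refine eq_of_tendsto_excised S.eventually (S.tendsto 1) ?_
  simp

theorem exists_nonneg_apply_star_mul_self (d : D) : ∃ r : ℝ, 0 ≤ r ∧ S.ψ (star d * d) = r := by
  have := S.neBot
  set c := S.ψ (star d * d) with hc
  have h1 := S.tendsto (star d * d)
  rw [← hc] at h1
  have hreal : star c = c := by
    refine eq_of_tendsto_excised (d := star d * d) S.eventually ?_ h1
    have h2 : Tendsto (fun e => star (e * (star d * d) * e - c • (e * e))) S.l (𝓝 (star 0)) :=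
      h1.star
    rw [star_zero] at h2
    refine h2.congr' ?_
    filter_upwards [S.eventually] with e he
    simp [mul_assoc, he.1.star_eq]
  obtain ⟨r, hr⟩ := Complex.conj_eq_iff_real.1 hreal
  refine ⟨r, ?_, hr⟩
  by_contra! hneg
  have h3 : ‖(r : ℝ)‖ ≤ 0 := by
    refine ge_of_tendsto (tendsto_zero_iff_norm_tendsto_zero.1 h1) ?_
    filter_upwards [S.eventually] with e he
    have h4 : ‖(-r) • (e * e)‖ = ‖r‖ := by
      rw [norm_smul, he.1.norm_mul_self, he.2]; simp
    rw [← h4]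
    have hee : 0 ≤ e * e := by
      nth_rewrite 1 [← he.1.star_eq]; exact star_mul_self_nonneg _
    refine CStarAlgebra.norm_le_norm_of_nonneg_of_le (smul_nonneg (by linarith) hee) ?_
    rw [hr, Complex.coe_smul, neg_smul, sub_eq_add_neg]
    exact le_add_of_nonneg_left (he.1.conjugate_nonneg (star_mul_self_nonneg d))
  rw [norm_le_zero_iff] at h3
  linarith

variable {A : Type v} {T : Type w} [NonUnitalCStarAlgebra A] [NonUnitalCStarAlgebra T]

/-- The slice map `a ⊗ d ↦ ψ(d) a`. -/
def slice (A : Type v) [NonUnitalCStarAlgebra A] : A ⊗[ℂ] D →ₗ[ℂ] A :=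
  TensorProduct.lift (LinearMap.flip ((LinearMap.lsmul ℂ A).comp S.ψ))

@[simp] theorem slice_tmul (a : A) (d : D) : S.slice A (a ⊗ₜ d) = S.ψ d • a := by
  simp [slice]

theorem norm_slice_le (h : CStarTensor A D T) (p : A ⊗[ℂ] D) :
    ‖S.slice A p‖ ≤ ‖h.lift p‖ := by
  have := S.neBot
  have key : Tendsto (fun e => h.lift ((LinearMap.mulLeft ℂ e).lTensor A
      ((LinearMap.mulRight ℂ e).lTensor A p)) - h.tmul (S.slice A p) (e * e)) S.l (𝓝 0) := by
    induction p with
    | zero => simp [h.zero_tmul]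
    | add p q hp hq =>
      have := hp.add hq
      rw [add_zero] at this
      refine this.congr fun e => ?_
      simp only [map_add, h.add_left]
      abel
    | tmul a d =>
      have h1 := (h.clm a).continuous.tendsto 0 |>.comp (S.tendsto d)
      rw [map_zero] at h1
      refine h1.congr fun e => ?_
      simp only [Function.comp, h.clm_apply, h.tmul_sub, h.smul_right, LinearMap.lTensor_tmul,
        LinearMap.mulLeft_apply, LinearMap.mulRight_apply, h.lift_tmul, slice_tmul, h.smul_left,
        mul_assoc]
  have h2 : Tendsto (fun e => ‖h.lift p‖ + ‖h.lift ((LinearMap.mulLeft ℂ e).lTensor A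
      ((LinearMap.mulRight ℂ e).lTensor A p)) - h.tmul (S.slice A p) (e * e)‖) S.l
      (𝓝 (‖h.lift p‖ + 0)) := tendsto_const_nhds.add (tendsto_zero_iff_norm_tendsto_zero.1 key)
  rw [add_zero] at h2
  refine ge_of_tendsto h2 ?_
  filter_upwards [S.eventually] with e he
  have h3 : ‖h.tmul (S.slice A p) (e * e)‖ = ‖S.slice A p‖ := by
    rw [h.norm_tmul, he.1.norm_mul_self, he.2]; simp
  have h4 := h.norm_lift_mulLeft_le e ((LinearMap.mulRight ℂ e).lTensor A p)
  have h5 := h.norm_lift_mulRight_le e p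
  rw [he.2, one_mul] at h4 h5
  have h6 := norm_sub_le (h.lift ((LinearMap.mulLeft ℂ e).lTensor A
      ((LinearMap.mulRight ℂ e).lTensor A p))) (h.lift ((LinearMap.mulLeft ℂ e).lTensor A
      ((LinearMap.mulRight ℂ e).lTensor A p)) - h.tmul (S.slice A p) (e * e))
  rw [sub_sub_cancel, h3] at h6
  linarith

end SliceState

end SliceState

namespace SliceState

variable {D : Type u} [CStarAlgebra D] (S : SliceState D)

theorem apply_star (d : D) : S.ψ (star d) = star (S.ψ d) := by
  have := S.neBot
  refine eq_of_tendsto_excised (d := star d) S.eventually (S.tendsto _) ?_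
  have h : Tendsto (fun e => star (e * d * e - S.ψ d • (e * e))) S.l (𝓝 (star 0)) :=
    (S.tendsto d).star
  rw [star_zero] at h
  refine h.congr' ?_
  filter_upwards [S.eventually] with e he
  simp [mul_assoc, he.1.star_eq]

variable {A : Type v} {T : Type w} {E : Type x} [NonUnitalCStarAlgebra A]
  [NonUnitalCStarAlgebra T] [NonUnitalCStarAlgebra E]

theorem sum_smul_nonneg {P : Type*} [NonUnitalRing P] [StarRing P] [Module ℂ P]
    [IsScalarTower ℂ P P] [SMulCommClass ℂ P P] [StarModule ℂ P] (Φ : P →ₗ[ℂ] E)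
    (hΦ : ∀ p, 0 ≤ Φ (star p * p)) {ι : Type*} [Fintype ι] (p : ι → P) (g : ι → D) :
    0 ≤ ∑ s, ∑ t, S.ψ (star (g s) * g t) • Φ (star (p s) * p t) := by
  obtain ⟨M, hM⟩ := exists_conjTranspose_mul_self (fun s t => S.ψ (star (g s) * g t))
    (fun s t => by rw [← S.apply_star]; simp) (fun z => by
      obtain ⟨r, hr, h⟩ := S.exists_nonneg_apply_star_mul_self (∑ s, z s • g s)
      refine ⟨r, hr, ?_⟩
      rw [← h, star_sum, Finset.sum_mul_sum, map_sum]
      refine Finset.sum_congr rfl fun s _ => ?_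
      rw [map_sum]
      refine Finset.sum_congr rfl fun t _ => ?_
      simp [mul_comm])
  have : ∑ s, ∑ t, S.ψ (star (g s) * g t) • Φ (star (p s) * p t) =
      ∑ m, Φ (star (∑ s, M m s • p s) * ∑ t, M m t • p t) := by
    simp only [hM, star_sum, Finset.sum_mul_sum, map_sum, Finset.sum_smul, star_smul,
      smul_mul_assoc, mul_smul_comm, map_smul, smul_smul]
    rw [Finset.sum_comm' (t' := Finset.univ) (s' := fun _ => Finset.univ) (by simp)]
    rw [Finset.sum_comm]
    simp_rw [fun s => Finset.sum_comm (s := (Finset.univ : Finset ι))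
      (t := (Finset.univ : Finset ι)) (f := fun t m => (star (M m s) * M m t) •
        Φ (star (p s) * p t))]
    rw [Finset.sum_comm]
    simp only [mul_comm]
  rw [this]
  exact Finset.sum_nonneg fun m _ => hΦ _

/-- The identity of `D` is a point-norm limit of maps
`d ↦ ∑ ψ(y_k* d y_l) x_k* x_l`. -/
def Approximates : Prop :=
  ∀ (F : Finset D) (ε : ℝ), 0 < ε → ∃ (n : ℕ) (x y : Fin n → D), ∀ d ∈ F,
    ‖∑ k, ∑ l, S.ψ (star (y k) * d * y l) • (star (x k) * x l) - d‖ ≤ ε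

variable {S}

theorem Approximates.nonneg_of_lift_nonneg (hS : S.Approximates) (h : CStarTensor A D T)
    {Φ : A ⊗[ℂ] D →ₗ[ℂ] E} {K : ℝ} (hK : 0 ≤ K) (hΦK : ∀ a d, ‖Φ (a ⊗ₜ d)‖ ≤ K * ‖a‖ * ‖d‖)
    (hΦ : ∀ p, 0 ≤ Φ (star p * p)) {q : A ⊗[ℂ] D} (hq : 0 ≤ h.lift q) : 0 ≤ Φ q := by
  classical
  suffices h0 : Φ q ∈ closure {e : E | 0 ≤ e} from CStarAlgebra.isClosed_nonneg.closure_subset h0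
  refine Metric.mem_closure_iff.2 fun ε hε => ?_
  obtain ⟨m, a, d, rfl⟩ := TensorProduct.exists_sum_tmul_eq q
  set q := ∑ j, a j ⊗ₜ[ℂ] d j with hqdef
  set N := ∑ j, K * ‖a j‖ with hN
  have hN0 : 0 ≤ N := Finset.sum_nonneg fun j _ => by positivity
  obtain ⟨n, x, y, hxy⟩ := hS (Finset.univ.image d) (ε / 2 / (N + 1)) (by positivity)
  let Θ : A ⊗[ℂ] D →ₗ[ℂ] E := ∑ k, ∑ l, Φ ∘ₗ (TensorProduct.mk ℂ A D).flip (star (x k) * x l) ∘ₗ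
    S.slice A ∘ₗ (LinearMap.mulLeft ℂ (star (y k))).lTensor A ∘ₗ
      (LinearMap.mulRight ℂ (y l)).lTensor A
  have hΘ : ∀ b c, Θ (b ⊗ₜ c) =
      ∑ k, ∑ l, S.ψ (star (y k) * c * y l) • Φ (b ⊗ₜ (star (x k) * x l)) := by
    intro b c
    simp [Θ, LinearMap.sum_apply, mul_assoc]
  have hΘq : ‖Θ q - Φ q‖ ≤ ε / 2 := by
    have h1 : Θ q - Φ q = ∑ j, Φ (a j ⊗ₜ
        (∑ k, ∑ l, S.ψ (star (y k) * d j * y l) • (star (x k) * x l) - d j)) := by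
      simp only [hqdef, map_sum, hΘ, ← Finset.sum_sub_distrib, TensorProduct.tmul_sub,
        TensorProduct.tmul_sum, TensorProduct.tmul_smul, map_sub, map_smul]
    rw [h1]
    have h2 : ∀ j, ‖Φ (a j ⊗ₜ
        (∑ k, ∑ l, S.ψ (star (y k) * d j * y l) • (star (x k) * x l) - d j))‖ ≤
          K * ‖a j‖ * (ε / 2 / (N + 1)) := fun j =>
      (hΦK _ _).trans (mul_le_mul_of_nonneg_left (hxy _ (by simp)) (by positivity))
    refine (norm_sum_le_of_le _ fun j _ => h2 j).trans ?_
    rw [← Finset.sum_mul, ← hN, mul_div_assoc', div_le_iff₀ (by positivity)]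
    nlinarith
  obtain ⟨C, hC0, hC⟩ : ∃ C : ℝ, 0 ≤ C ∧ ∀ p, ‖Θ p‖ ≤ C * ‖h.lift p‖ := by
    refine ⟨∑ k, ∑ l, K * (‖star (y k)‖ * ‖y l‖) * ‖star (x k) * x l‖,
      Finset.sum_nonneg fun k _ => Finset.sum_nonneg fun l _ => by positivity, fun p => ?_⟩
    simp only [Θ, LinearMap.sum_apply, Finset.sum_mul]
    refine norm_sum_le_of_le _ fun k _ => norm_sum_le_of_le _ fun l _ => ?_
    refine (hΦK _ _).trans ?_
    have h1 := (S.norm_slice_le h ((LinearMap.mulLeft ℂ (star (y k))).lTensor A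
      ((LinearMap.mulRight ℂ (y l)).lTensor A p))).trans ((h.norm_lift_mulLeft_le _ _).trans
        (mul_le_mul_of_nonneg_left (h.norm_lift_mulRight_le _ _) (norm_nonneg _)))
    have h2 := mul_le_mul_of_nonneg_right (mul_le_mul_of_nonneg_left h1 hK)
      (norm_nonneg (star (x k) * x l))
    refine h2.trans (le_of_eq ?_)
    ring
  obtain ⟨R, hR⟩ := CStarAlgebra.nonneg_iff_eq_star_mul_self.1 hq
  obtain ⟨r, hr⟩ : ∃ r, ‖h.lift (star r * r) - h.lift q‖ < ε / 2 / (C + 1) := by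
    have hcont : Continuous fun s : T => star s * s := by fun_prop
    obtain ⟨δ, hδ, hδ'⟩ := Metric.continuous_iff.1 hcont R (ε / 2 / (C + 1)) (by positivity)
    obtain ⟨r, hr⟩ := h.exists_lift_near R hδ
    refine ⟨r, ?_⟩
    rw [hR, map_mul, map_star, ← dist_eq_norm]
    exact hδ' _ (by rwa [dist_eq_norm])
  refine ⟨Θ (star r * r), ?_, ?_⟩
  · obtain ⟨m', b, c, rfl⟩ := TensorProduct.exists_sum_tmul_eq r
    have h3 := S.sum_smul_nonneg Φ hΦ (fun s : Fin m' × Fin n => b s.1 ⊗ₜ[ℂ] x s.2)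
      (fun s => c s.1 * y s.2)
    refine h3.trans_eq ?_
    simp only [star_sum, Finset.sum_mul_sum, map_sum, TensorProduct.star_tmul,
      Algebra.TensorProduct.tmul_mul_tmul, hΘ, Fintype.sum_prod_type, star_mul, mul_assoc]
    refine Finset.sum_congr rfl fun i _ => ?_
    rw [Finset.sum_comm]
  · rw [dist_eq_norm, ← norm_neg, neg_sub]
    have h1 : Θ (star r * r) - Φ q = Θ (star r * r - q) + (Θ q - Φ q) := by
      rw [map_sub]; abel
    rw [h1]
    have h2 : ‖Θ (star r * r - q)‖ < ε / 2 := by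
      refine (hC _).trans_lt ?_
      rw [map_sub]
      have := mul_le_mul_of_nonneg_left hr.le hC0
      refine this.trans_lt ?_
      rw [mul_div_assoc', div_lt_iff₀ (by positivity)]
      nlinarith
    linarith [norm_add_le (Θ (star r * r - q)) (Θ q - Φ q)]

theorem Approximates.norm_apply_star_mul_self_le (hS : S.Approximates) (h : CStarTensor A D T)
    {Φ : A ⊗[ℂ] D →ₗ[ℂ] E} {K : ℝ} (hK : 0 ≤ K) (hΦK : ∀ a d, ‖Φ (a ⊗ₜ d)‖ ≤ K * ‖a‖ * ‖d‖)
    (hΦ : ∀ p, 0 ≤ Φ (star p * p)) (p : A ⊗[ℂ] D) :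
    ‖Φ (star p * p)‖ ≤ K * ‖h.lift p‖ ^ 2 := by
  rcases subsingleton_or_nontrivial D with hD | hD
  · have : star p * p = 0 := by
      have : p = 0 := by
        induction p with
        | zero => rfl
        | add p q hp hq => rw [hp, hq, add_zero]
        | tmul a d => rw [Subsingleton.elim d 0, TensorProduct.tmul_zero]
      rw [this, mul_zero]
    rw [this, map_zero, norm_zero]
    positivity
  have hlim : ∀ q : A ⊗[ℂ] D, Tendsto (fun f : A => Φ ((f ⊗ₜ (1 : D)) * q * (f ⊗ₜ (1 : D))))
      (CStarAlgebra.approximateUnit A) (𝓝 (Φ q)) := by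
    intro q
    induction q with
    | zero => simp
    | add p q hp hq => simpa [mul_add, add_mul] using hp.add hq
    | tmul a d =>
      simp only [Algebra.TensorProduct.tmul_mul_tmul, one_mul, mul_one]
      let L : A →L[ℂ] E := (Φ ∘ₗ (TensorProduct.mk ℂ A D).flip d).mkContinuous (K * ‖d‖)
        fun a => by simpa [mul_right_comm] using hΦK a d
      have h1 : Tendsto (fun f => f * a * f) (CStarAlgebra.approximateUnit A) (𝓝 a) := by
        have h2 : Tendsto (fun f => (f * a - a) * f + a * f)
            (CStarAlgebra.approximateUnit A) (𝓝 (0 + a)) := by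
          refine Tendsto.add ?_ (tendsto_mul_approximateUnit a)
          have h3 : Tendsto (fun f => ‖f * a - a‖) (CStarAlgebra.approximateUnit A) (𝓝 0) :=
            tendsto_iff_norm_sub_tendsto_zero.1 (tendsto_approximateUnit_mul a)
          refine squeeze_zero_norm' ?_ h3
          filter_upwards [eventually_approximateUnit A] with f hf
          exact (norm_mul_le _ _).trans (mul_le_of_le_one_right (norm_nonneg _) hf.2)
        rw [zero_add] at h2
        refine h2.congr fun f => ?_
        rw [sub_mul, sub_add_cancel]
      exact (L.continuous.tendsto a).comp h1
  refine le_of_tendsto (hlim _).norm ?_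
  filter_upwards [eventually_approximateUnit A] with f hf
  set F : A ⊗[ℂ] D := f ⊗ₜ (1 : D) with hF
  have hFs : star F = F := by simp [hF, hf.1]
  have hFF : F * F = (f * f) ⊗ₜ (1 : D) := by simp [hF]
  set L := ‖h.lift p‖ with hL
  have hle : h.lift (F * (star p * p) * F) ≤ h.lift (((L ^ 2 : ℝ) : ℂ) • (F * F)) := by
    have h1 := CStarAlgebra.star_left_conjugate_le_norm_smul (a := h.lift F)
      (b := star (h.lift p) * h.lift p) (IsSelfAdjoint.star_mul_self _)
    rw [CStarRing.norm_star_mul_self, ← sq, ← map_star, hFs] at h1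
    rw [map_smul, map_mul, map_mul, map_mul, map_mul, map_star, Complex.coe_smul]
    exact h1
  have hle' : Φ (F * (star p * p) * F) ≤ Φ (((L ^ 2 : ℝ) : ℂ) • (F * F)) := by
    rw [← sub_nonneg, ← map_sub]
    refine hS.nonneg_of_lift_nonneg h hK hΦK hΦ ?_
    rwa [map_sub, sub_nonneg]
  have h0 : 0 ≤ Φ (F * (star p * p) * F) := by
    have := hΦ (p * F)
    rwa [star_mul, hFs, show F * star p * (p * F) = F * (star p * p) * F by
      simp only [mul_assoc]] at this
  refine (CStarAlgebra.norm_le_norm_of_nonneg_of_le h0 hle').trans ?_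
  rw [map_smul, norm_smul, hFF, Complex.norm_real, Real.norm_of_nonneg (by positivity), mul_comm]
  refine mul_le_mul_of_nonneg_right ?_ (by positivity)
  refine (hΦK _ _).trans ?_
  rw [CStarRing.norm_one, mul_one]
  refine mul_le_of_le_one_right hK ((norm_mul_le _ _).trans ?_)
  exact mul_le_one₀ hf.2 (norm_nonneg _) hf.2

theorem Approximates.norm_starHom_le (hS : S.Approximates) (h : CStarTensor A D T)
    (Φ : A ⊗[ℂ] D →⋆ₙₐ[ℂ] E) (p : A ⊗[ℂ] D) : ‖Φ p‖ ≤ ‖h.lift p‖ := by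
  have h1 := hS.norm_apply_star_mul_self_le h (Φ := (Φ : A ⊗[ℂ] D →ₗ[ℂ] E)) zero_le_one
    (fun a d => by simpa using norm_starHom_tmul_le Φ a d)
    (fun p => by
      have : (Φ : A ⊗[ℂ] D →ₗ[ℂ] E) (star p * p) = star (Φ p) * Φ p := by
        rw [← map_star, ← map_mul]; rfl
      rw [this]; exact star_mul_self_nonneg _) p
  have h2 : (Φ : A ⊗[ℂ] D →ₗ[ℂ] E) (star p * p) = star (Φ p) * Φ p := by
    rw [← map_star, ← map_mul]; rfl
  rw [h2, CStarRing.norm_star_mul_self, one_mul] at h1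
  exact abs_le_of_sq_le_sq' (by rwa [sq]) (norm_nonneg _) |>.2

/-- *-homomorphisms on the algebraic tensor product extend to any C*-tensor product. -/
theorem Approximates.exists_extend (hS : S.Approximates) (h : CStarTensor A D T)
    (Φ : A ⊗[ℂ] D →⋆ₙₐ[ℂ] E) : ∃ ρ : T →⋆ₙₐ[ℂ] E, ∀ p, ρ (h.lift p) = Φ p :=
  h.exists_extend Φ (hS.norm_starHom_le h Φ)

end SliceState

section K1

variable {D : Type u} [CStarAlgebra D]

/-- The unitary `diag(u, v)`. -/
def diagUnitary (u v : unitary D) : unitary (Matrix (Fin 2) (Fin 2) D) :=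
  ⟨Matrix.diagonal fun i => if i = 0 then (u : D) else v, by
    rw [Unitary.mem_iff, Matrix.star_eq_conjTranspose, Matrix.diagonal_conjTranspose,
      Matrix.diagonal_mul_diagonal, Matrix.diagonal_mul_diagonal]
    constructor <;> rw [← Matrix.diagonal_one] <;> congr 1 <;> ext i <;> fin_cases i <;> simp⟩

theorem diagUnitary_mul (u v u' v' : unitary D) :
    diagUnitary u v * diagUnitary u' v' = diagUnitary (u * u') (v * v') := by
  refine Subtype.ext ((Matrix.diagonal_mul_diagonal _ _).trans ?_)
  refine congrArg Matrix.diagonal ?_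
  ext i
  fin_cases i <;> simp

theorem diagUnitary_one : diagUnitary (1 : unitary D) 1 = 1 := by
  refine Subtype.ext (Eq.trans ?_ Matrix.diagonal_one)
  refine congrArg Matrix.diagonal ?_
  ext i
  fin_cases i <;> simp

theorem inv_diagUnitary (u v : unitary D) : (diagUnitary u v)⁻¹ = diagUnitary u⁻¹ v⁻¹ :=
  inv_eq_of_mul_eq_one_right (by
    rw [diagUnitary_mul, mul_inv_cancel, mul_inv_cancel, diagUnitary_one])

/-- The rotation matrix by the angle `t`. -/
def rotationUnitary (D : Type u) [CStarAlgebra D] (t : ℝ) : unitary (Matrix (Fin 2) (Fin 2) D) :=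
  ⟨!![(Real.cos t : ℂ) • 1, (-Real.sin t : ℂ) • 1; (Real.sin t : ℂ) • 1, (Real.cos t : ℂ) • 1], by
    have h : (Real.cos t : ℂ) * Real.cos t + Real.sin t * Real.sin t = 1 := by
      have := Real.cos_sq_add_sin_sq t
      rw [sq, sq] at this
      exact_mod_cast this
    have h' : (Real.sin t : ℂ) * Real.sin t + Real.cos t * Real.cos t = 1 := by rw [add_comm, h]
    have hc : (starRingEnd ℂ) (Complex.cos t) = Complex.cos t := by
      rw [← Complex.ofReal_cos, Complex.conj_ofReal]
    have hs : (starRingEnd ℂ) (Complex.sin t) = Complex.sin t := by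
      rw [← Complex.ofReal_sin, Complex.conj_ofReal]
    push_cast at h h'
    rw [Unitary.mem_iff, Matrix.star_eq_conjTranspose]
    constructor <;> ext i j <;> fin_cases i <;> fin_cases j <;>
      simp [Matrix.mul_apply, Matrix.conjTranspose_apply, smul_smul, ← add_smul, h, h', hc, hs,
        mul_comm]⟩

theorem continuous_rotationUnitary : Continuous (rotationUnitary D) := by
  refine Continuous.subtype_mk ?_ _
  refine continuous_matrix fun i j => ?_
  fin_cases i <;> fin_cases j <;> simp <;> fun_prop

theorem joined_diagUnitary_swap (y : unitary D) : Joined (diagUnitary y 1) (diagUnitary 1 y) := by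
  have h0 : rotationUnitary D 0 = 1 := by
    refine Subtype.ext ?_
    ext i j
    fin_cases i <;> fin_cases j <;> simp [rotationUnitary]
  have h1 : rotationUnitary D (Real.pi / 2) * diagUnitary y 1 =
      diagUnitary 1 y * rotationUnitary D (Real.pi / 2) := by
    refine Subtype.ext ?_
    ext i j
    fin_cases i <;> fin_cases j <;>
      simp [rotationUnitary, diagUnitary, Matrix.mul_apply, Matrix.diagonal, Matrix.vecHead,
        Matrix.vecTail]
  have h2 : Joined (rotationUnitary D 0) (rotationUnitary D (Real.pi / 2)) :=
    (PathConnectedSpace.joined _ _).map continuous_rotationUnitary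
  have h3 := (h2.mul (Joined.refl (diagUnitary y 1))).mul h2.inv
  rwa [h0, h1, one_mul, inv_one, mul_one, mul_inv_cancel_right] at h3

theorem representsZeroInK1_commutator (x y : unitary D) :
    RepresentsZeroInK1 ((x * y * x⁻¹ * y⁻¹ : unitary D) : D) := by
  have h0 : stabUnitary 1 ((x * y * x⁻¹ * y⁻¹ : unitary D) : D) =
      diagUnitary (x * y * x⁻¹ * y⁻¹) 1 := by
    refine congrArg Matrix.diagonal ?_
    ext i
    fin_cases i <;> simp
  refine ⟨1, h0 ▸ (diagUnitary _ _).2, ?_⟩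
  simp only [h0]
  have h1 := (((Joined.refl (diagUnitary x 1)).mul (joined_diagUnitary_swap y)).mul
    (Joined.refl (diagUnitary x 1)⁻¹)).mul (joined_diagUnitary_swap y).inv
  simpa only [inv_diagUnitary, diagUnitary_mul, mul_one, one_mul, inv_one, mul_inv_cancel,
    diagUnitary_one] using h1

end K1

section Conjugate

variable {X : Type x} {B : Type w} [CStarAlgebra B]

/-- Approximate unitary equivalence on finite sets, by unitaries of a unital C*-algebra. -/
def FiniteUnitaryEquiv (φ ψ : X → B) : Prop :=
  ∀ (F : Finset X) (ε : ℝ), 0 < ε → ∃ u : unitary B, ∀ a ∈ F,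
    ‖star (u : B) * φ a * u - ψ a‖ < ε

theorem ApproxUnitaryEquiv.finiteUnitaryEquiv {φ ψ : X → B} (h : ApproxUnitaryEquiv φ ψ) :
    FiniteUnitaryEquiv φ ψ := by
  obtain ⟨v, hv, h⟩ := h
  intro F ε hε
  have h1 : ∀ᶠ n in atTop, ∀ a ∈ F,
      ‖star (v n) * (φ a : 𝓜(ℂ, B)) * v n - (ψ a : 𝓜(ℂ, B))‖ < ε :=
    (Finset.eventually_all F).2 fun a _ => (h a).eventually (gt_mem_nhds hε)
  obtain ⟨n, hn⟩ := h1.exists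
  have hfst : ∀ (m : 𝓜(ℂ, B)) (b : B), m.fst b = m.fst 1 * b := fun m b => by
    have h2 := m.central 1 1
    have h3 := m.central 1 b
    simp only [one_mul, mul_one] at h2 h3
    rw [← h2, h3]
  have hst : (star (v n)).fst 1 = star ((v n).fst 1) := by
    rw [DoubleCentralizer.star_fst, star_one]
    have := (v n).central 1 1
    simp only [one_mul, mul_one] at this
    rw [this]
  have hmul : ∀ m m' : 𝓜(ℂ, B), (m * m').fst 1 = m.fst 1 * m'.fst 1 := fun m m' => by
    rw [DoubleCentralizer.mul_fst, mul_apply_eq_comp, hfst]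
  have hone : (1 : 𝓜(ℂ, B)).fst 1 = 1 := by simp
  refine ⟨⟨(v n).fst 1, ?_⟩, fun a ha => ?_⟩
  · rw [Unitary.mem_iff, ← hst, ← hmul, ← hmul, (Unitary.mem_iff.1 (hv n)).1,
      (Unitary.mem_iff.1 (hv n)).2]
    exact ⟨hone, hone⟩
  · refine lt_of_le_of_lt ?_ (hn a ha)
    set m := star (v n) * (φ a : 𝓜(ℂ, B)) * v n - (ψ a : 𝓜(ℂ, B)) with hm
    have h4 : star ((v n).fst 1) * φ a * (v n).fst 1 - ψ a = m.fst 1 := by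
      rw [hm, DoubleCentralizer.sub_fst, sub_apply, hmul, hmul, hst]
      simp
    rw [h4, ← DoubleCentralizer.norm_fst]
    rcases subsingleton_or_nontrivial B with hB | hB
    · rw [Subsingleton.elim (m.fst 1) 0, norm_zero]
      exact norm_nonneg _
    · simpa using m.fst.le_opNorm 1

theorem norm_unitary_conj (u : unitary B) (b : B) : ‖star (u : B) * b * u‖ = ‖b‖ := by
  rw [CStarRing.norm_mul_coe_unitary, ← Unitary.coe_star, CStarRing.norm_coe_unitary_mul]

theorem norm_unitary_conj_sub (u : unitary B) (b c : B) :
    ‖star (u : B) * b * u - c‖ = ‖(u : B) * c * star (u : B) - b‖ := by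
  rw [← norm_unitary_conj u (u * c * star (u : B) - b), norm_sub_rev]
  congr 1
  rw [mul_sub, sub_mul]
  congr 1
  simp only [mul_assoc, Unitary.coe_star_mul_self, mul_one]
  rw [← mul_assoc, Unitary.coe_star_mul_self, one_mul]

theorem FiniteUnitaryEquiv.symm {φ ψ : X → B} (h : FiniteUnitaryEquiv φ ψ) :
    FiniteUnitaryEquiv ψ φ := by
  intro F ε hε
  obtain ⟨u, hu⟩ := h F ε hε
  refine ⟨star u, fun a ha => ?_⟩
  rw [norm_unitary_conj_sub]
  simpa using hu a ha

theorem FiniteUnitaryEquiv.trans {φ ψ χ : X → B} (h : FiniteUnitaryEquiv φ ψ)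
    (h' : FiniteUnitaryEquiv ψ χ) : FiniteUnitaryEquiv φ χ := by
  intro F ε hε
  obtain ⟨u, hu⟩ := h F (ε / 2) (half_pos hε)
  obtain ⟨v, hv⟩ := h' F (ε / 2) (half_pos hε)
  refine ⟨u * v, fun a ha => ?_⟩
  have h1 : star ((u * v : unitary B) : B) * φ a * (u * v : unitary B) - χ a =
      star (v : B) * (star (u : B) * φ a * u - ψ a) * v + (star (v : B) * ψ a * v - χ a) := by
    rw [Submonoid.coe_mul, star_mul]; noncomm_ring
  rw [h1]
  refine (norm_add_le _ _).trans_lt ?_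
  rw [norm_unitary_conj]
  linarith [hu a ha, hv a ha]

/-- A *-homomorphism preserving units maps unitaries to unitaries. -/
theorem map_mem_unitary {C : Type*} [CStarAlgebra C] {π : B →⋆ₙₐ[ℂ] C} (h1 : π 1 = 1)
    (u : unitary B) : π u ∈ unitary C := by
  rw [Unitary.mem_iff, ← map_star, ← map_mul, ← map_mul, Unitary.coe_star_mul_self,
    Unitary.mul_star_self_of_mem u.2]
  exact ⟨h1, h1⟩

theorem FiniteUnitaryEquiv.map {C : Type*} [CStarAlgebra C] {φ ψ : X → B}
    (h : FiniteUnitaryEquiv φ ψ) (π : B →⋆ₙₐ[ℂ] C) (h1 : π 1 = 1) :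
    FiniteUnitaryEquiv (π ∘ φ) (π ∘ ψ) := by
  intro F ε hε
  obtain ⟨u, hu⟩ := h F ε hε
  refine ⟨⟨π u, map_mem_unitary h1 u⟩, fun a ha => ?_⟩
  refine lt_of_le_of_lt ?_ (hu a ha)
  simpa [-Unitary.coe_star, map_star] using
    NonUnitalStarAlgHom.norm_apply_le π (star (u : B) * φ a * u - ψ a)

theorem FiniteUnitaryEquiv.comp {Y : Type*} {φ ψ : X → B} (h : FiniteUnitaryEquiv φ ψ)
    (f : Y → X) : FiniteUnitaryEquiv (φ ∘ f) (ψ ∘ f) := by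
  classical
  intro F ε hε
  obtain ⟨u, hu⟩ := h (F.image f) ε hε
  exact ⟨u, fun a ha => hu _ (Finset.mem_image_of_mem f ha)⟩

end Conjugate

section Flip

variable {D TD : Type u} [CStarAlgebra D] [CStarAlgebra TD] (h : MinTensor D D TD)

/-- The C*-tensor product with the factors interchanged. -/
def CStarTensor.swap {A B T : Type*} [NonUnitalCStarAlgebra A] [NonUnitalCStarAlgebra B]
    [NonUnitalCStarAlgebra T] (h : CStarTensor A B T) : CStarTensor B A T where
  tmul b a := h.tmul a b
  add_left _ _ _ := h.add_right _ _ _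
  add_right _ _ _ := h.add_left _ _ _
  smul_left _ _ _ := h.smul_right _ _ _
  smul_right _ _ _ := h.smul_left _ _ _
  mul_tmul _ _ _ _ := h.mul_tmul _ _ _ _
  star_tmul _ _ := h.star_tmul _ _
  norm_tmul _ _ := (h.norm_tmul _ _).trans (mul_comm _ _)
  dense_span := by
    have : {t : T | ∃ b a, h.tmul a b = t} = {t : T | ∃ a b, h.tmul a b = t} :=
      Set.ext fun t => exists_comm
    rw [this]
    exact h.dense_span

/-- The C*-tensor product with the first factor twisted by an automorphism. -/
def CStarTensor.twist {A B T : Type*} [NonUnitalCStarAlgebra A] [NonUnitalCStarAlgebra B]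
    [NonUnitalCStarAlgebra T] (h : CStarTensor A B T) (α : A ≃⋆ₐ[ℂ] A) : CStarTensor A B T where
  tmul a b := h.tmul (α a) b
  add_left _ _ _ := by rw [map_add, h.add_left]
  add_right _ _ _ := h.add_right _ _ _
  smul_left _ _ _ := by rw [map_smul, h.smul_left]
  smul_right _ _ _ := h.smul_right _ _ _
  mul_tmul _ _ _ _ := by rw [map_mul, h.mul_tmul]
  star_tmul _ _ := by rw [map_star, h.star_tmul]
  norm_tmul a b := by
    have := NonUnitalStarAlgHom.norm_map (α : A →⋆ₙₐ[ℂ] A) α.injective a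
    rw [h.norm_tmul]
    exact congrArg (· * ‖b‖) this
  dense_span := by
    have : {t : T | ∃ a b, h.tmul (α a) b = t} = {t : T | ∃ a b, h.tmul a b = t} :=
      Set.ext fun t => (EquivLike.surjective α).exists (p := fun a => ∃ b, h.tmul a b = t) |>.symm
    rw [this]
    exact h.dense_span

theorem CStarTensor.hom_ext {A B T E : Type*} [NonUnitalCStarAlgebra A] [NonUnitalCStarAlgebra B]
    [NonUnitalCStarAlgebra T] [NonUnitalCStarAlgebra E] (h : CStarTensor A B T)
    {f g : T →⋆ₙₐ[ℂ] E} (hfg : ∀ a b, f (h.tmul a b) = g (h.tmul a b)) (t : T) : f t = g t := by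
  refine congrFun (h.denseRange_lift.equalizer (map_continuous f) (map_continuous g) ?_) t
  ext p
  simp only [Function.comp_apply]
  induction p with
  | zero => simp
  | add p q hp hq => rw [map_add, map_add, map_add, hp, hq]
  | tmul a b => rw [h.lift_tmul, hfg]

theorem MinTensor.exists_flip : ∃ s : TD ≃⋆ₐ[ℂ] TD, ∀ a b, s (h.tmul a b) = h.tmul b a := by
  obtain ⟨s, hs⟩ := h.minimal TD h.toCStarTensor.swap
  have hs' : ∀ a b, s (h.tmul a b) = h.tmul b a := fun a b => hs b a
  have hss : ∀ t, s (s t) = t := h.toCStarTensor.hom_ext (f := s.comp s)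
    (g := NonUnitalStarAlgHom.id ℂ TD) fun a b => by simp [hs']
  exact ⟨{ s with
    toFun := s
    invFun := s
    left_inv := hss
    right_inv := hss
    map_mul' := map_mul s
    map_add' := map_add s
    map_star' := map_star s
    map_smul' := map_smul s }, hs'⟩

theorem IsStronglySelfAbsorbing.halfFlip (h1 : h.tmul 1 1 = 1) (φ : D ≃⋆ₐ[ℂ] TD)
    (hφ : ApproxUnitaryEquiv φ h.fst) : FiniteUnitaryEquiv h.fst h.snd := by
  obtain ⟨s, hs⟩ := h.exists_flip
  let α : D ≃⋆ₐ[ℂ] D := (φ.trans s).trans φ.symm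
  have hα : ∀ d, φ (α d) = s (φ d) := fun d => φ.apply_symm_apply _
  have hα1 : α 1 = 1 := map_one α
  obtain ⟨π, hπ⟩ := h.minimal TD (h.toCStarTensor.twist α)
  replace hπ : ∀ a b, π (h.tmul (α a) b) = h.tmul a b := hπ
  have hπ1 : π 1 = 1 := by
    have := hπ 1 1
    rwa [hα1, h1] at this
  have hs1 : (s : TD →⋆ₙₐ[ℂ] TD) 1 = 1 := map_one s
  have e0 := hφ.finiteUnitaryEquiv
  have e1 : FiniteUnitaryEquiv (h.fst ∘ α) h.snd := by
    have e2 := e0.map (s : TD →⋆ₙₐ[ℂ] TD) hs1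
    have e3 : (s : TD →⋆ₙₐ[ℂ] TD) ∘ φ = φ ∘ α := funext fun d => (hα d).symm
    have e4 : (s : TD →⋆ₙₐ[ℂ] TD) ∘ h.fst = h.snd := funext fun d => hs d 1
    rw [e3, e4] at e2
    exact (e0.comp α).symm.trans e2
  have e5 := e1.map π hπ1
  have e6 : π ∘ h.fst ∘ α = h.fst := funext fun d => hπ d 1
  have e7 : π ∘ h.snd = h.snd := funext fun d => by
    have := hπ 1 d
    rwa [hα1] at this
  rwa [e6, e7] at e5

end Flip

section HalfFlip

variable {D TD : Type u} [CStarAlgebra D] [CStarAlgebra TD] {h : MinTensor D D TD}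

theorem FiniteUnitaryEquiv.approximates (S : SliceState D) (hs : FiniteUnitaryEquiv h.snd h.fst) :
    S.Approximates := by
  intro F ε hε
  obtain ⟨u, hu⟩ := hs F ε hε
  have hcont : ∀ d ∈ F, ∀ᶠ t in 𝓝 (u : TD), ‖star t * h.snd d * t - h.fst d‖ < ε := by
    intro d hd
    have : Continuous fun t : TD => ‖star t * h.snd d * t - h.fst d‖ := by fun_prop
    exact this.continuousAt.eventually (gt_mem_nhds (hu d hd))
  obtain ⟨δ, hδ, hball⟩ := Metric.eventually_nhds_iff.1 ((Finset.eventually_all F).2 hcont)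
  obtain ⟨p, hp⟩ := h.toCStarTensor.exists_lift_near (u : TD) hδ
  rw [← dist_eq_norm] at hp
  have hp' := hball hp
  obtain ⟨n, x, y, rfl⟩ := TensorProduct.exists_sum_tmul_eq p
  refine ⟨n, x, y, fun d hd => ?_⟩
  have h1 := S.norm_slice_le h.toCStarTensor
    (star (∑ j, x j ⊗ₜ[ℂ] y j) * (1 ⊗ₜ[ℂ] d) * (∑ j, x j ⊗ₜ[ℂ] y j) - d ⊗ₜ[ℂ] 1)
  refine (le_of_eq ?_).trans (h1.trans (le_trans (le_of_eq ?_) (hp' d hd).le))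
  · congr 1
    simp only [star_sum, TensorProduct.star_tmul, Finset.sum_mul, Finset.mul_sum, map_sub,
      Algebra.TensorProduct.tmul_mul_tmul, mul_one, map_sum, SliceState.slice_tmul, S.apply_one,
      one_smul]
    congr 1
    rw [Finset.sum_comm]
  · rw [map_sub, map_mul, map_mul, map_star, h.toCStarTensor.lift_tmul, h.toCStarTensor.lift_tmul]
    rfl

theorem exists_unitary_prod_exp (h1 : h.tmul 1 1 = 1) (φ : D ≃⋆ₐ[ℂ] TD)
    (hφ : ApproxUnitaryEquiv φ h.fst) (hK : K1Injective D) (F : Finset D) {ε : ℝ} (hε : 0 < ε) :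
    ∃ (l : List (selfAdjoint D)) (w : unitary D), (l.map selfAdjoint.expUnitary).prod = w ∧
      ∀ d ∈ F, ‖star (w : D) * φ.symm (h.tmul 1 d) * w - φ.symm (h.tmul d 1)‖ < ε := by
  have hflip := IsStronglySelfAbsorbing.halfFlip h h1 φ hφ
  obtain ⟨u, hu⟩ := hflip.symm F ε hε
  have hφ1 : (φ.symm : TD →⋆ₙₐ[ℂ] D) 1 = 1 := map_one φ.symm
  let ψ : unitary TD → unitary D := fun u => ⟨φ.symm u, map_mem_unitary hφ1 u⟩
  have hψ : ∀ u, φ (ψ u) = u := fun u => φ.apply_symm_apply _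
  set z := ψ u with hz
  obtain ⟨v, hv⟩ := hφ.finiteUnitaryEquiv {(z : D)} 1 one_pos
  have hv' := hv z (Finset.mem_singleton_self _)
  have hz1 : h.fst z ∈ unitary TD := by
    rw [Unitary.mem_iff]
    simp only [MinTensor.fst, h.star_tmul, h.mul_tmul, star_one, mul_one,
      Unitary.coe_star_mul_self, Unitary.mul_star_self_of_mem z.2, h1, and_self]
  let Z : unitary TD := ⟨h.fst z, hz1⟩
  let w : unitary TD := Z⁻¹ * u
  have hnorm : ∀ t, ‖φ.symm t‖ = ‖t‖ :=
    NonUnitalStarAlgHom.norm_map (φ.symm : TD →⋆ₙₐ[ℂ] D) φ.symm.injective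
  have hjoin : Joined (ψ w) 1 := by
    refine Joined.trans ?_ (hK ((ψ v)⁻¹ * (ψ u)⁻¹ * (ψ v)⁻¹⁻¹ * (ψ u)⁻¹⁻¹)
      (representsZeroInK1_commutator _ _))
    have e : ((ψ v)⁻¹ * (ψ u)⁻¹ * (ψ v)⁻¹⁻¹ * (ψ u)⁻¹⁻¹) = ψ (v⁻¹ * u⁻¹ * v * u) := by
      refine Subtype.ext ?_
      simp [ψ, ← Unitary.star_eq_inv, map_star]
    rw [e]
    refine Unitary.joined _ _ ?_
    change ‖φ.symm _ - φ.symm _‖ < 2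
    rw [← map_sub, hnorm]
    refine lt_of_le_of_lt ?_ (hv'.trans one_lt_two)
    rw [hψ]
    have e2 : (((v⁻¹ * u⁻¹ * v * u : unitary TD) : TD) - (w : TD)) =
        star (star (v : TD) * u * v - h.fst z) * u := by
      rw [star_sub, sub_mul]
      congr 1
      simp [mul_assoc, ← Unitary.star_eq_inv]
    rw [e2, CStarRing.norm_mul_coe_unitary, norm_star]
  obtain ⟨l, hl⟩ := Unitary.mem_pathComponentOne_iff.1 hjoin.symm
  refine ⟨l, ψ w, hl, fun d hd => ?_⟩
  refine lt_of_le_of_lt (le_of_eq ?_) (hu d hd)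
  have e3 : star ((ψ w : unitary D) : D) * φ.symm (h.tmul 1 d) * (ψ w : unitary D) -
      φ.symm (h.tmul d 1) =
      φ.symm (star (u : TD) * (h.fst z * h.snd d * star (h.fst z)) * u - h.fst d) := by
    simp [ψ, w, Z, mul_assoc, MinTensor.fst, MinTensor.snd, ← Unitary.star_eq_inv, map_star]
  have e4 : h.fst z * h.snd d * star (h.fst z) = h.snd d := by
    simp only [MinTensor.fst, MinTensor.snd, h.star_tmul, h.mul_tmul, star_one, mul_one,
      one_mul, Unitary.mul_star_self_of_mem z.2]
  rw [e3, e4, hnorm]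

end HalfFlip

section Corona

/-- Bounded sequences, as a C*-algebra. -/
abbrev BoundedSeq (B : Type u) [NonUnitalCStarAlgebra B] : Type u := lp (fun _ : ℕ => B) ⊤

namespace BoundedSeq

variable {B : Type u} [NonUnitalCStarAlgebra B]

/-- The bounded sequence with given terms. -/
def of (s : ℕ → B) (h : ∃ C, ∀ n, ‖s n‖ ≤ C) : BoundedSeq B :=
  ⟨s, memℓp_infty ⟨h.choose, by rintro _ ⟨n, rfl⟩; exact h.choose_spec n⟩⟩

@[simp] theorem of_apply (s : ℕ → B) (h : ∃ C, ∀ n, ‖s n‖ ≤ C) (n : ℕ) : of s h n = s n := rfl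

theorem norm_apply_le (f : BoundedSeq B) (n : ℕ) : ‖f n‖ ≤ ‖f‖ :=
  lp.norm_apply_le_norm ENNReal.top_ne_zero f n

theorem norm_le {f : BoundedSeq B} {C : ℝ} (hC : ∀ n, ‖f n‖ ≤ C) : ‖f‖ ≤ C :=
  lp.norm_le_of_forall_le' C hC

@[simp] theorem sub_apply (f g : BoundedSeq B) (n : ℕ) : (f - g) n = f n - g n := rfl
@[simp] theorem mul_apply (f g : BoundedSeq B) (n : ℕ) : (f * g) n = f n * g n := rfl
@[simp] theorem star_apply (f : BoundedSeq B) (n : ℕ) : (star f) n = star (f n) := rfl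

end BoundedSeq

variable (B : Type u) [NonUnitalCStarAlgebra B]

/-- Sequences converging to zero. -/
def nullSeqs : Submodule ℂ (BoundedSeq B) where
  carrier := {f | Tendsto (fun n => f n) atTop (𝓝 0)}
  add_mem' hf hg := by simpa using Tendsto.add hf hg
  zero_mem' := tendsto_const_nhds
  smul_mem' c f hf := by simpa using Tendsto.const_smul hf c

variable {B}

theorem mem_nullSeqs {f : BoundedSeq B} :
    f ∈ nullSeqs B ↔ Tendsto (fun n => f n) atTop (𝓝 0) := Iff.rfl

theorem mul_mem_nullSeqs_left (g : BoundedSeq B) {f : BoundedSeq B} (hf : f ∈ nullSeqs B) :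
    g * f ∈ nullSeqs B := by
  refine squeeze_zero_norm (a := fun n => ‖g‖ * ‖f n‖) (fun n => ?_) ?_
  · exact (norm_mul_le _ _).trans
      (mul_le_mul_of_nonneg_right (BoundedSeq.norm_apply_le g n) (norm_nonneg _))
  · simpa using (tendsto_zero_iff_norm_tendsto_zero.1 hf).const_mul ‖g‖

theorem star_mem_nullSeqs {f : BoundedSeq B} (hf : f ∈ nullSeqs B) : star f ∈ nullSeqs B := by
  have h1 : Tendsto (fun n => star (f n)) atTop (𝓝 (star 0)) := Tendsto.star hf
  rwa [star_zero] at h1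

theorem mul_mem_nullSeqs_right (g : BoundedSeq B) {f : BoundedSeq B} (hf : f ∈ nullSeqs B) :
    f * g ∈ nullSeqs B := by
  simpa using star_mem_nullSeqs (mul_mem_nullSeqs_left (star g) (star_mem_nullSeqs hf))

instance isClosed_nullSeqs : IsClosed (nullSeqs B : Set (BoundedSeq B)) := by
  refine isClosed_of_closure_subset fun f hf => ?_
  refine Metric.tendsto_atTop.2 fun ε hε => ?_
  obtain ⟨g, hg, hfg⟩ := Metric.mem_closure_iff.1 hf (ε / 2) (half_pos hε)
  obtain ⟨N, hN⟩ := Metric.tendsto_atTop.1 hg (ε / 2) (half_pos hε)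
  refine ⟨N, fun n hn => ?_⟩
  have h1 := hN n hn
  rw [dist_eq_norm] at hfg
  have h2 := (BoundedSeq.norm_apply_le (f - g) n).trans_lt hfg
  rw [BoundedSeq.sub_apply, ← dist_eq_norm] at h2
  exact (dist_triangle _ (g n) _).trans_lt (by linarith)

variable (B) in
/-- The sequence algebra of bounded sequences modulo sequences converging to zero. -/
def Corona : Type u := BoundedSeq B ⧸ nullSeqs B

namespace Corona

instance : NormedAddCommGroup (Corona B) :=
  inferInstanceAs (NormedAddCommGroup (BoundedSeq B ⧸ nullSeqs B))

instance : NormedSpace ℂ (Corona B) :=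
  inferInstanceAs (NormedSpace ℂ (BoundedSeq B ⧸ nullSeqs B))

instance : CompleteSpace (Corona B) :=
  inferInstanceAs (CompleteSpace (BoundedSeq B ⧸ nullSeqs B))

variable (B) in
/-- The quotient map onto the sequence algebra. -/
def mkₗ : BoundedSeq B →ₗ[ℂ] Corona B := (nullSeqs B).mkQ

theorem mkₗ_surjective : Function.Surjective (mkₗ B) := (nullSeqs B).mkQ_surjective

theorem mkₗ_eq_iff {f g : BoundedSeq B} : mkₗ B f = mkₗ B g ↔ f - g ∈ nullSeqs B :=
  Submodule.Quotient.eq _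

theorem exists_norm_lt {x : Corona B} {C : ℝ} (h : ‖x‖ < C) : ∃ f, mkₗ B f = x ∧ ‖f‖ < C := by
  obtain ⟨m, hm, hm'⟩ := Submodule.Quotient.norm_mk_lt (S := nullSeqs B) x (sub_pos.2 h)
  exact ⟨m, hm, hm'.trans_eq (add_sub_cancel _ _)⟩

theorem eventually_norm_lt {f : BoundedSeq B} {C : ℝ} (h : ‖mkₗ B f‖ < C) :
    ∀ᶠ n in atTop, ‖f n‖ < C := by
  obtain ⟨g, hg, hgC⟩ := exists_norm_lt h
  have h1 := (mem_nullSeqs.1 (mkₗ_eq_iff.1 hg.symm)).norm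
  rw [norm_zero] at h1
  filter_upwards [h1.eventually (gt_mem_nhds (sub_pos.2 hgC))] with n hn
  have h2 := norm_sub_norm_le (f n) (g n)
  have h3 := BoundedSeq.norm_apply_le g n
  rw [BoundedSeq.sub_apply] at hn
  linarith

theorem norm_mkₗ_le {f : BoundedSeq B} {C : ℝ} (hC : 0 ≤ C) (h : ∀ᶠ n in atTop, ‖f n‖ ≤ C) :
    ‖mkₗ B f‖ ≤ C := by
  obtain ⟨N, hN⟩ := eventually_atTop.1 h
  have hb : ∀ n, ‖if N ≤ n then f n else 0‖ ≤ C := fun n => by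
    split_ifs with hn
    · exact hN n hn
    · simpa using hC
  have h1 : mkₗ B f = mkₗ B (BoundedSeq.of _ ⟨C, hb⟩) := by
    refine mkₗ_eq_iff.2 (tendsto_const_nhds.congr' ?_)
    filter_upwards [eventually_ge_atTop N] with n hn
    simp [hn]
  rw [h1]
  exact (Submodule.Quotient.norm_mk_le (nullSeqs B) _).trans (BoundedSeq.norm_le hb)

instance : Mul (Corona B) where
  mul x y := mkₗ B (Function.surjInv mkₗ_surjective x * Function.surjInv mkₗ_surjective y)

theorem mkₗ_mul (f g : BoundedSeq B) : mkₗ B (f * g) = mkₗ B f * mkₗ B g := by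
  refine mkₗ_eq_iff.2 ?_
  have hf := mkₗ_eq_iff.1 (Function.surjInv_eq mkₗ_surjective (mkₗ B f)).symm
  have hg := mkₗ_eq_iff.1 (Function.surjInv_eq mkₗ_surjective (mkₗ B g)).symm
  have := (nullSeqs B).add_mem (mul_mem_nullSeqs_right g hf)
    (mul_mem_nullSeqs_left (Function.surjInv mkₗ_surjective (mkₗ B f)) hg)
  convert this using 1
  noncomm_ring

instance : Star (Corona B) where
  star x := mkₗ B (star (Function.surjInv mkₗ_surjective x))

theorem mkₗ_star (f : BoundedSeq B) : mkₗ B (star f) = star (mkₗ B f) := by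
  refine mkₗ_eq_iff.2 ?_
  have hf := mkₗ_eq_iff.1 (Function.surjInv_eq mkₗ_surjective (mkₗ B f)).symm
  simpa using star_mem_nullSeqs hf

instance : NonUnitalNormedRing (Corona B) where
  left_distrib x y z := by
    obtain ⟨x, rfl⟩ := mkₗ_surjective x
    obtain ⟨y, rfl⟩ := mkₗ_surjective y
    obtain ⟨z, rfl⟩ := mkₗ_surjective z
    simp only [← mkₗ_mul, ← map_add, mul_add]
  right_distrib x y z := by
    obtain ⟨x, rfl⟩ := mkₗ_surjective x
    obtain ⟨y, rfl⟩ := mkₗ_surjective y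
    obtain ⟨z, rfl⟩ := mkₗ_surjective z
    simp only [← mkₗ_mul, ← map_add, add_mul]
  zero_mul x := by
    obtain ⟨x, rfl⟩ := mkₗ_surjective x
    rw [← map_zero (mkₗ B), ← mkₗ_mul, zero_mul]
  mul_zero x := by
    obtain ⟨x, rfl⟩ := mkₗ_surjective x
    rw [← map_zero (mkₗ B), ← mkₗ_mul, mul_zero]
  mul_assoc x y z := by
    obtain ⟨x, rfl⟩ := mkₗ_surjective x
    obtain ⟨y, rfl⟩ := mkₗ_surjective y
    obtain ⟨z, rfl⟩ := mkₗ_surjective z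
    simp only [← mkₗ_mul, mul_assoc]
  dist_eq := dist_eq_norm_neg_add
  norm_mul_le x y := by
    refine le_mul_of_forall_lt₀ fun a ha b hb => ?_
    obtain ⟨f, rfl, hf⟩ := exists_norm_lt ha
    obtain ⟨g, rfl, hg⟩ := exists_norm_lt hb
    rw [← mkₗ_mul]
    refine (Submodule.Quotient.norm_mk_le (nullSeqs B) _).trans ((norm_mul_le _ _).trans ?_)
    exact mul_le_mul hf.le hg.le (norm_nonneg _) ((norm_nonneg _).trans hf.le)

instance : NonUnitalCStarAlgebra (Corona B) where
  star_involutive x := by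
    obtain ⟨x, rfl⟩ := mkₗ_surjective x
    rw [← mkₗ_star, ← mkₗ_star, star_star]
  star_mul x y := by
    obtain ⟨x, rfl⟩ := mkₗ_surjective x
    obtain ⟨y, rfl⟩ := mkₗ_surjective y
    simp only [← mkₗ_mul, ← mkₗ_star, star_mul]
  star_add x y := by
    obtain ⟨x, rfl⟩ := mkₗ_surjective x
    obtain ⟨y, rfl⟩ := mkₗ_surjective y
    simp only [← map_add, ← mkₗ_star, star_add]
  norm_mul_self_le x := by
    obtain ⟨f, rfl⟩ := mkₗ_surjective x
    rw [← mkₗ_star, ← mkₗ_mul]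
    refine le_of_forall_gt_imp_ge_of_dense fun c hc => ?_
    have h0 : 0 ≤ c := (norm_nonneg _).trans hc.le
    have h1 : ‖mkₗ B f‖ ≤ √c := by
      refine norm_mkₗ_le (Real.sqrt_nonneg _) ?_
      filter_upwards [eventually_norm_lt hc] with n hn
      rw [BoundedSeq.mul_apply, BoundedSeq.star_apply, CStarRing.norm_star_mul_self] at hn
      exact Real.le_sqrt_of_sq_le (by rw [sq]; exact hn.le)
    calc _ ≤ √c * √c := mul_self_le_mul_self (norm_nonneg _) h1
      _ = c := Real.mul_self_sqrt h0
  smul_assoc c x y := by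
    obtain ⟨x, rfl⟩ := mkₗ_surjective x
    obtain ⟨y, rfl⟩ := mkₗ_surjective y
    simp only [← mkₗ_mul, smul_eq_mul, ← map_smul, smul_mul_assoc]
  smul_comm c x y := by
    obtain ⟨x, rfl⟩ := mkₗ_surjective x
    obtain ⟨y, rfl⟩ := mkₗ_surjective y
    simp only [← mkₗ_mul, smul_eq_mul, ← map_smul, mul_smul_comm]
  star_smul c x := by
    obtain ⟨x, rfl⟩ := mkₗ_surjective x
    rw [← map_smul, ← mkₗ_star, ← mkₗ_star, star_smul, map_smul]

variable (B) in
/-- The quotient *-homomorphism onto the sequence algebra. -/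
def mk : BoundedSeq B →⋆ₙₐ[ℂ] Corona B where
  toFun := mkₗ B
  map_smul' := map_smul (mkₗ B)
  map_zero' := map_zero (mkₗ B)
  map_add' := map_add (mkₗ B)
  map_mul' := mkₗ_mul
  map_star' := mkₗ_star

theorem mk_surjective : Function.Surjective (mk B) := mkₗ_surjective

theorem mk_eq_iff {f g : BoundedSeq B} :
    mk B f = mk B g ↔ Tendsto (fun n => f n - g n) atTop (𝓝 0) := mkₗ_eq_iff

theorem eventually_norm_lt_of_norm_mk_lt {f : BoundedSeq B} {C : ℝ} (h : ‖mk B f‖ < C) :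
    ∀ᶠ n in atTop, ‖f n‖ < C := eventually_norm_lt h

end Corona

end Corona

section Multiplier

variable {B : Type u} [NonUnitalCStarAlgebra B]

theorem coeHom_injective : Function.Injective (DoubleCentralizer.coeHom : B →⋆ₙₐ[ℂ] 𝓜(ℂ, B)) := by
  refine (injective_iff_map_eq_zero _).2 fun b hb => ?_
  have h1 : (DoubleCentralizer.coeHom (𝕜 := ℂ) b).fst (star b) = 0 := by rw [hb]; simp
  exact (CStarRing.mul_star_self_eq_zero_iff b).1 h1

theorem norm_coe_multiplier (b : B) : ‖(b : 𝓜(ℂ, B))‖ = ‖b‖ :=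
  NonUnitalStarAlgHom.norm_map _ coeHom_injective b

theorem coe_sub_multiplier (a b : B) : ((a - b : B) : 𝓜(ℂ, B)) = (a : 𝓜(ℂ, B)) - b :=
  map_sub (DoubleCentralizer.coeHom (𝕜 := ℂ) (A := B)) a b

theorem DoubleCentralizer.fst_mul (m : 𝓜(ℂ, B)) (b c : B) : m.fst (b * c) = m.fst b * c := by
  rw [← sub_eq_zero, ← CStarRing.star_mul_self_eq_zero_iff, mul_sub, ← m.central, ← mul_assoc,
    ← mul_assoc, ← m.central, sub_self]

theorem DoubleCentralizer.snd_mul (m : 𝓜(ℂ, B)) (b c : B) : m.snd (b * c) = b * m.snd c := by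
  rw [← sub_eq_zero, ← CStarRing.mul_star_self_eq_zero_iff, sub_mul, m.central, mul_assoc,
    mul_assoc, m.central, sub_self]

/-- Conjugation by a multiplier. -/
def conjMultiplier (m : 𝓜(ℂ, B)) (b : B) : B := m.fst ((star m).snd b)

theorem coe_conjMultiplier (m : 𝓜(ℂ, B)) (b : B) :
    ((conjMultiplier m b : B) : 𝓜(ℂ, B)) = m * b * star m := by
  refine DoubleCentralizer.ext _ _ _ _ (Prod.ext ?_ ?_)
  · rw [DoubleCentralizer.mul_fst, DoubleCentralizer.mul_fst]
    ext c
    change m.fst ((star m).snd b) * c = m.fst (b * (star m).fst c)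
    rw [← DoubleCentralizer.fst_mul, (star m).central]
  · rw [DoubleCentralizer.mul_snd, DoubleCentralizer.mul_snd]
    ext c
    change c * m.fst ((star m).snd b) = (star m).snd (m.snd c * b)
    rw [← m.central, DoubleCentralizer.snd_mul]

end Multiplier

section Intertwining

variable {A : Type u} {B : Type v} [NonUnitalCStarAlgebra A] [NonUnitalCStarAlgebra B]

theorem norm_conj_sub (u : unitary 𝓜(ℂ, B)) (b c : B) :
    ‖conjMultiplier (u : 𝓜(ℂ, B)) b - c‖ = ‖star (u : 𝓜(ℂ, B)) * c * u - b‖ := by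
  rw [norm_unitary_conj_sub, ← norm_coe_multiplier, coe_sub_multiplier, coe_conjMultiplier]

theorem conj_eq_iff (u : unitary 𝓜(ℂ, B)) (b c : B) :
    conjMultiplier (u : 𝓜(ℂ, B)) b = c ↔
      (u : 𝓜(ℂ, B)) * b * star (u : 𝓜(ℂ, B)) = (c : 𝓜(ℂ, B)) := by
  rw [← coe_conjMultiplier]
  exact coeHom_injective.eq_iff.symm

/-- Conjugation by a unitary multiplier, as a *-homomorphism. -/
def conjHom (u : unitary 𝓜(ℂ, B)) : B →⋆ₙₐ[ℂ] B where
  toFun := conjMultiplier (u : 𝓜(ℂ, B))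
  map_smul' c b := by simp [conjMultiplier]
  map_zero' := by simp [conjMultiplier]
  map_add' b c := by simp [conjMultiplier]
  map_mul' b c := by
    rw [conj_eq_iff]
    change _ = DoubleCentralizer.coeHom (𝕜 := ℂ) _
    rw [map_mul]
    change _ =
      ((conjMultiplier (u : 𝓜(ℂ, B)) b : B) : 𝓜(ℂ, B)) * (conjMultiplier (u : 𝓜(ℂ, B)) c : B)
    rw [coe_conjMultiplier, coe_conjMultiplier]
    have h1 : ((b * c : B) : 𝓜(ℂ, B)) = b * c := map_mul (DoubleCentralizer.coeHom (𝕜 := ℂ)) b c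
    rw [h1]
    calc _ = (u : 𝓜(ℂ, B)) * b * 1 * c * star (u : 𝓜(ℂ, B)) := by simp only [mul_one, mul_assoc]
      _ = _ := by rw [← Unitary.coe_star_mul_self u]; simp only [mul_assoc]
  map_star' b := by
    rw [conj_eq_iff]
    change _ = DoubleCentralizer.coeHom (𝕜 := ℂ) _
    rw [map_star]
    change _ = star ((conjMultiplier (u : 𝓜(ℂ, B)) b : B) : 𝓜(ℂ, B))
    have h1 : ((star b : B) : 𝓜(ℂ, B)) = star (b : 𝓜(ℂ, B)) :=
      map_star (DoubleCentralizer.coeHom (𝕜 := ℂ)) b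
    rw [coe_conjMultiplier, h1, star_mul, star_mul, star_star, mul_assoc]

theorem norm_conjHom (u : unitary 𝓜(ℂ, B)) (b : B) : ‖conjHom u b‖ = ‖b‖ := by
  change ‖conjMultiplier (u : 𝓜(ℂ, B)) b‖ = _
  rw [← norm_coe_multiplier, coe_conjMultiplier, ← Unitary.coe_star,
    CStarRing.norm_mul_coe_unitary, CStarRing.norm_coe_unitary_mul, norm_coe_multiplier]

theorem conjHom_mul (u v : unitary 𝓜(ℂ, B)) (b : B) :
    conjHom (u * v) b = conjHom u (conjHom v b) := by
  refine (conj_eq_iff _ _ _).2 ?_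
  change _ = ((conjMultiplier (u : 𝓜(ℂ, B)) (conjMultiplier (v : 𝓜(ℂ, B)) b) : B) : 𝓜(ℂ, B))
  rw [coe_conjMultiplier, coe_conjMultiplier, Submonoid.coe_mul, star_mul]
  simp only [mul_assoc]

theorem conjHom_one (b : B) : conjHom (1 : unitary 𝓜(ℂ, B)) b = b := by
  refine (conj_eq_iff _ _ _).2 ?_
  simp

/-- One-sided approximate intertwining. -/
theorem exists_equiv_of_intertwining [TopologicalSpace.SeparableSpace A]
    [TopologicalSpace.SeparableSpace B] (ι : A →⋆ₙₐ[ℂ] B) (hι : ∀ a, ‖ι a‖ = ‖a‖)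
    (h : ∀ (F : Finset A) (b : B) (ε : ℝ), 0 < ε → ∃ v : unitary 𝓜(ℂ, B),
      (∀ a ∈ F, ‖conjHom v (ι a) - ι a‖ ≤ ε) ∧ ∃ a, ‖conjHom v (ι a) - b‖ ≤ ε) :
    ∃ φ : A ≃⋆ₐ[ℂ] B, ApproxUnitaryEquiv φ ι := by
  classical
  have h' : ∀ (F : Finset A) (b : B) (n : ℕ), ∃ (v : unitary 𝓜(ℂ, B)) (c : A),
      (∀ a ∈ F, ‖conjHom v (ι a) - ι a‖ ≤ 1 / 2 ^ n) ∧ ‖conjHom v (ι c) - b‖ ≤ 1 / 2 ^ n := by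
    intro F b n
    obtain ⟨v, h1, c, h2⟩ := h F b (1 / 2 ^ n) (by positivity)
    exact ⟨v, c, h1, h2⟩
  choose v c hv hc using h'
  let a : ℕ → A := TopologicalSpace.denseSeq A
  let b : ℕ → B := fun n => TopologicalSpace.denseSeq B n.unpair.1
  let S : ℕ → unitary 𝓜(ℂ, B) × Finset A := fun n => Nat.rec (1, ∅) (fun n s =>
    (s.1 * v (insert (a n) s.2) (conjHom s.1⁻¹ (b n)) n,
      insert (c (insert (a n) s.2) (conjHom s.1⁻¹ (b n)) n) (insert (a n) s.2))) n
  let F : ℕ → Finset A := fun n => insert (a n) (S n).2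
  let U : ℕ → unitary 𝓜(ℂ, B) := fun n => (S n).1
  let V : ℕ → unitary 𝓜(ℂ, B) := fun n => v (F n) (conjHom (U n)⁻¹ (b n)) n
  let C : ℕ → A := fun n => c (F n) (conjHom (U n)⁻¹ (b n)) n
  have hU : ∀ n, U (n + 1) = U n * V n := fun n => rfl
  have hF : ∀ n, F (n + 1) = insert (a (n + 1)) (insert (C n) (F n)) := fun n => rfl
  have hFmono : Monotone F := monotone_nat_of_le_succ fun n => by
    rw [hF]
    exact (Finset.subset_insert _ _).trans (Finset.subset_insert _ _)
  let θ : ℕ → A → B := fun n x => conjHom (U n) (ι x)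
  have hθ : ∀ n x, ‖θ n x‖ = ‖x‖ := fun n x => (norm_conjHom _ _).trans (hι x)
  have hθsub : ∀ n x y, θ n x - θ n y = θ n (x - y) := fun n x y => by simp [θ]
  have hstep : ∀ N, ∀ x ∈ F N, ∀ n, N ≤ n → dist (θ n x) (θ (n + 1) x) ≤ 1 / 2 ^ n := by
    intro N x hx n hn
    have h1 := hv (F n) (conjHom (U n)⁻¹ (b n)) n x (hFmono hn hx)
    rw [dist_comm, dist_eq_norm]
    change ‖conjHom (U (n + 1)) (ι x) - conjHom (U n) (ι x)‖ ≤ _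
    rwa [hU, conjHom_mul, ← map_sub, norm_conjHom]
  have hstep' : ∀ N, ∀ x ∈ F N, ∀ n, dist (θ (n + N) x) (θ (n + 1 + N) x) ≤
      (2 / 2 ^ N) / 2 / 2 ^ n := by
    intro N x hx n
    have h1 := hstep N x hx (n + N) (Nat.le_add_left _ _)
    rw [show n + 1 + N = n + N + 1 by ring]
    refine h1.trans (le_of_eq ?_)
    rw [pow_add]
    field_simp
  have hcauF : ∀ N, ∀ x ∈ F N, CauchySeq fun n => θ n x := fun N x hx =>
    (cauchySeq_shift N).1 (cauchySeq_of_le_geometric_two (hstep' N x hx))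
  have hcau : ∀ x, CauchySeq fun n => θ n x := by
    intro x
    refine Metric.cauchySeq_iff.2 fun ε hε => ?_
    obtain ⟨_, ⟨k, rfl⟩, hk⟩ := Metric.mem_closure_iff.1
      (TopologicalSpace.denseRange_denseSeq A x) (ε / 3) (by positivity)
    obtain ⟨N, hN⟩ := Metric.cauchySeq_iff.1 (hcauF k (a k) (Finset.mem_insert_self _ _))
      (ε / 3) (by positivity)
    refine ⟨N, fun m hm n hn => ?_⟩
    have h1 := hN m hm n hn
    have h2 : ∀ j, dist (θ j x) (θ j (a k)) < ε / 3 := fun j => by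
      rw [dist_eq_norm, hθsub, hθ, ← dist_eq_norm]
      exact hk
    have h3 := dist_triangle4 (θ m x) (θ m (a k)) (θ n (a k)) (θ n x)
    have h4 := h2 m
    have h5 := h2 n
    rw [dist_comm] at h5
    linarith
  choose ψ hψ using fun x => cauchySeq_tendsto_of_complete (hcau x)
  let Ψ : A →⋆ₙₐ[ℂ] B :=
    { toFun := ψ
      map_smul' := fun r x => tendsto_nhds_unique (hψ _) (by
        simpa [θ] using (hψ x).const_smul r)
      map_zero' := tendsto_nhds_unique (hψ _) (by simp [θ])
      map_add' := fun x y => tendsto_nhds_unique (hψ _) (by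
        simpa [θ] using (hψ x).add (hψ y))
      map_mul' := fun x y => tendsto_nhds_unique (hψ _) (by
        simpa [θ] using (hψ x).mul (hψ y))
      map_star' := fun x => tendsto_nhds_unique (hψ _) (by
        simpa [θ, map_star] using (hψ x).star) }
  have hΨ : ∀ x, ‖Ψ x‖ = ‖x‖ := fun x =>
    tendsto_nhds_unique (hψ x).norm (by simp only [hθ]; exact tendsto_const_nhds)
  have hiso : Isometry Ψ := AddMonoidHomClass.isometry_of_norm Ψ hΨ
  have hclose : ∀ n, ‖Ψ (C n) - b n‖ ≤ 2 / 2 ^ n := by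
    intro n
    have hmem : C n ∈ F (n + 1) := by
      rw [hF]
      exact Finset.mem_insert_of_mem (Finset.mem_insert_self _ _)
    have h1 := dist_le_of_le_geometric_two_of_tendsto₀ (hstep' (n + 1) (C n) hmem)
      ((tendsto_add_atTop_iff_nat (n + 1)).2 (hψ (C n)))
    rw [zero_add] at h1
    have h2 : ‖θ (n + 1) (C n) - b n‖ ≤ 1 / 2 ^ n := by
      have h3 := hc (F n) (conjHom (U n)⁻¹ (b n)) n
      change ‖conjHom (U (n + 1)) (ι (C n)) - b n‖ ≤ _
      have h4 : b n = conjHom (U n) (conjHom (U n)⁻¹ (b n)) := by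
        rw [← conjHom_mul, mul_inv_cancel, conjHom_one]
      rw [h4, hU, conjHom_mul, ← map_sub, norm_conjHom]
      exact h3
    rw [dist_comm, dist_eq_norm] at h1
    have h5 := norm_add_le (ψ (C n) - θ (n + 1) (C n)) (θ (n + 1) (C n) - b n)
    rw [sub_add_sub_cancel] at h5
    refine h5.trans ((add_le_add h1 h2).trans (le_of_eq ?_))
    rw [pow_succ]
    field_simp
    norm_num
  have hdense : DenseRange Ψ := by
    intro y
    refine Metric.mem_closure_iff.2 fun ε hε => ?_
    obtain ⟨_, ⟨k, rfl⟩, hk⟩ := Metric.mem_closure_iff.1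
      (TopologicalSpace.denseRange_denseSeq B y) (ε / 2) (half_pos hε)
    have hlim : Tendsto (fun n : ℕ => (2 : ℝ) / 2 ^ n) atTop (𝓝 0) := by
      simpa [div_eq_mul_inv] using
        (tendsto_pow_atTop_nhds_zero_of_lt_one (r := (2 : ℝ)⁻¹) (by norm_num)
          (by norm_num)).const_mul 2
    obtain ⟨N, hN⟩ := eventually_atTop.1 (hlim.eventually (gt_mem_nhds (half_pos hε)))
    refine ⟨_, ⟨C (Nat.pair k N), rfl⟩, ?_⟩
    have h1 := (hclose (Nat.pair k N)).trans_lt (hN _ (Nat.right_le_pair k N))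
    simp only [b, Nat.unpair_pair] at h1
    rw [← dist_eq_norm, dist_comm] at h1
    exact (dist_triangle _ _ _).trans_lt (by linarith)
  have hsurj : Function.Surjective Ψ := by
    rw [← Set.range_eq_univ, ← hiso.isClosedEmbedding.isClosed_range.closure_eq]
    exact hdense.closure_range
  refine ⟨StarAlgEquiv.ofBijective Ψ ⟨hiso.injective, hsurj⟩, fun n => U n, fun n => (U n).2,
    fun x => ?_⟩
  have h1 := (tendsto_iff_norm_sub_tendsto_zero.1 (hψ x))
  refine h1.congr fun n => ?_
  exact norm_conj_sub (U n) (ι x) (ψ x)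

end Intertwining

section Induced

variable {A : Type u} {D : Type w} {T : Type u} {QA : Type v} [NonUnitalCStarAlgebra A]
  [CStarAlgebra D] [NonUnitalCStarAlgebra T] [NonUnitalCStarAlgebra QA]

/-- The bounded sequence `n ↦ s n ⊗ d`. -/
def CStarTensor.seqTmul (h : CStarTensor A D T) (s : boundedSeqs A) (d : D) : BoundedSeq T :=
  BoundedSeq.of (fun n => h.tmul ((s : ℕ → A) n) d) (by
    obtain ⟨C, hC⟩ := s.2
    exact ⟨C * ‖d‖, fun n => by
      rw [h.norm_tmul]
      exact mul_le_mul_of_nonneg_right (hC n) (norm_nonneg d)⟩)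

theorem IsSeqCorona.exists_tmul (hQ : IsSeqCorona A QA) (h : CStarTensor A D T) :
    ∃ κ : QA ⊗[ℂ] D →⋆ₙₐ[ℂ] Corona T, ∀ s d, κ (hQ.q s ⊗ₜ d) = Corona.mk T (h.seqTmul s d) := by
  let k : QA → D → Corona T := fun x d =>
    Corona.mk T (h.seqTmul (Function.surjInv hQ.surjective x) d)
  have hk : ∀ s d, k (hQ.q s) d = Corona.mk T (h.seqTmul s d) := by
    intro s d
    refine Corona.mk_eq_iff.2 ?_
    have h1 : hQ.q (Function.surjInv hQ.surjective (hQ.q s) - s) = 0 := by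
      rw [map_sub, Function.surjInv_eq hQ.surjective, sub_self]
    have h2 := tendsto_zero_iff_norm_tendsto_zero.2 ((hQ.ker_iff _).1 h1)
    have h3 : Tendsto (fun n => h.clm ((((Function.surjInv hQ.surjective (hQ.q s) - s :
        boundedSeqs A)) : ℕ → A) n) d) atTop (𝓝 (h.clm 0 d)) :=
      ((h.clm.flip d).continuous.tendsto 0).comp h2
    rw [map_zero, zero_apply] at h3
    refine h3.congr fun n => ?_
    exact h.sub_tmul _ _ _
  have hsurj := hQ.surjective
  refine ⟨tensorStarHom (LinearMap.mk₂ ℂ k ?_ ?_ ?_ ?_) ?_ ?_, fun s d => ?_⟩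
  · intro x y d
    obtain ⟨s, rfl⟩ := hsurj x
    obtain ⟨t, rfl⟩ := hsurj y
    rw [← map_add, hk, hk, hk, ← map_add]
    exact congrArg _ (Subtype.ext (funext fun n => h.add_left _ _ _))
  · intro c x d
    obtain ⟨s, rfl⟩ := hsurj x
    rw [← map_smul, hk, hk, ← map_smul]
    exact congrArg _ (Subtype.ext (funext fun n => h.smul_left _ _ _))
  · intro x d d'
    rw [← map_add]
    exact congrArg _ (Subtype.ext (funext fun n => h.add_right _ _ _))
  · intro c x d
    rw [← map_smul]
    exact congrArg _ (Subtype.ext (funext fun n => h.smul_right _ _ _))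
  · intro x y d d'
    obtain ⟨s, rfl⟩ := hsurj x
    obtain ⟨t, rfl⟩ := hsurj y
    simp only [LinearMap.mk₂_apply]
    rw [hk, hk, ← map_mul hQ.q, hk, ← map_mul]
    exact congrArg _ (Subtype.ext (funext fun n => h.mul_tmul _ _ _ _))
  · intro x d
    obtain ⟨s, rfl⟩ := hsurj x
    simp only [LinearMap.mk₂_apply]
    rw [← map_star hQ.q, hk, hk, ← map_star]
    exact congrArg _ (Subtype.ext (funext fun n => h.star_tmul _ _))
  · rw [tensorStarHom_tmul]
    exact hk s d

end Induced

namespace SliceState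

variable {A : Type u} {D : Type v} {T : Type w} {TD : Type*} {Q : Type*} {E : Type x}
  [NonUnitalCStarAlgebra A] [CStarAlgebra D] [NonUnitalCStarAlgebra T] [CStarAlgebra TD]
  [NonUnitalCStarAlgebra Q] [NonUnitalCStarAlgebra E] {S : SliceState D}

theorem Approximates.exists_extend_triple (hS : S.Approximates) (h : CStarTensor A D T)
    (hD : CStarTensor D D TD) (φ : D ≃⋆ₐ[ℂ] TD) (σ : T →⋆ₙₐ[ℂ] Q) (κ : Q ⊗[ℂ] D →⋆ₙₐ[ℂ] E) :
    ∃ ρ : T →⋆ₙₐ[ℂ] E, ∀ a x y,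
      ρ (h.tmul a (φ.symm (hD.tmul x y))) = κ (σ (h.tmul a x) ⊗ₜ y) := by
  let Λ : A → D ⊗[ℂ] D →ₗ[ℂ] E := fun a =>
    (κ : Q ⊗[ℂ] D →ₗ[ℂ] E) ∘ₗ LinearMap.rTensor D ((σ : T →ₗ[ℂ] Q) ∘ₗ h.bil a)
  have hΛ : ∀ a x y, Λ a (x ⊗ₜ y) = κ (σ (h.tmul a x) ⊗ₜ y) := fun a x y => rfl
  have hΛadd : ∀ a b p, Λ (a + b) p = Λ a p + Λ b p := by
    intro a b p
    simp [Λ, LinearMap.comp_add, LinearMap.rTensor_add]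
  have hΛsmul : ∀ (c : ℂ) a p, Λ (c • a) p = c • Λ a p := by
    intro c a p
    simp [Λ, LinearMap.comp_smul, LinearMap.rTensor_smul]
  have hΛmul : ∀ a b p q, Λ a p * Λ b q = Λ (a * b) (p * q) := by
    intro a b p q
    induction p with
    | zero => simp
    | add p₁ p₂ h₁ h₂ => simp [add_mul, h₁, h₂]
    | tmul x y =>
      induction q with
      | zero => simp
      | add q₁ q₂ h₁ h₂ => simp [mul_add, h₁, h₂]
      | tmul x' y' =>
        rw [Algebra.TensorProduct.tmul_mul_tmul, hΛ, hΛ, hΛ, ← map_mul,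
          Algebra.TensorProduct.tmul_mul_tmul, ← map_mul, h.mul_tmul]
  have hΛstar : ∀ a p, star (Λ a p) = Λ (star a) (star p) := by
    intro a p
    induction p with
    | zero => simp
    | add p₁ p₂ h₁ h₂ => simp [h₁, h₂]
    | tmul x y =>
      rw [hΛ, TensorProduct.star_tmul, hΛ, ← map_star, TensorProduct.star_tmul, ← map_star,
        h.star_tmul]
  have hΛpos : ∀ a p, Λ (star a * a) (star p * p) = star (Λ a p) * Λ a p := fun a p => by
    rw [← hΛmul, ← hΛstar]
  have hΛnorm : ∀ a p, ‖Λ a p‖ ≤ ‖a‖ * ‖hD.lift p‖ := by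
    intro a p
    have h1 := hS.norm_apply_star_mul_self_le hD (Φ := Λ (star a * a)) (K := ‖a‖ ^ 2)
      (by positivity) (fun x y => by
        rw [hΛ]
        refine (norm_starHom_tmul_le κ _ _).trans (mul_le_mul_of_nonneg_right ?_ (norm_nonneg y))
        refine (NonUnitalStarAlgHom.norm_apply_le σ _).trans ?_
        rw [h.norm_tmul, CStarRing.norm_star_mul_self, sq])
      (fun p => by
        rw [hΛpos]
        exact star_mul_self_nonneg _) p
    rw [hΛpos, CStarRing.norm_star_mul_self, ← sq, ← mul_pow] at h1
    exact (pow_le_pow_iff_left₀ (norm_nonneg _) (by positivity) two_ne_zero).1 h1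
  let L : A → TD →L[ℂ] E := fun a => (Λ a).extendOfNorm (hD.lift : D ⊗[ℂ] D →ₗ[ℂ] TD)
  have hL : ∀ a p, L a (hD.lift p) = Λ a p := fun a p =>
    LinearMap.extendOfNorm_eq (f := Λ a) (e := (hD.lift : D ⊗[ℂ] D →ₗ[ℂ] TD)) hD.denseRange_lift
      ⟨‖a‖, hΛnorm a⟩ p
  have hLmul : ∀ a b s t, L a s * L b t = L (a * b) (s * t) := by
    intro a b s t
    induction s using hD.denseRange_lift.induction_on with
    | hp => exact isClosed_eq (by fun_prop) (by fun_prop)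
    | ih p =>
      induction t using hD.denseRange_lift.induction_on with
      | hp => exact isClosed_eq (by fun_prop) (by fun_prop)
      | ih q => rw [← map_mul, hL, hL, hL, hΛmul]
  have hLstar : ∀ a s, star (L a s) = L (star a) (star s) := by
    intro a s
    induction s using hD.denseRange_lift.induction_on with
    | hp => exact isClosed_eq (by fun_prop) (by fun_prop)
    | ih p => rw [hL, ← map_star hD.lift, hL, hΛstar]
  obtain ⟨ρ, hρ⟩ := hS.exists_extend h
    (tensorStarHom (LinearMap.mk₂ ℂ (fun a d => L a (φ d))
      (fun a b d => by
        induction φ d using hD.denseRange_lift.induction_on with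
        | hp => exact isClosed_eq (by fun_prop) (by fun_prop)
        | ih p => rw [hL, hL, hL, hΛadd])
      (fun c a d => by
        induction φ d using hD.denseRange_lift.induction_on with
        | hp => exact isClosed_eq (by fun_prop) (by fun_prop)
        | ih p => rw [hL, hL, hΛsmul])
      (fun a d d' => by rw [map_add, map_add]) (fun c a d => by rw [map_smul, map_smul]))
      (fun a b d d' => by simp only [LinearMap.mk₂_apply, map_mul, hLmul])
      (fun a d => by simp only [LinearMap.mk₂_apply, map_star, hLstar]))
  refine ⟨ρ, fun a x y => ?_⟩
  rw [← h.lift_tmul, hρ, tensorStarHom_tmul, LinearMap.mk₂_apply, StarAlgEquiv.apply_symm_apply,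
    ← hD.lift_tmul, hL, hΛ]

end SliceState

section Implementation

theorem tendsto_exp_mul {E ι : Type*} [NormedRing E] [NormedAlgebra ℂ E] [CompleteSpace E]
    {l : Filter ι} {X : ι → E} {C : ℝ} (hX : ∀ᶠ i in l, ‖X i‖ ≤ C) {b : ℕ → E}
    (hb : ∀ n, Tendsto (fun i => X i * b n) l (𝓝 (b (n + 1)))) {s : E}
    (hs : HasSum (fun n => ((n.factorial : ℂ)⁻¹) • b n) s) :
    Tendsto (fun i => NormedSpace.exp (X i) * b 0) l (𝓝 s) := by
  have hpow : ∀ n, Tendsto (fun i => X i ^ n * b 0) l (𝓝 (b n)) := by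
    intro n
    induction n with
    | zero => simpa using tendsto_const_nhds
    | succ n ih =>
      have h1 : Tendsto (fun i => X i * (X i ^ n * b 0 - b n)) l (𝓝 0) := by
        refine squeeze_zero_norm' (a := fun i => C * ‖X i ^ n * b 0 - b n‖) ?_ ?_
        · filter_upwards [hX] with i hi
          exact (norm_mul_le _ _).trans (mul_le_mul_of_nonneg_right hi (norm_nonneg _))
        · simpa using (tendsto_iff_norm_sub_tendsto_zero.1 ih).const_mul C
      have h2 := h1.add (hb n)
      rw [zero_add] at h2
      refine h2.congr fun i => ?_
      rw [mul_sub, sub_add_cancel, pow_succ', mul_assoc]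
  rw [← hs.tsum_eq]
  have hexp : ∀ i, NormedSpace.exp (X i) * b 0 =
      ∑' n : ℕ, ((n.factorial : ℂ)⁻¹) • (X i ^ n * b 0) := by
    intro i
    have h1 := (NormedSpace.exp_series_hasSum_exp' (𝕂 := ℂ) (X i)).mul_right (b 0)
    rw [← h1.tsum_eq]
    simp only [smul_mul_assoc]
  simp only [hexp]
  refine tendsto_tsum_of_dominated_convergence
    (bound := fun n : ℕ => C ^ n / n.factorial * ‖b 0‖)
    ((Real.summable_pow_div_factorial C).mul_right _)
    (fun n => (hpow n).const_smul _) ?_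
  filter_upwards [hX] with i hi n
  rw [norm_smul, norm_inv, RCLike.norm_natCast]
  have h1 : ‖X i ^ n * b 0‖ ≤ C ^ n * ‖b 0‖ := by
    rcases n with _ | n
    · simp
    · exact (norm_mul_le _ _).trans (mul_le_mul_of_nonneg_right
        ((norm_pow_le' _ n.succ_pos).trans (pow_le_pow_left₀ (norm_nonneg _) hi _))
        (norm_nonneg _))
  rw [div_eq_inv_mul, mul_assoc]
  exact mul_le_mul_of_nonneg_left h1 (by positivity)

variable {A : Type v} {D : Type w} {B : Type u} [NonUnitalCStarAlgebra A] [CStarAlgebra D]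
  [NonUnitalCStarAlgebra B]

theorem CStarTensor.tendsto_exp_mul_tmul (h : CStarTensor A D B) (a : A) (k g : D) :
    Tendsto (fun f => NormedSpace.exp (h.tmul f k : Unitization ℂ B) * (h.tmul a g : Unitization ℂ B))
      (CStarAlgebra.approximateUnit A)
      (𝓝 (h.tmul a (NormedSpace.exp k * g) : Unitization ℂ B)) := by
  have hcont : Continuous fun b : B => (b : Unitization ℂ B) :=
    (AddMonoidHomClass.isometry_of_norm (Unitization.inrNonUnitalStarAlgHom ℂ B)
      fun b => Unitization.norm_inr b).continuous
  have hX : ∀ᶠ f in CStarAlgebra.approximateUnit A, ‖(h.tmul f k : Unitization ℂ B)‖ ≤ ‖k‖ := by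
    filter_upwards [eventually_approximateUnit A] with f hf
    rw [Unitization.norm_inr, h.norm_tmul]
    exact mul_le_of_le_one_left (norm_nonneg k) hf.2
  have hb : ∀ n : ℕ, Tendsto
      (fun f => (h.tmul f k : Unitization ℂ B) * (h.tmul a (k ^ n * g) : Unitization ℂ B))
      (CStarAlgebra.approximateUnit A) (𝓝 (h.tmul a (k ^ (n + 1) * g) : Unitization ℂ B)) := by
    intro n
    have h1 : Tendsto (fun f => h.clm (f * a) (k ^ (n + 1) * g)) (CStarAlgebra.approximateUnit A)
        (𝓝 (h.clm a (k ^ (n + 1) * g))) :=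
      ((h.clm.flip (k ^ (n + 1) * g)).continuous.tendsto a).comp (tendsto_approximateUnit_mul a)
    refine ((hcont.tendsto _).comp h1).congr fun f => ?_
    rw [← Unitization.inr_mul, h.mul_tmul, ← mul_assoc, ← pow_succ']
    rfl
  have hs : HasSum (fun n : ℕ => ((n.factorial : ℂ)⁻¹) • (h.tmul a (k ^ n * g) : Unitization ℂ B))
      (h.tmul a (NormedSpace.exp k * g) : Unitization ℂ B) := by
    have h1 := (NormedSpace.exp_series_hasSum_exp' (𝕂 := ℂ) k).mul_right g
    have h2 := ((h1.mapL (h.clm a)).map (Unitization.inrNonUnitalStarAlgHom ℂ B) hcont)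
    convert h2 using 1
    · funext n
      simp only [Function.comp_apply, smul_mul_assoc, map_smul]
      rfl
    · rfl
  simpa using tendsto_exp_mul hX hb hs

/-- Conjugation by `1 ⊗ w` is approximately implemented by unitaries whose images under `ρ`
lift to unitaries over the algebra of bounded sequences. -/
def LiftableConj (h : CStarTensor A D B) (ρ : B →⋆ₙₐ[ℂ] Corona B) (w : unitary D) : Prop :=
  ∀ (F : Finset (A × D)) (ε : ℝ), 0 < ε →
    ∃ (V : unitary (Unitization ℂ (BoundedSeq B))) (W : unitary (Unitization ℂ B)),
      Unitization.starMap (Corona.mk B) (V : Unitization ℂ (BoundedSeq B)) =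
        Unitization.starMap ρ (W : Unitization ℂ B) ∧
      ∀ p ∈ F, ‖star (W : Unitization ℂ B) * (h.tmul p.1 p.2 : Unitization ℂ B) * W -
        (h.tmul p.1 (star (w : D) * p.2 * w) : Unitization ℂ B)‖ < ε

variable {h : CStarTensor A D B} {ρ : B →⋆ₙₐ[ℂ] Corona B}

theorem LiftableConj.one : LiftableConj h ρ 1 := fun F ε hε =>
  ⟨1, 1, by simp, fun p _ => by simpa using hε⟩

theorem LiftableConj.mul {w₁ w₂ : unitary D} (h₁ : LiftableConj h ρ w₁)
    (h₂ : LiftableConj h ρ w₂) : LiftableConj h ρ (w₁ * w₂) := by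
  classical
  intro F ε hε
  obtain ⟨V₁, W₁, e₁, H₁⟩ := h₁ F (ε / 2) (half_pos hε)
  obtain ⟨V₂, W₂, e₂, H₂⟩ := h₂ (F.image fun p => (p.1, star (w₁ : D) * p.2 * w₁)) (ε / 2)
    (half_pos hε)
  refine ⟨V₁ * V₂, W₁ * W₂, by rw [Submonoid.coe_mul, Submonoid.coe_mul, map_mul, map_mul, e₁, e₂],
    fun p hp => ?_⟩
  have H₁' := H₁ p hp
  have H₂' := H₂ _ (Finset.mem_image_of_mem _ hp)
  rw [← norm_unitary_conj W₂] at H₁'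
  refine lt_of_le_of_lt (le_trans (le_of_eq ?_) (norm_add_le _ _))
    ((add_lt_add H₁' H₂').trans_eq (add_halves ε))
  congr 1
  simp only [Submonoid.coe_mul, star_mul, mul_sub, sub_mul, mul_assoc, sub_add_sub_cancel]

theorem star_coe_expUnitary {E : Type*} [CStarAlgebra E] (y : selfAdjoint E) :
    star (selfAdjoint.expUnitary y : E) = NormedSpace.exp (-(Complex.I • (y : E))) := by
  let +nondep : NormedAlgebra ℚ E := .restrictScalars ℚ ℂ E
  rw [selfAdjoint.expUnitary_coe, NormedSpace.star_exp, star_smul, y.2.star_eq]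
  simp

theorem LiftableConj.expUnitary (k : selfAdjoint D) :
    LiftableConj h ρ (selfAdjoint.expUnitary k) := by
  intro F ε hε
  set w := selfAdjoint.expUnitary k with hw
  have key : ∀ (a : A) (g : D), ∀ᶠ f in CStarAlgebra.approximateUnit A,
      ‖NormedSpace.exp (h.tmul f (-(Complex.I • (k : D))) : Unitization ℂ B) * h.tmul a g -
        (h.tmul a (star (w : D) * g) : Unitization ℂ B)‖ < ε / 2 := by
    intro a g
    have h1 := tendsto_iff_norm_sub_tendsto_zero.1
      (h.tendsto_exp_mul_tmul a (-(Complex.I • (k : D))) g)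
    rw [← star_coe_expUnitary] at h1
    exact h1.eventually (gt_mem_nhds (half_pos hε))
  obtain ⟨f, ⟨hf, -⟩, hfF⟩ := ((eventually_approximateUnit A).and
    ((Finset.eventually_all F).2 fun p _ => (key p.1 p.2).and
      (key (star p.1) (star (star (w : D) * p.2))))).exists
  have hy : star (h.tmul f (k : D)) = h.tmul f (k : D) := by rw [h.star_tmul, hf, k.2.star_eq]
  obtain ⟨Y₀, hY₀⟩ := Corona.mk_surjective (ρ (h.tmul f (k : D)))
  let Y : BoundedSeq B := (1 / 2 : ℂ) • (Y₀ + star Y₀)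
  have hYs : star Y = Y := by
    simp [Y, add_comm]
  have hY : Corona.mk B Y = ρ (h.tmul f (k : D)) := by
    simp only [Y, map_smul, map_add, map_star, hY₀]
    rw [← map_star, hy, ← two_smul ℂ, smul_smul]
    norm_num
  let y' : selfAdjoint (Unitization ℂ B) :=
    ⟨(h.tmul f (k : D) : Unitization ℂ B), by rw [selfAdjoint.mem_iff, ← Unitization.inr_star, hy]⟩
  let Y' : selfAdjoint (Unitization ℂ (BoundedSeq B)) :=
    ⟨(Y : Unitization ℂ (BoundedSeq B)), by rw [selfAdjoint.mem_iff, ← Unitization.inr_star, hYs]⟩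
  have hW : star (selfAdjoint.expUnitary y' : Unitization ℂ B) =
      NormedSpace.exp (h.tmul f (-(Complex.I • (k : D))) : Unitization ℂ B) := by
    rw [star_coe_expUnitary]
    congr 1
    rw [← neg_smul, ← neg_smul, h.smul_right, Unitization.inr_smul]
  refine ⟨selfAdjoint.expUnitary Y', selfAdjoint.expUnitary y', ?_, fun p hp => ?_⟩
  · let +nondep : NormedAlgebra ℚ (Unitization ℂ B) := .restrictScalars ℚ ℂ _
    let +nondep : NormedAlgebra ℚ (Unitization ℂ (BoundedSeq B)) := .restrictScalars ℚ ℂ _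
    let +nondep : NormedAlgebra ℚ (Unitization ℂ (Corona B)) := .restrictScalars ℚ ℂ _
    rw [selfAdjoint.expUnitary_coe, selfAdjoint.expUnitary_coe,
      NormedSpace.map_exp _ (map_continuous _), NormedSpace.map_exp _ (map_continuous _),
      map_smul, map_smul, Unitization.starMap_inr, Unitization.starMap_inr, hY]
  · obtain ⟨h1, h2⟩ := hfF p hp
    rw [← hW] at h1 h2
    rw [← norm_star, star_sub, star_mul, star_star, ← Unitization.inr_star, ← Unitization.inr_star,
      h.star_tmul, h.star_tmul] at h2
    simp only [star_mul, star_star] at h2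
    rw [← CStarRing.norm_mul_coe_unitary _ (selfAdjoint.expUnitary y')] at h1
    refine lt_of_le_of_lt (le_trans (le_of_eq ?_) (norm_add_le _ _))
      ((add_lt_add h1 h2).trans_eq (add_halves ε))
    congr 1
    rw [sub_mul, sub_add_sub_cancel]

theorem LiftableConj.list_prod (l : List (selfAdjoint D)) :
    LiftableConj h ρ (l.map selfAdjoint.expUnitary).prod := by
  induction l with
  | nil => exact LiftableConj.one
  | cons k l ih =>
    rw [List.map_cons, List.prod_cons]
    exact (LiftableConj.expUnitary k).mul ih

end Implementation

section Existence

variable {B : Type u} [NonUnitalCStarAlgebra B]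

/-- Evaluation of (the unitization of) bounded sequences in the multiplier algebra. -/
def evalMultiplier (n : ℕ) : Unitization ℂ (BoundedSeq B) →⋆ₐ[ℂ] 𝓜(ℂ, B) :=
  Unitization.starLift
    { toFun := fun f : BoundedSeq B => ((f n : B) : 𝓜(ℂ, B))
      map_smul' := fun c f => map_smul (DoubleCentralizer.coeHom (𝕜 := ℂ) (A := B)) c (f n)
      map_zero' := map_zero (DoubleCentralizer.coeHom (𝕜 := ℂ) (A := B))
      map_add' := fun f g => map_add (DoubleCentralizer.coeHom (𝕜 := ℂ) (A := B)) (f n) (g n)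
      map_mul' := fun f g => map_mul (DoubleCentralizer.coeHom (𝕜 := ℂ) (A := B)) (f n) (g n)
      map_star' := fun f => map_star (DoubleCentralizer.coeHom (𝕜 := ℂ) (A := B)) (f n) }

theorem evalMultiplier_inr (n : ℕ) (f : BoundedSeq B) :
    evalMultiplier n (f : Unitization ℂ (BoundedSeq B)) = ((f n : B) : 𝓜(ℂ, B)) :=
  DFunLike.congr_fun (Unitization.starLift.symm_apply_apply _) f

theorem eventually_norm_conj_lt {ρ : B →⋆ₙₐ[ℂ] Corona B}
    {V : Unitization ℂ (BoundedSeq B)} {W : Unitization ℂ B}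
    (hVW : Unitization.starMap (Corona.mk B) V = Unitization.starMap ρ W) {b c : B}
    {f g : BoundedSeq B} (hf : Corona.mk B f = ρ b) (hg : Corona.mk B g = ρ c) {ε : ℝ}
    (h : ‖star W * (b : Unitization ℂ B) * W - (c : Unitization ℂ B)‖ < ε) :
    ∀ᶠ n in atTop, ‖star (evalMultiplier n V) * ((f n : B) : 𝓜(ℂ, B)) * evalMultiplier n V -
      ((g n : B) : 𝓜(ℂ, B))‖ < ε := by
  set x : Unitization ℂ (BoundedSeq B) :=
    star V * (f : Unitization ℂ (BoundedSeq B)) * V - (g : Unitization ℂ (BoundedSeq B)) with hx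
  have hxs : x = (x.snd : Unitization ℂ (BoundedSeq B)) := by
    refine Unitization.ext ?_ rfl
    change Unitization.fstHom ℂ (BoundedSeq B) x = 0
    rw [hx, map_sub, map_mul, map_mul]
    simp
  have h1 : Unitization.starMap (Corona.mk B) x =
      Unitization.starMap ρ (star W * (b : Unitization ℂ B) * W - (c : Unitization ℂ B)) := by
    rw [hx, map_sub, map_mul, map_mul, map_star, hVW, Unitization.starMap_inr,
      Unitization.starMap_inr, hf, hg, map_sub, map_mul, map_mul, map_star,
      Unitization.starMap_inr, Unitization.starMap_inr]
  have h2 : ‖Corona.mk B x.snd‖ < ε := by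
    rw [hxs, Unitization.starMap_inr] at h1
    rw [← Unitization.norm_inr (𝕜 := ℂ), h1]
    exact (NonUnitalStarAlgHom.norm_apply_le _ _).trans_lt h
  filter_upwards [Corona.eventually_norm_lt_of_norm_mk_lt h2] with n hn
  rw [← norm_coe_multiplier, ← evalMultiplier_inr, ← hxs, hx, map_sub, map_mul, map_mul,
    map_star, evalMultiplier_inr, evalMultiplier_inr] at hn
  exact hn

end Existence

section Forward

variable {A : Type u} {D : Type u} {TD AD : Type u} {QA : Type v}
  [NonUnitalCStarAlgebra A] [CStarAlgebra D] [CStarAlgebra TD]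
  [NonUnitalCStarAlgebra AD] [NonUnitalCStarAlgebra QA]

theorem exists_unitary_conj_near_fst {S : SliceState D} (hS : S.Approximates)
    (hD : MinTensor D D TD) (hDu : hD.tmul 1 1 = 1) (φ : D ≃⋆ₐ[ℂ] TD)
    (hφ : ApproxUnitaryEquiv φ hD.fst) (hK1 : K1Injective D) (h : CStarTensor A D AD)
    (hQ : IsSeqCorona A QA) (σ : AD →⋆ₙₐ[ℂ] QA) (hσ : ∀ a, σ (h.tmul a 1) = hQ.incl a)
    (F : Finset A) (G : Finset (A × D)) {ε : ℝ} (hε : 0 < ε) :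
    ∃ v : unitary 𝓜(ℂ, AD),
      (∀ a ∈ F, ‖star (v : 𝓜(ℂ, AD)) * (h.tmul a 1 : AD) * v - (h.tmul a 1 : AD)‖ < ε) ∧
      ∀ p ∈ G, ∃ c, ‖star (v : 𝓜(ℂ, AD)) * (h.tmul p.1 p.2 : AD) * v - (h.tmul c 1 : AD)‖ < ε := by
  classical
  obtain ⟨κ, hκ⟩ := hQ.exists_tmul h
  obtain ⟨ρ, hρ⟩ := hS.exists_extend_triple h hD.toCStarTensor φ σ κ
  have hφ1 : φ.symm (hD.tmul 1 1) = 1 := by rw [hDu, map_one]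
  have hρ2 : ∀ a c, ρ (h.tmul a (φ.symm (hD.tmul 1 c))) =
      Corona.mk AD (h.seqTmul (constSeq a) c) := by
    intro a c
    rw [hρ, hσ]
    exact hκ _ _
  have hρ1 : ∀ a c s, hQ.q s = σ (h.tmul a c) →
      ρ (h.tmul a (φ.symm (hD.tmul c 1))) = Corona.mk AD (h.seqTmul s 1) := by
    intro a c s hs
    rw [hρ, ← hs, hκ]
  choose s hs using fun p : A × D => hQ.surjective (σ (h.tmul p.1 p.2))
  let M : ℝ := ∑ p ∈ G, ‖p.1‖
  have hM0 : 0 ≤ M := Finset.sum_nonneg fun p _ => norm_nonneg _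
  have hM : ∀ p ∈ G, ‖p.1‖ ≤ M := fun p hp =>
    Finset.single_le_sum (f := fun p : A × D => ‖p.1‖) (fun p _ => norm_nonneg _) hp
  obtain ⟨l, w, hl, hw⟩ := exists_unitary_prod_exp hDu φ hφ hK1 (G.image Prod.snd)
    (ε := ε / 2 / (M + 1)) (by positivity)
  obtain ⟨V, W, hVW, hW⟩ := hl ▸ LiftableConj.list_prod (h := h) (ρ := ρ) l
    (G.image (fun p : A × D => (p.1, φ.symm (hD.tmul 1 p.2))) ∪ F.image fun a => (a, 1)) (ε / 2)
    (half_pos hε)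
  let v : ℕ → 𝓜(ℂ, AD) := fun n => evalMultiplier n (V : Unitization ℂ (BoundedSeq AD))
  have hF : ∀ a ∈ F, ∀ᶠ n in atTop,
      ‖star (v n) * (h.tmul a 1 : AD) * v n -
        (h.tmul a 1 : AD)‖ < ε := by
    intro a ha
    have h1 := hW _ (Finset.mem_union_right _ (Finset.mem_image_of_mem _ ha))
    have h2 := hρ2 a 1
    rw [hφ1] at h2
    rw [mul_one, Unitary.coe_star_mul_self] at h1
    exact eventually_norm_conj_lt hVW h2.symm h2.symm (h1.trans (half_lt_self hε))
  have hG : ∀ p ∈ G, ∀ᶠ n in atTop,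
      ‖star (v n) * (h.tmul p.1 p.2 : AD) * v n -
        (h.tmul ((s p : ℕ → A) n) 1 : AD)‖ < ε := by
    intro p hp
    have h1 := hW _ (Finset.mem_union_left _ (Finset.mem_image_of_mem _ hp))
    refine eventually_norm_conj_lt hVW (hρ2 p.1 p.2).symm (hρ1 p.1 p.2 _ (hs p)).symm ?_
    have h3 : ‖(h.tmul p.1 (star (w : D) * φ.symm (hD.tmul 1 p.2) * w) : Unitization ℂ AD) -
        (h.tmul p.1 (φ.symm (hD.tmul p.2 1)) : Unitization ℂ AD)‖ ≤ ε / 2 := by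
      rw [← Unitization.inr_sub, Unitization.norm_inr, ← h.tmul_sub, h.norm_tmul]
      refine (mul_le_mul ((hM p hp).trans (le_add_of_nonneg_right zero_le_one))
        (hw p.2 (Finset.mem_image_of_mem _ hp)).le (norm_nonneg _) (by positivity)).trans_eq ?_
      field_simp
    refine lt_of_le_of_lt (le_trans (le_of_eq ?_) (norm_add_le _ _))
      ((add_lt_add_of_lt_of_le h1 h3).trans_eq (add_halves ε))
    rw [sub_add_sub_cancel]
  obtain ⟨n, hn1, hn2⟩ := (((Finset.eventually_all F).2 hF).and
    ((Finset.eventually_all G).2 hG)).exists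
  exact ⟨⟨v n, Unitary.map_mem (evalMultiplier n) V.2⟩, hn1,
    fun p hp => ⟨_, hn2 p hp⟩⟩

end Forward

theorem CStarTensor.separableSpace {A : Type u} {B : Type v} {T : Type w} [NonUnitalCStarAlgebra A]
    [NonUnitalCStarAlgebra B] [NonUnitalCStarAlgebra T] [TopologicalSpace.SeparableSpace A]
    [TopologicalSpace.SeparableSpace B] (h : CStarTensor A B T) :
    TopologicalSpace.SeparableSpace T := by
  have h1 : TopologicalSpace.IsSeparable {t : T | ∃ a b, h.tmul a b = t} := by
    convert TopologicalSpace.isSeparable_range h.continuous_tmul using 1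
    ext t
    simp
  have h2 := (h1.span (R := ℂ)).closure
  rw [h.dense_span.closure_eq] at h2
  exact TopologicalSpace.isSeparable_univ_iff.1 h2

section Forward

variable {A : Type u} {D : Type u} {TD AD : Type u} {QA : Type v}
  [NonUnitalCStarAlgebra A] [CStarAlgebra D] [CStarAlgebra TD]
  [NonUnitalCStarAlgebra AD] [NonUnitalCStarAlgebra QA]

/-- The *-homomorphism `a ↦ a ⊗ 1`. -/
def CStarTensor.fstHom (h : CStarTensor A D AD) : A →⋆ₙₐ[ℂ] AD where
  toFun a := h.tmul a 1
  map_smul' c a := h.smul_left c a 1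
  map_zero' := h.zero_tmul 1
  map_add' a b := h.add_left a b 1
  map_mul' a b := by rw [h.mul_tmul, one_mul]
  map_star' a := by rw [h.star_tmul, star_one]

theorem exists_equiv_of_corona_hom [TopologicalSpace.SeparableSpace A]
    [TopologicalSpace.SeparableSpace D] [Nontrivial D] {S : SliceState D} (hS : S.Approximates)
    (hD : MinTensor D D TD) (hDu : hD.tmul 1 1 = 1) (φ : D ≃⋆ₐ[ℂ] TD)
    (hφ : ApproxUnitaryEquiv φ hD.fst) (hK1 : K1Injective D) (h : CStarTensor A D AD)
    (hQ : IsSeqCorona A QA) (σ : AD →⋆ₙₐ[ℂ] QA) (hσ : ∀ a, σ (h.tmul a 1) = hQ.incl a) :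
    ∃ α : A ≃⋆ₐ[ℂ] AD, ApproxUnitaryEquiv α (fun a => h.tmul a 1) := by
  classical
  have _ := h.separableSpace
  refine exists_equiv_of_intertwining h.fstHom (fun a => ?_) fun F b ε hε => ?_
  · change ‖h.tmul a 1‖ = _
    rw [h.norm_tmul, norm_one, mul_one]
  obtain ⟨p, hp⟩ := h.exists_lift_near b (half_pos hε)
  obtain ⟨n, x, y, rfl⟩ := TensorProduct.exists_sum_tmul_eq p
  have hδ : 0 < ε / 2 / (n + 1) := by positivity
  obtain ⟨v, hvF, hvG⟩ := exists_unitary_conj_near_fst hS hD hDu φ hφ hK1 h hQ σ hσ F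
    (Finset.univ.image fun i => (x i, y i)) hδ
  refine ⟨v, fun a ha => ?_, ?_⟩
  · refine (norm_conj_sub v _ _).trans_le ((hvF a ha).le.trans ?_)
    exact (div_le_self (half_pos hε).le (by simp)).trans (half_le_self hε.le)
  · choose c hc using fun i => hvG (x i, y i) (Finset.mem_image_of_mem _ (Finset.mem_univ i))
    refine ⟨∑ i, c i, ?_⟩
    have h1 : ∀ i, ‖conjHom v (h.fstHom (c i)) - h.tmul (x i) (y i)‖ ≤ ε / 2 / (n + 1) :=
      fun i => (norm_conj_sub v _ _).trans_le (hc i).le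
    have h2 : ‖∑ i, (conjHom v (h.fstHom (c i)) - h.tmul (x i) (y i))‖ ≤ ε / 2 := by
      refine (norm_sum_le_of_le _ fun i _ => h1 i).trans ?_
      rw [Finset.sum_const, Finset.card_univ, Fintype.card_fin, nsmul_eq_mul, mul_div_assoc',
        div_le_iff₀ (by positivity)]
      nlinarith
    refine (le_trans (le_of_eq ?_) (norm_add_le _ _)).trans
      ((add_le_add h2 hp.le).trans_eq (add_halves ε))
    simp only [map_sum, Finset.sum_sub_distrib, h.lift_tmul, sub_add_sub_cancel]

end Forward

section Backward

variable {A : Type u} {D : Type v} {T : Type w} [NonUnitalCStarAlgebra A] [CStarAlgebra D]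
  [NonUnitalCStarAlgebra T]

/-- Right multiplication by `1 ⊗ c`. -/
theorem CStarTensor.exists_rightMul (h : CStarTensor A D T) (c : D) :
    ∃ R : T →L[ℂ] T, ∀ a x, R (h.tmul a x) = h.tmul a (x * c) := by
  let Λ : A ⊗[ℂ] D →ₗ[ℂ] T :=
    (h.lift : A ⊗[ℂ] D →ₗ[ℂ] T) ∘ₗ LinearMap.lTensor A (LinearMap.mulRight ℂ c)
  have hΛ : ∀ a x, Λ (a ⊗ₜ x) = h.tmul a (x * c) := fun a x => h.lift_tmul _ _
  refine ⟨Λ.extendOfNorm (h.lift : A ⊗[ℂ] D →ₗ[ℂ] T), fun a x => ?_⟩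
  rw [← h.lift_tmul, ← hΛ]
  exact LinearMap.extendOfNorm_eq (f := Λ) (e := (h.lift : A ⊗[ℂ] D →ₗ[ℂ] T)) h.denseRange_lift
    ⟨‖c‖, h.norm_lift_mulRight_le c⟩ (a ⊗ₜ x)

theorem CStarTensor.clm_ext {E : Type*} [NormedAddCommGroup E] [NormedSpace ℂ E]
    (h : CStarTensor A D T) {f g : T →L[ℂ] E} (hfg : ∀ a x, f (h.tmul a x) = g (h.tmul a x)) :
    f = g := by
  ext t
  induction t using h.denseRange_lift.induction_on with
  | hp => exact isClosed_eq (by fun_prop) (by fun_prop)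
  | ih p =>
    induction p with
    | zero => simp
    | add p q hp hq => simp only [map_add, hp, hq]
    | tmul a x => rw [h.lift_tmul, hfg]

/-- The action of a commuting pair of endomorphisms on the second tensor factor. -/
theorem SliceState.Approximates.exists_hom_of_commute {S : SliceState D} (hS : S.Approximates)
    (h : CStarTensor A D T) (c₁ c₂ : D →⋆ₙₐ[ℂ] D) (hc : ∀ x y, Commute (c₁ x) (c₂ y)) :
    ∃ Ψ : T ⊗[ℂ] D →⋆ₙₐ[ℂ] T, ∀ a x y,
      Ψ (h.tmul a x ⊗ₜ y) = h.tmul a (c₁ x * c₂ y) := by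
  obtain ⟨ρ, hρ'⟩ := hS.exists_extend h (tensorStarHom (h.bil.compl₂ (c₁ : D →ₗ[ℂ] D))
    (fun a a' x x' => by simp [h.mul_tmul]) (fun a x => by simp [h.star_tmul, map_star]))
  have hρ : ∀ a x, ρ (h.tmul a x) = h.tmul a (c₁ x) := fun a x => by
    rw [← h.lift_tmul, hρ', tensorStarHom_tmul]
    rfl
  choose R hR using h.exists_rightMul
  let r : T →L[ℂ] T := ⟨(ρ : T →ₗ[ℂ] T), map_continuous ρ⟩
  have hr : ∀ a x, r (h.tmul a x) = h.tmul a (c₁ x) := hρ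
  have hradd : ∀ c c', R (c + c') = R c + R c' := fun c c' =>
    h.clm_ext fun a x => by simp [hR, mul_add, h.add_right]
  have hrsmul : ∀ (k : ℂ) c, R (k • c) = k • R c := fun k c =>
    h.clm_ext fun a x => by simp [hR, h.smul_right]
  have hmul : ∀ s t y z, R (c₂ y) (r s) * R (c₂ z) (r t) = R (c₂ (y * z)) (r (s * t)) := by
    intro s t y z
    have h1 : ∀ a x, (ContinuousLinearMap.mul ℂ T (R (c₂ y) (r (h.tmul a x)))).comp
        ((R (c₂ z)).comp r) = ((R (c₂ (y * z))).comp r).comp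
          (ContinuousLinearMap.mul ℂ T (h.tmul a x)) := fun a x =>
      h.clm_ext fun b x' => by
        have h2 : c₁ x * c₂ y * (c₁ x' * c₂ z) = c₁ x * c₁ x' * (c₂ y * c₂ z) := by
          rw [mul_assoc, ← mul_assoc (c₂ y), ← (hc x' y).eq]
          noncomm_ring
        simp [hr, hR, h.mul_tmul, h2]
    have h3 : ((ContinuousLinearMap.mul ℂ T).flip (R (c₂ z) (r t))).comp ((R (c₂ y)).comp r) =
        ((R (c₂ (y * z))).comp r).comp ((ContinuousLinearMap.mul ℂ T).flip t) :=
      h.clm_ext fun a x => by simpa using DFunLike.congr_fun (h1 a x) t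
    simpa using DFunLike.congr_fun h3 s
  have hstar : ∀ s y, star (R (c₂ y) (r s)) = R (c₂ (star y)) (r (star s)) := by
    intro s y
    induction s using h.denseRange_lift.induction_on with
    | hp => exact isClosed_eq (by fun_prop) (by fun_prop)
    | ih p =>
      induction p with
      | zero => simp
      | add p q hp hq => simp only [map_add, star_add, hp, hq]
      | tmul a x =>
        rw [h.lift_tmul, hr, hR, h.star_tmul, h.star_tmul, hr, hR, star_mul, map_star, map_star,
          ((hc x y).star_star).eq]
  refine ⟨tensorStarHom (LinearMap.mk₂ ℂ (fun t y => R (c₂ y) (r t)) ?_ ?_ ?_ ?_) ?_ ?_,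
    fun a x y => ?_⟩
  · intro s t y
    simp
  · intro k s y
    simp
  · intro s y z
    rw [map_add, hradd, add_apply]
  · intro k s y
    rw [map_smul, hrsmul, smul_apply]
  · exact fun s t y z => hmul s t y z
  · exact fun s y => hstar s y
  · refine (tensorStarHom_tmul ..).trans ?_
    rw [LinearMap.mk₂_apply, hr, hR]

end Backward

section BackwardUnital

variable {A : Type u} {D : Type u} {TD AD : Type u} {QA : Type v}
  [NonUnitalCStarAlgebra A] [CStarAlgebra D] [CStarAlgebra TD]
  [NonUnitalCStarAlgebra AD] [NonUnitalCStarAlgebra QA]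

theorem exists_hom_near_inverse [Nontrivial D] {S : SliceState D} (hS : S.Approximates)
    (hD : MinTensor D D TD) (hDu : hD.tmul 1 1 = 1) (φ : D ≃⋆ₐ[ℂ] TD) (hφ : ApproxUnitaryEquiv φ hD.fst)
    (h : CStarTensor A D AD) (α : A ≃⋆ₐ[ℂ] AD) (F : Finset A) {ε : ℝ} (hε : 0 < ε) :
    ∃ ρ : AD →⋆ₙₐ[ℂ] A, ∀ a ∈ F, ‖ρ (h.tmul a 1) - a‖ < ε := by
  classical
  have hε3 : 0 < ε / 3 := by positivity
  choose p hp using fun a => h.exists_lift_near (α a) hε3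
  choose n x y hxy using fun a => TensorProduct.exists_sum_tmul_eq (p a)
  let M : ℝ := ∑ a ∈ F, ∑ i, ‖x a i‖
  have hM : 0 ≤ M := by positivity
  obtain ⟨u, hu⟩ := hφ.finiteUnitaryEquiv (F.biUnion fun a => Finset.univ.image (y a))
    (ε / 3 / (M + 1)) (by positivity)
  let θ : TD ≃⋆ₐ[ℂ] D := (Unitary.conjStarAlgAut ℂ TD u).trans φ.symm
  have hθ : ∀ t, φ (θ t) = u * t * star (u : TD) := fun t => φ.apply_symm_apply _
  obtain ⟨Ψ, hΨ⟩ := hS.exists_hom_of_commute h ((θ : TD →⋆ₙₐ[ℂ] D).comp hD.fstHom)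
    ((θ : TD →⋆ₙₐ[ℂ] D).comp hD.swap.fstHom) fun c d => by
      change θ (hD.tmul c 1) * θ (hD.tmul 1 d) = θ (hD.tmul 1 d) * θ (hD.tmul c 1)
      rw [← map_mul, ← map_mul, hD.mul_tmul, hD.mul_tmul]
      simp only [one_mul, mul_one]
  let Γ : AD →ₗ[ℂ] AD := (Ψ : AD ⊗[ℂ] D →ₗ[ℂ] AD) ∘ₗ (TensorProduct.mk ℂ AD D).flip 1
  have hΓ : ∀ t, Γ t = Ψ (t ⊗ₜ 1) := fun t => rfl
  have hΓt : ∀ b c, Γ (h.tmul b c) = h.tmul b (θ (hD.tmul c 1)) := fun b c => by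
    rw [hΓ, hΨ]
    change h.tmul b (θ (hD.tmul c 1) * θ (hD.tmul 1 1)) = _
    rw [hDu, map_one, mul_one]
  have hΓn : ∀ t, ‖Γ t‖ ≤ ‖t‖ := fun t => by
    exact (norm_starHom_tmul_le Ψ t 1).trans_eq (by rw [norm_one, mul_one])
  obtain ⟨σ, hσ⟩ := hS.exists_extend h (tensorStarHom
    ((TensorProduct.mk ℂ AD D).compr₂ (Ψ : AD ⊗[ℂ] D →ₗ[ℂ] AD) ∘ₗ (α : A →ₗ[ℂ] AD))
    (fun a a' d d' => by
      change Ψ (α a ⊗ₜ d) * Ψ (α a' ⊗ₜ d') = Ψ (α (a * a') ⊗ₜ (d * d'))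
      rw [← map_mul, Algebra.TensorProduct.tmul_mul_tmul, map_mul α])
    (fun a d => by
      change star (Ψ (α a ⊗ₜ d)) = Ψ (α (star a) ⊗ₜ star d)
      rw [← map_star, TensorProduct.star_tmul, map_star α]))
  have hσ1 : ∀ a, σ (h.tmul a 1) = Γ (α a) := fun a => by
    rw [← h.lift_tmul, hσ, tensorStarHom_tmul]
    rfl
  refine ⟨(α.symm : AD →⋆ₙₐ[ℂ] A).comp σ, fun a ha => ?_⟩
  have h1 : ‖(α.symm : AD →⋆ₙₐ[ℂ] A) (σ (h.tmul a 1) - α a)‖ ≤ ‖σ (h.tmul a 1) - α a‖ :=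
    NonUnitalStarAlgHom.norm_apply_le _ _
  have h2 : (α.symm : AD →⋆ₙₐ[ℂ] A) (σ (h.tmul a 1) - α a) = α.symm (σ (h.tmul a 1)) - a := by
    rw [map_sub]
    exact congrArg _ (α.symm_apply_apply a)
  rw [h2, hσ1] at h1
  change ‖α.symm (σ (h.tmul a 1)) - a‖ < ε
  rw [hσ1]
  refine h1.trans_lt ?_
  have h3 : ‖Γ (h.lift (p a)) - h.lift (p a)‖ ≤ ε / 3 := by
    rw [hxy a]
    simp only [map_sum, h.lift_tmul, hΓt, ← Finset.sum_sub_distrib, ← h.tmul_sub]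
    have h4 : ∀ i, ‖h.tmul (x a i) (θ (hD.tmul (y a i) 1) - y a i)‖ ≤
        ‖x a i‖ * (ε / 3 / (M + 1)) := fun i => by
      rw [h.norm_tmul]
      refine mul_le_mul_of_nonneg_left ?_ (norm_nonneg _)
      have h5 := hu (y a i) (Finset.mem_biUnion.2 ⟨a, ha,
        Finset.mem_image_of_mem _ (Finset.mem_univ i)⟩)
      rw [norm_unitary_conj_sub] at h5
      refine le_trans (le_of_eq ?_) h5.le
      rw [← NonUnitalStarAlgHom.norm_map (φ : D →⋆ₙₐ[ℂ] TD) φ.injective, map_sub]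
      exact congrArg (fun t => ‖t - φ (y a i)‖) (hθ _)
    refine (norm_sum_le_of_le _ fun i _ => h4 i).trans ?_
    rw [← Finset.sum_mul, mul_div_assoc', div_le_iff₀ (by positivity), mul_comm]
    have h6 : ∑ i, ‖x a i‖ ≤ M :=
      Finset.single_le_sum (f := fun a => ∑ i, ‖x a i‖) (fun _ _ => by positivity) ha
    exact mul_le_mul_of_nonneg_left (h6.trans (by linarith)) hε3.le
  have h7 : ‖Γ (α a - h.lift (p a))‖ < ε / 3 := by
    refine (hΓn _).trans_lt ?_
    rw [norm_sub_rev]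
    exact hp a
  calc ‖Γ (α a) - α a‖
      = ‖Γ (α a - h.lift (p a)) + (Γ (h.lift (p a)) - h.lift (p a)) + (h.lift (p a) - α a)‖ := by
        rw [map_sub]
        congr 1
        abel
    _ ≤ _ := norm_add₃_le
    _ < ε := by linarith [hp a]

theorem exists_corona_hom_of_equiv [TopologicalSpace.SeparableSpace A] [Nontrivial D]
    {S : SliceState D} (hS : S.Approximates) (hD : MinTensor D D TD) (hDu : hD.tmul 1 1 = 1)
    (φ : D ≃⋆ₐ[ℂ] TD) (hφ : ApproxUnitaryEquiv φ hD.fst) (h : CStarTensor A D AD) (hQ : IsSeqCorona A QA)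
    (α : A ≃⋆ₐ[ℂ] AD) : ∃ σ : AD →⋆ₙₐ[ℂ] QA, ∀ a, σ (h.tmul a 1) = hQ.incl a := by
  classical
  choose ρ hρ using fun n : ℕ => exists_hom_near_inverse hS hD hDu φ hφ h α
    ((Finset.range (n + 1)).image (TopologicalSpace.denseSeq A)) (Nat.one_div_pos_of_nat (n := n))
  have hlim : ∀ a, Tendsto (fun n => ‖ρ n (h.tmul a 1) - a‖) atTop (𝓝 0) := by
    intro a
    refine Metric.tendsto_atTop.2 fun ε hε => ?_
    have hε3 : 0 < ε / 3 := by positivity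
    obtain ⟨k, hk⟩ := (TopologicalSpace.denseRange_denseSeq A).exists_dist_lt a hε3
    set b := TopologicalSpace.denseSeq A k
    rw [dist_eq_norm] at hk
    obtain ⟨N, hN⟩ := exists_nat_one_div_lt hε3
    refine ⟨max N k, fun n hn => ?_⟩
    rw [Real.dist_0_eq_abs, abs_norm]
    have h1 := hρ n b (Finset.mem_image_of_mem _ (Finset.mem_range.2 (by omega)))
    have h2 : (1 : ℝ) / (n + 1) ≤ 1 / (N + 1) :=
      Nat.one_div_le_one_div ((le_max_left _ _).trans hn)
    have h3 : ‖ρ n (h.tmul (a - b) 1)‖ ≤ ‖a - b‖ :=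
      (NonUnitalStarAlgHom.norm_apply_le _ _).trans_eq (by rw [h.norm_tmul, norm_one, mul_one])
    calc ‖ρ n (h.tmul a 1) - a‖
        = ‖ρ n (h.tmul (a - b) 1) + (ρ n (h.tmul b 1) - b) + (b - a)‖ := by
          rw [h.sub_tmul, map_sub]
          congr 1
          abel
      _ ≤ _ := norm_add₃_le
      _ < ε := by
        rw [norm_sub_rev b a]
        linarith
  let s : AD →⋆ₙₐ[ℂ] boundedSeqs A :=
    { toFun := fun t => ⟨fun n => ρ n t, ‖t‖, fun n => NonUnitalStarAlgHom.norm_apply_le _ _⟩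
      map_smul' := fun c t => Subtype.ext (funext fun n => map_smul (ρ n) c t)
      map_zero' := Subtype.ext (funext fun n => map_zero (ρ n))
      map_add' := fun t t' => Subtype.ext (funext fun n => map_add (ρ n) t t')
      map_mul' := fun t t' => Subtype.ext (funext fun n => map_mul (ρ n) t t')
      map_star' := fun t => Subtype.ext (funext fun n => map_star (ρ n) t) }
  refine ⟨hQ.q.comp s, fun a => ?_⟩
  refine sub_eq_zero.1 ?_
  change hQ.q (s (h.tmul a 1)) - hQ.q (constSeq a) = 0
  rw [← map_sub, hQ.ker_iff]
  exact hlim a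

end BackwardUnital

end Order

section Degenerate

variable {A : Type u} {D : Type u} {AD : Type u} {QA : Type v}
  [NonUnitalCStarAlgebra A] [CStarAlgebra D] [NonUnitalCStarAlgebra AD]
  [NonUnitalCStarAlgebra QA]

theorem CStarTensor.subsingleton_of_right [Subsingleton D] (h : CStarTensor A D AD) :
    Subsingleton AD := by
  refine subsingleton_of_forall_eq 0 fun t => ?_
  induction t using h.denseRange_lift.induction_on with
  | hp => exact isClosed_eq continuous_id continuous_const
  | ih p =>
    induction p with
    | zero => exact map_zero _
    | add p q hp hq => rw [map_add, hp, hq, add_zero]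
    | tmul a d => rw [h.lift_tmul, Subsingleton.elim d 0, h.tmul_zero]

theorem IsSeqCorona.incl_eq_zero_iff (hQ : IsSeqCorona A QA) (a : A) :
    hQ.incl a = 0 ↔ a = 0 := by
  rw [IsSeqCorona.incl, hQ.ker_iff, ← norm_eq_zero (a := a)]
  exact tendsto_const_nhds_iff (X := ℝ) (l := atTop (α := ℕ)) (c := ‖a‖) (d := 0)

theorem exists_equiv_of_subsingleton [Subsingleton A] [Subsingleton AD] (ψ : A → AD) :
    ∃ φ : A ≃⋆ₐ[ℂ] AD, ApproxUnitaryEquiv φ ψ := by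
  refine ⟨{ toFun := 0
            invFun := 0
            left_inv := fun _ => Subsingleton.elim _ _
            right_inv := fun _ => Subsingleton.elim _ _
            map_mul' := fun _ _ => Subsingleton.elim _ _
            map_add' := fun _ _ => Subsingleton.elim _ _
            map_star' := fun _ => Subsingleton.elim _ _
            map_smul' := fun _ _ => Subsingleton.elim _ _ }, fun _ => 1, fun _ => one_mem _,
    fun a => ?_⟩
  refine tendsto_const_nhds.congr fun n => ?_
  rw [star_one, one_mul, mul_one, Subsingleton.elim (ψ a), sub_self, norm_zero]

end Degenerate

/-- Let `A`, `D` be separable C*-algebras with `D` unital, strongly self-absorbing and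
`K₁`-injective, and let `AD ≅ A ⊗ D` and `QA ≅ Q(A)`.  Then `A ≅ A ⊗ D` iff there is a
*-homomorphism `σ : A ⊗ D → Q(A)` with `σ(a ⊗ 1_D) = a` for all `a ∈ A`; moreover, in
this case the isomorphism can be chosen approximately unitarily equivalent to
`id_A ⊗ 1_D`. -/
theorem stmt_9 {A : Type u} {D : Type u} {TD AD : Type u} {QA : Type v}
    [NonUnitalCStarAlgebra A] [CStarAlgebra D] [CStarAlgebra TD]
    [NonUnitalCStarAlgebra AD] [NonUnitalCStarAlgebra QA]
    [TopologicalSpace.SeparableSpace A] [TopologicalSpace.SeparableSpace D]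
    (hD : MinTensor D D TD) (hDu : hD.tmul 1 1 = 1)
    (hssa : IsStronglySelfAbsorbing hD) (hK1 : K1Injective D)
    (hAD : MinTensor A D AD)
    (hQ : IsSeqCorona A QA) :
    (Nonempty (A ≃⋆ₐ[ℂ] AD) ↔
      ∃ σ : AD →⋆ₙₐ[ℂ] QA, ∀ a : A, σ (hAD.tmul a 1) = hQ.incl a) ∧
    ((∃ σ : AD →⋆ₙₐ[ℂ] QA, ∀ a : A, σ (hAD.tmul a 1) = hQ.incl a) →
      ∃ φ : A ≃⋆ₐ[ℂ] AD, ApproxUnitaryEquiv (⇑φ) (fun a => hAD.tmul a 1)) := by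
  have key : (Nonempty (A ≃⋆ₐ[ℂ] AD) →
      ∃ σ : AD →⋆ₙₐ[ℂ] QA, ∀ a : A, σ (hAD.tmul a 1) = hQ.incl a) ∧
      ((∃ σ : AD →⋆ₙₐ[ℂ] QA, ∀ a : A, σ (hAD.tmul a 1) = hQ.incl a) →
        ∃ φ : A ≃⋆ₐ[ℂ] AD, ApproxUnitaryEquiv (⇑φ) (fun a => hAD.tmul a 1)) := by
    obtain ⟨-, φ, hφ⟩ := hssa
    rcases subsingleton_or_nontrivial D with hsub | hnt
    · have _ := hAD.subsingleton_of_right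
      refine ⟨fun ⟨α⟩ => ⟨0, fun a => ?_⟩, fun ⟨σ, hσ⟩ => ?_⟩
      · exact ((hQ.incl_eq_zero_iff a).2 (α.injective (Subsingleton.elim _ _))).symm
      · have _ : Subsingleton A := subsingleton_of_forall_eq 0 fun a => by
          rw [← hQ.incl_eq_zero_iff, ← hσ, Subsingleton.elim (hAD.tmul a 1) 0, map_zero]
        exact exists_equiv_of_subsingleton _
    · obtain ⟨S⟩ := exists_sliceState D
      have hS := FiniteUnitaryEquiv.approximates S
        (IsStronglySelfAbsorbing.halfFlip hD hDu φ hφ).symm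
      exact ⟨fun ⟨α⟩ => exists_corona_hom_of_equiv hS hD hDu φ hφ hAD.toCStarTensor hQ α,
        fun ⟨σ, hσ⟩ => exists_equiv_of_corona_hom hS hD hDu φ hφ hK1 hAD.toCStarTensor hQ σ hσ⟩
  exact ⟨⟨key.1, fun h => let ⟨φ, _⟩ := key.2 h; ⟨φ⟩⟩, key.2⟩
end
end

section
/- Let A be a separable C*-algebra sitting as a closed two-sided ideal in a separable unital C*-algebra B. Then there is a sequence of unital *-homomorphisms βₙ : C([0,1]) → A⁺ ⊆ B (where A⁺ is the unitization of A inside B) such that: (i) βₙ(C₀([0,1))) ⊆ A, regarding C₀([0,1)) as the ideal of functions vanishing at 1 in C([0,1]); (ii) ‖βₙ(h)a − h(0)·a‖ → 0 for all h ∈ C([0,1]) and a ∈ A; (iii) ‖[βₙ(h), b]‖ → 0 for all h ∈ C([0,1]) and b ∈ B. -/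
open scoped MultiplierAlgebra TensorProduct
open Filter Topology

noncomputable section

universe u v w x

/-- A closed two-sided ideal of a C*-algebra is closed under the star operation. -/
theorem star_mem_of_isClosed_ideal {B : Type*} [CStarAlgebra B] {J : Set B} (hclosed : IsClosed J)
    (hideal : ∀ x ∈ J, ∀ b : B, b * x ∈ J ∧ x * b ∈ J) {x : B} (hx : x ∈ J) : star x ∈ J := by
  let _ := CStarAlgebra.spectralOrder B
  have := CStarAlgebra.spectralOrderedRing B
  set a : B := star x * x with ha
  have ha0 : 0 ≤ a := star_mul_self_nonneg x
  have hsa : IsSelfAdjoint a := .of_nonneg ha0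
  have hspec (t : ℝ) (ht : t ∈ spectrum ℝ a) : 0 ≤ t := spectrum_nonneg_of_nonneg ha0 ht
  let g (n : ℕ) (t : ℝ) : ℝ := (1 + (n + 1) * t)⁻¹
  have hpos (n : ℕ) (t : ℝ) (ht : t ∈ spectrum ℝ a) : 0 < 1 + ((n : ℝ) + 1) * t := by
    have := hspec t ht
    positivity
  have hg (n : ℕ) : ContinuousOn (g n) (spectrum ℝ a) :=
    ContinuousOn.inv₀ (by fun_prop) fun t ht => (hpos n t ht).ne'
  let G (n : ℕ) : B := cfc (g n) a
  have hGsa (n : ℕ) : star (G n) = G n := (cfc_predicate (g n) a : IsSelfAdjoint _)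
  have hGcfc (n : ℕ) : 1 - G n = (((n : ℝ) + 1 : ℝ) : ℂ) • (a * G n) := by
    have h1 : G n + ((n : ℝ) + 1) • (a * G n) = 1 := by
      have h2 : a * G n = cfc (fun t => t * g n t) a := by
        rw [cfc_mul (fun t => t) (g n) a (by fun_prop) (hg n), cfc_id' ℝ a]
      rw [h2, ← cfc_smul _ _ a (by fun_prop), ← cfc_add a (g n) _ (hg n) (by fun_prop),
        ← cfc_one ℝ a]
      refine cfc_congr fun t ht => ?_
      have := (hpos n t ht).ne'
      simp only [g, smul_eq_mul, Pi.one_apply]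
      field_simp
    rw [Complex.coe_smul, ← h1]
    abel
  have hmem (n : ℕ) : (1 - G n) * star x ∈ J := by
    rw [hGcfc, ← smul_one_mul (_ : ℂ) (a * G n), ha]
    have h1 := (hideal _ (hideal x hx ((((n : ℝ) + 1 : ℝ) : ℂ) • (1 : B) * star x)).1
      (G n * star x)).2
    simpa only [mul_assoc] using h1
  have hnorm (n : ℕ) : ‖G n * star x‖ ^ 2 ≤ 1 / ((n : ℝ) + 1) := by
    have h1 : ‖G n * star x‖ ^ 2 = ‖G n * a * G n‖ := by
      rw [sq, ← CStarRing.norm_self_mul_star, star_mul, star_star, hGsa, ha]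
      simp only [mul_assoc]
    have h2 : G n * a * G n = cfc (fun t => g n t * t * g n t) a := by
      rw [cfc_mul (fun t => g n t * t) (g n) a (by fun_prop) (hg n),
        cfc_mul (g n) (fun t => t) a (hg n) (by fun_prop), cfc_id' ℝ a]
    rw [h1, h2]
    refine norm_cfc_le (by positivity) fun t ht => ?_
    have h0 := hspec t ht
    have h3 := hpos n t ht
    have h4 : (0 : ℝ) < (n : ℝ) + 1 := by positivity
    have h5 : 0 ≤ g n t := by simp only [g]; positivity
    rw [Real.norm_of_nonneg (by positivity)]
    simp only [g]
    rw [le_div_iff₀ h4, inv_mul_eq_div, ← div_eq_mul_inv, div_div, div_mul_eq_mul_div,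
      div_le_one (by positivity)]
    nlinarith [mul_nonneg h4.le h0, sq_nonneg (((n : ℝ) + 1) * t)]
  refine hclosed.mem_of_tendsto (b := atTop) (f := fun n => (1 - G n) * star x) ?_
    (Eventually.of_forall hmem)
  rw [tendsto_iff_norm_sub_tendsto_zero]
  have h1 : Tendsto (fun n => ‖G n * star x‖ ^ 2) atTop (𝓝 0) :=
    squeeze_zero (fun _ => by positivity) hnorm tendsto_one_div_add_atTop_nhds_zero_nat
  have h2 := (Real.continuous_sqrt.tendsto 0).comp h1
  simp only [Real.sqrt_zero] at h2
  refine h2.congr fun n => ?_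
  simp [sub_mul]

/-- Compressing two contractions by `u` and `1 - u`, where `0 ≤ u ≤ 1`, and adding up the results
gives a contraction. -/
theorem norm_conj_add_conj_le_one {B : Type*} [CStarAlgebra B] [PartialOrder B] [StarOrderedRing B]
    {u x y : B} (hu0 : 0 ≤ u) (hu1 : u ≤ 1) (hx : ‖x‖ ≤ 1) (hy : ‖y‖ ≤ 1) :
    ‖u * x * u + (1 - u) * y * (1 - u)‖ ≤ 1 := by
  set w := 1 - u with hw
  have husa : star u = u := (IsSelfAdjoint.of_nonneg hu0).star_eq
  have hwsa : star w = w := by simp [hw, husa]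
  have hw0 : 0 ≤ w := sub_nonneg.2 hu1
  have hw1 : w ≤ 1 := by simpa [hw] using hu0
  have hcomm : u * w = w * u := by simp [hw, mul_sub, sub_mul]
  have huw : 0 ≤ u * w := by
    have h : Commute u w := hcomm
    exact h.mul_nonneg hu0 hw0
  have hsum : u * u + w * w + (u * w + u * w) = 1 := by
    simp only [hw]; noncomm_ring
  have hss (z : B) (hz : ‖z‖ ≤ 1) : star z * z ≤ 1 := by
    rw [← CStarAlgebra.norm_le_one_iff_of_nonneg _ (star_mul_self_nonneg z),
      CStarRing.norm_star_mul_self]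
    exact mul_le_one₀ hz (norm_nonneg _) hz
  set c := u * x * u + w * y * w with hc
  set d := w * x * u - u * y * w with hd
  have key : star c * c ≤ 1 := by
    have e1 : u * (star x * x) * u + w * (star y * y) * w - star c * c
        = star d * d + u * (star x * (u * w + u * w) * x) * u
          + w * (star y * (u * w + u * w) * y) * w := by
      have e2 : u * (star x * x) * u = u * (star x * (u * u + w * w + (u * w + u * w)) * x) * u := by
        rw [hsum, mul_one]
      have e3 : w * (star y * y) * w = w * (star y * (u * u + w * w + (u * w + u * w)) * y) * w := by
        rw [hsum, mul_one]
      have e4 (p q : B) : p * (u * (w * q)) = p * (w * (u * q)) := by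
        rw [← mul_assoc u, hcomm, mul_assoc]
      rw [e2, e3]
      simp only [hc, hd, star_add, star_sub, star_mul, husa, hwsa, mul_add, add_mul, mul_sub,
        sub_mul, mul_assoc, e4]
      abel
    have e5 : 0 ≤ u * (star x * x) * u + w * (star y * y) * w - star c * c := by
      rw [e1]
      have h2 : 0 ≤ u * w + u * w := add_nonneg huw huw
      have h3 : 0 ≤ u * (star x * (u * w + u * w) * x) * u := by
        simpa [husa] using star_left_conjugate_nonneg (star_left_conjugate_nonneg h2 x) u
      have h4 : 0 ≤ w * (star y * (u * w + u * w) * y) * w := by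
        simpa [hwsa] using star_left_conjugate_nonneg (star_left_conjugate_nonneg h2 y) w
      exact add_nonneg (add_nonneg (star_mul_self_nonneg d) h3) h4
    have e6 : u * (star x * x) * u ≤ u * u := by
      simpa [husa] using star_left_conjugate_le_conjugate (hss x hx) u
    have e7 : w * (star y * y) * w ≤ w * w := by
      simpa [hwsa] using star_left_conjugate_le_conjugate (hss y hy) w
    calc star c * c ≤ u * (star x * x) * u + w * (star y * y) * w := sub_nonneg.1 e5
      _ ≤ u * u + w * w := add_le_add e6 e7
      _ ≤ u * u + w * w + (u * w + u * w) := le_add_of_nonneg_right (add_nonneg huw huw)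
      _ = 1 := hsum
  have h1 := (CStarAlgebra.norm_le_one_iff_of_nonneg _ (star_mul_self_nonneg c)).2 key
  rw [CStarRing.norm_star_mul_self] at h1
  nlinarith [norm_nonneg c]

/-- A closed star subalgebra of a C*-algebra has an approximate unit which consists of positive
contractions. -/
theorem exists_filter_approximateUnit {B : Type*} [CStarAlgebra B] [PartialOrder B]
    [StarOrderedRing B] (S : NonUnitalStarSubalgebra ℂ B) (hS : IsClosed (S : Set B)) :
    ∃ l : Filter B, l.NeBot ∧ (∀ᶠ e in l, e ∈ S ∧ 0 ≤ e ∧ e ≤ 1) ∧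
      ∀ a ∈ S, Tendsto (fun e => e * a) l (𝓝 a) ∧ Tendsto (fun e => a * e) l (𝓝 a) := by
  have : IsClosed (S : Set B) := hS
  let _ := CStarAlgebra.spectralOrder S
  have := CStarAlgebra.spectralOrderedRing S
  have hl := CStarAlgebra.increasingApproximateUnit S
  refine ⟨(CStarAlgebra.approximateUnit S).map ((↑) : S → B), inferInstance, ?_, fun a ha => ?_⟩
  · rw [eventually_map]
    filter_upwards [hl.eventually_nonneg, hl.eventually_norm] with e he0 he1
    obtain ⟨y, rfl⟩ := CStarAlgebra.nonneg_iff_eq_star_mul_self.1 he0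
    have h0 : (0 : B) ≤ ((star y * y : S) : B) := star_mul_self_nonneg (y : B)
    exact ⟨SetLike.coe_mem _, h0, (CStarAlgebra.norm_le_one_iff_of_nonneg _ h0).1 he1⟩
  · have h1 := (continuous_subtype_val.tendsto _).comp (hl.tendsto_mul_right ⟨a, ha⟩)
    have h2 := (continuous_subtype_val.tendsto _).comp (hl.tendsto_mul_left ⟨a, ha⟩)
    exact ⟨tendsto_map'_iff.2 h1, tendsto_map'_iff.2 h2⟩

/-- If `l` is an approximate unit of `S` consisting of positive contractions, then the compressions
`y ↦ φ ((1 - e) * y * (1 - e))` of a bounded functional `φ` to `S` tend to zero in norm. -/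
theorem eventually_abs_conj_one_sub_le {B : Type*} [CStarAlgebra B] [PartialOrder B]
    [StarOrderedRing B] {S : NonUnitalStarSubalgebra ℂ B} (hideal : ∀ x ∈ S, ∀ b : B, x * b ∈ S)
    {l : Filter B} (hl : ∀ᶠ e in l, e ∈ S ∧ 0 ≤ e ∧ e ≤ 1)
    (happrox : ∀ a ∈ S, Tendsto (fun e => e * a) l (𝓝 a) ∧ Tendsto (fun e => a * e) l (𝓝 a))
    (φ : StrongDual ℝ B) {ε : ℝ} (hε : 0 < ε) :
    ∀ᶠ e in l, ∀ y ∈ S, |φ ((1 - e) * y * (1 - e))| ≤ ε * ‖y‖ := by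
  set D : Set ℝ := φ '' {x | x ∈ S ∧ ‖x‖ ≤ 1} with hD
  have hbdd : BddAbove D := by
    refine ⟨‖φ‖, ?_⟩
    rintro _ ⟨x, ⟨-, hx⟩, rfl⟩
    exact (le_abs_self _).trans (φ.unit_le_opNorm x hx)
  have hne : D.Nonempty := ⟨φ 0, 0, ⟨zero_mem S, by simp⟩, rfl⟩
  obtain ⟨_, ⟨x, ⟨hxS, hx1⟩, rfl⟩, hxM⟩ := exists_lt_of_lt_csSup hne (sub_lt_self (sSup D) hε)
  have hconj : Tendsto (fun e => e * x * e) l (𝓝 x) := by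
    rw [tendsto_iff_norm_sub_tendsto_zero]
    have h1 := (tendsto_iff_norm_sub_tendsto_zero.1 (happrox x hxS).1).add
      (tendsto_iff_norm_sub_tendsto_zero.1 (happrox x hxS).2)
    rw [add_zero] at h1
    refine squeeze_zero' (Eventually.of_forall fun _ => norm_nonneg _) ?_ h1
    filter_upwards [hl] with e he
    have he1 := (CStarAlgebra.norm_le_one_iff_of_nonneg e he.2.1).2 he.2.2
    calc ‖e * x * e - x‖ = ‖(e * x - x) + e * (x * e - x)‖ := by
          congr 1; noncomm_ring
      _ ≤ ‖e * x - x‖ + ‖e‖ * ‖x * e - x‖ :=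
          (norm_add_le _ _).trans (by gcongr; exact norm_mul_le _ _)
      _ ≤ ‖e * x - x‖ + ‖x * e - x‖ := by
          gcongr
          exact mul_le_of_le_one_left (norm_nonneg _) he1
  filter_upwards [hl, ((φ.continuous.tendsto x).comp hconj).eventually (lt_mem_nhds hxM)]
    with e ⟨heS, he0, he1⟩ hex
  simp only [Function.comp_apply] at hex
  have hmem (y : B) (hy : y ∈ S) : (1 - e) * y * (1 - e) ∈ S := by
    have h1 : (1 - e) * y * (1 - e) = y - e * y - (y * e - e * y * e) := by noncomm_ring
    rw [h1]
    exact sub_mem (sub_mem hy (mul_mem heS hy))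
      (sub_mem (mul_mem hy heS) (mul_mem (mul_mem heS hy) heS))
  have hle (y : B) (hy : y ∈ S) (hy1 : ‖y‖ ≤ 1) : φ ((1 - e) * y * (1 - e)) ≤ ε := by
    have h1 : φ (e * x * e + (1 - e) * y * (1 - e)) ≤ sSup D :=
      le_csSup hbdd ⟨_, ⟨add_mem (hideal _ (mul_mem heS hxS) e) (hmem y hy),
        norm_conj_add_conj_le_one he0 he1 hx1 hy1⟩, rfl⟩
    rw [map_add] at h1
    linarith
  intro y hy
  rcases eq_or_ne y 0 with rfl | hy0
  · simp
  have hpos : 0 < ‖y‖ := norm_pos_iff.2 hy0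
  have hscale (s : ℝ) (hs : |s| = ‖y‖⁻¹) : s * φ ((1 - e) * y * (1 - e)) ≤ ε := by
    have h1 : (s : ℂ) • y ∈ S := SMulMemClass.smul_mem _ hy
    have h2 : ‖(s : ℂ) • y‖ ≤ 1 := by
      rw [norm_smul, Complex.norm_real, Real.norm_eq_abs, hs, inv_mul_cancel₀ hpos.ne']
    have h3 := hle _ h1 h2
    rwa [mul_smul_comm, smul_mul_assoc, Complex.coe_smul, map_smul, smul_eq_mul] at h3
  have h1 := hscale ‖y‖⁻¹ (abs_of_pos (inv_pos.2 hpos))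
  have h2 := hscale (-‖y‖⁻¹) (by rw [abs_neg, abs_of_pos (inv_pos.2 hpos)])
  rw [inv_mul_le_iff₀ hpos] at h1
  rw [neg_mul, ← mul_neg, inv_mul_le_iff₀ hpos] at h2
  rw [abs_le]
  constructor <;> linarith

/-- An approximate unit of a closed ideal which consists of positive contractions asymptotically
commutes, in the weak topology, with every element of the ambient algebra. -/
theorem tendsto_dual_commutator_approximateUnit {B : Type*} [CStarAlgebra B] [PartialOrder B]
    [StarOrderedRing B] {S : NonUnitalStarSubalgebra ℂ B}
    (hideal : ∀ x ∈ S, ∀ b : B, b * x ∈ S ∧ x * b ∈ S)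
    {l : Filter B} [l.NeBot] (hl : ∀ᶠ e in l, e ∈ S ∧ 0 ≤ e ∧ e ≤ 1)
    (happrox : ∀ a ∈ S, Tendsto (fun e => e * a) l (𝓝 a) ∧ Tendsto (fun e => a * e) l (𝓝 a))
    (φ : StrongDual ℝ B) (b : B) :
    Tendsto (fun e => φ (e * b - b * e)) l (𝓝 0) := by
  rw [Metric.tendsto_nhds]
  intro ε hε
  set K : ℝ := 2 * ‖b‖ + 1 with hK
  have hKpos : 0 < K := by positivity
  obtain ⟨v, hv, hvS, hv0, hv1⟩ := ((eventually_abs_conj_one_sub_le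
    (fun x hx b => (hideal x hx b).2) hl happrox φ (ε := ε / (2 * K)) (by positivity)).and
    hl).exists
  have hleft : Tendsto (fun e => v * (e * b - b * e)) l (𝓝 0) := by
    have h1 := ((happrox v hvS).2.mul_const b).sub (happrox (v * b) (hideal v hvS b).2).2
    simpa only [sub_self, mul_sub, mul_assoc] using h1
  have hright : Tendsto (fun e => (e * b - b * e) * v) l (𝓝 0) := by
    have h1 := (happrox (b * v) (hideal v hvS b).1).1.sub ((happrox v hvS).1.const_mul b)
    simpa only [sub_self, sub_mul, mul_assoc] using h1
  have hrest : Tendsto (fun e => φ (v * (e * b - b * e) + (e * b - b * e) * v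
      - v * (e * b - b * e) * v)) l (𝓝 0) := by
    have h1 := (φ.continuous.tendsto _).comp ((hleft.add hright).sub (hleft.mul_const v))
    simpa [Function.comp_def] using h1
  filter_upwards [hl, (Metric.tendsto_nhds.1 hrest) (ε / 2) (by positivity)] with e he hr
  obtain ⟨heS, he0, he1⟩ := he
  have hen := (CStarAlgebra.norm_le_one_iff_of_nonneg e he0).2 he1
  rw [Real.dist_eq, sub_zero] at hr ⊢
  set y := e * b - b * e with hy
  have hyS : y ∈ S := sub_mem (hideal e heS b).2 (hideal e heS b).1
  have hyn : ‖y‖ ≤ K := by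
    have h1 : ‖e * b‖ ≤ ‖b‖ :=
      (norm_mul_le _ _).trans (mul_le_of_le_one_left (norm_nonneg _) hen)
    have h2 : ‖b * e‖ ≤ ‖b‖ :=
      (norm_mul_le _ _).trans (mul_le_of_le_one_right (norm_nonneg _) hen)
    linarith [norm_sub_le (e * b) (b * e)]
  have hsplit : φ y = φ ((1 - v) * y * (1 - v)) + φ (v * y + y * v - v * y * v) := by
    rw [← map_add]
    congr 1
    noncomm_ring
  have h3 : |φ ((1 - v) * y * (1 - v))| ≤ ε / 2 :=
    calc _ ≤ ε / (2 * K) * ‖y‖ := hv y hyS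
      _ ≤ ε / (2 * K) * K := by gcongr
      _ = ε / 2 := by field_simp
  rw [hsplit]
  linarith [abs_add_le (φ ((1 - v) * y * (1 - v))) (φ (v * y + y * v - v * y * v))]

/-- A closed ideal contains positive contractions which are approximate units for finitely many
elements of the ideal and almost commute with finitely many elements of the ambient algebra. -/
theorem exists_quasicentral_contraction {B : Type*} [CStarAlgebra B] [PartialOrder B]
    [StarOrderedRing B] {S : NonUnitalStarSubalgebra ℂ B} (hS : IsClosed (S : Set B))
    (hideal : ∀ x ∈ S, ∀ b : B, b * x ∈ S ∧ x * b ∈ S) {ι : Type*} [Fintype ι] (a b : ι → B)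
    (ha : ∀ i, a i ∈ S) {ε : ℝ} (hε : 0 < ε) :
    ∃ e ∈ S, 0 ≤ e ∧ e ≤ 1 ∧ ∀ i, ‖e * a i - a i‖ < ε ∧ ‖e * b i - b i * e‖ < ε := by
  classical
  obtain ⟨l, hne, hl, happrox⟩ := exists_filter_approximateUnit S hS
  let T : B → (ι → B) × (ι → B) := fun e => (fun i => e * a i - a i, fun i => e * b i - b i * e)
  let K : Set B := {e | e ∈ S ∧ 0 ≤ e ∧ e ≤ 1}
  have hconv : Convex ℝ (T '' K) := by
    rintro _ ⟨e, ⟨heS, he0, he1⟩, rfl⟩ _ ⟨f, ⟨hfS, hf0, hf1⟩, rfl⟩ s t hs ht hst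
    refine ⟨s • e + t • f, ⟨?_, ?_, ?_⟩, ?_⟩
    · rw [← Complex.coe_smul s, ← Complex.coe_smul t]
      exact add_mem (SMulMemClass.smul_mem _ heS) (SMulMemClass.smul_mem _ hfS)
    · exact add_nonneg (smul_nonneg hs he0) (smul_nonneg ht hf0)
    · calc s • e + t • f ≤ s • (1 : B) + t • (1 : B) :=
            add_le_add (smul_le_smul_of_nonneg_left he1 hs) (smul_le_smul_of_nonneg_left hf1 ht)
        _ = 1 := by rw [← add_smul, hst, one_smul]
    · refine Prod.ext (funext fun i => ?_) (funext fun i => ?_)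
      · have h1 : a i = s • a i + t • a i := by rw [← add_smul, hst, one_smul]
        simp only [T, Prod.fst_add, Prod.smul_fst, Pi.add_apply, Pi.smul_apply, add_mul,
          smul_mul_assoc, smul_sub]
        nth_rewrite 3 [h1]
        abel
      · simp only [T, Prod.snd_add, Prod.smul_snd, Pi.add_apply, Pi.smul_apply, add_mul, mul_add,
          smul_mul_assoc, mul_smul_comm, smul_sub]
        abel
  have hzero : (0 : (ι → B) × (ι → B)) ∈ closure (T '' K) := by
    by_contra hcon
    obtain ⟨f, r, hr0, hr⟩ :=
      geometric_hahn_banach_point_closed hconv.closure isClosed_closure hcon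
    rw [map_zero] at hr0
    have h1 : Tendsto (fun e => f (fun i => e * a i - a i, 0)) l (𝓝 0) := by
      have h2 : Tendsto (fun e => ((fun i => e * a i - a i, 0) : (ι → B) × (ι → B))) l
          (𝓝 0) := by
        refine Tendsto.prodMk_nhds (tendsto_pi_nhds.2 fun i => ?_) tendsto_const_nhds
        simpa using (happrox (a i) (ha i)).1.sub_const (a i)
      simpa [Function.comp_def] using (f.continuous.tendsto _).comp h2
    have h3 : Tendsto (fun e => f (0, fun i => e * b i - b i * e)) l (𝓝 0) := by
      let ψ (i : ι) : StrongDual ℝ B := (f.comp (ContinuousLinearMap.inr ℝ (ι → B) (ι → B))).comp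
        (ContinuousLinearMap.single ℝ (fun _ => B) i)
      have h4 (q : ι → B) : f (0, q) = ∑ i, ψ i (q i) := by
        change (f.comp (ContinuousLinearMap.inr ℝ (ι → B) (ι → B))) q = _
        conv_lhs => rw [← Finset.univ_sum_single q, map_sum]
        rfl
      simp only [h4]
      simpa using tendsto_finsetSum Finset.univ fun i _ =>
        tendsto_dual_commutator_approximateUnit hideal hl happrox (ψ i) (b i)
    have h5 : Tendsto (fun e => f (T e)) l (𝓝 0) := by
      have h6 := h1.add h3
      simp only [← map_add, Prod.mk_add_mk, add_zero, zero_add] at h6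
      exact h6
    obtain ⟨e, he, heK⟩ := ((h5.eventually (gt_mem_nhds hr0)).and hl).exists
    exact absurd (hr _ (subset_closure ⟨e, heK, rfl⟩)) he.le.not_gt
  obtain ⟨_, ⟨e, ⟨heS, he0, he1⟩, rfl⟩, hdist⟩ := Metric.mem_closure_iff.1 hzero ε hε
  rw [dist_zero_left] at hdist
  refine ⟨e, heS, he0, he1, fun i => ⟨?_, ?_⟩⟩
  · exact ((norm_le_pi_norm _ i).trans (norm_fst_le (T e))).trans_lt hdist
  · exact ((norm_le_pi_norm _ i).trans (norm_snd_le (T e))).trans_lt hdist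

/-- A uniformly Lipschitz sequence of maps which tends to zero on a set tends to zero on its
closure. -/
theorem tendsto_norm_zero_of_mem_closure {E F : Type*} [SeminormedAddCommGroup E]
    [SeminormedAddCommGroup F] {L : ℕ → E → F} {C : ℝ}
    (hL : ∀ n x y, ‖L n x - L n y‖ ≤ C * ‖x - y‖) {s : Set E}
    (hs : ∀ y ∈ s, Tendsto (fun n => ‖L n y‖) atTop (𝓝 0)) {x : E} (hx : x ∈ closure s) :
    Tendsto (fun n => ‖L n x‖) atTop (𝓝 0) := by
  rw [Metric.tendsto_nhds]
  intro ε hε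
  obtain ⟨y, hy, hxy⟩ := Metric.mem_closure_iff.1 hx (ε / (2 * (|C| + 1))) (by positivity)
  filter_upwards [Metric.tendsto_nhds.1 (hs y hy) (ε / 2) (by positivity)] with n hn
  rw [Real.dist_eq, sub_zero, abs_norm] at hn ⊢
  rw [dist_eq_norm] at hxy
  have h1 : ‖L n x - L n y‖ ≤ ε / 2 :=
    calc ‖L n x - L n y‖ ≤ C * ‖x - y‖ := hL n x y
      _ ≤ (|C| + 1) * ‖x - y‖ := by
          gcongr
          linarith [le_abs_self C]
      _ ≤ (|C| + 1) * (ε / (2 * (|C| + 1))) := by gcongr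
      _ = ε / 2 := by field_simp
  have h2 : ‖L n x‖ ≤ ‖L n x - L n y‖ + ‖L n y‖ := by
    simpa using norm_add_le (L n x - L n y) (L n y)
  linarith

/-- A closed ideal of a separable unital C*-algebra has a sequential quasicentral approximate unit
consisting of positive contractions. -/
theorem exists_seq_quasicentral_approximateUnit {B : Type*} [CStarAlgebra B] [PartialOrder B]
    [StarOrderedRing B] [TopologicalSpace.SeparableSpace B] {S : NonUnitalStarSubalgebra ℂ B}
    (hS : IsClosed (S : Set B)) (hideal : ∀ x ∈ S, ∀ b : B, b * x ∈ S ∧ x * b ∈ S) :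
    ∃ e : ℕ → B, (∀ n, e n ∈ S ∧ 0 ≤ e n ∧ e n ≤ 1) ∧
      (∀ a ∈ S, Tendsto (fun n => ‖e n * a - a‖) atTop (𝓝 0)) ∧
      ∀ b : B, Tendsto (fun n => ‖e n * b - b * e n‖) atTop (𝓝 0) := by
  have : SecondCountableTopology B := UniformSpace.secondCountable_of_separable B
  have : Nonempty S := ⟨0⟩
  let a : ℕ → S := TopologicalSpace.denseSeq S
  let b : ℕ → B := TopologicalSpace.denseSeq B
  choose e heS he0 he1 he using fun n : ℕ => exists_quasicentral_contraction hS hideal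
    (fun i : Fin (n + 1) => (a i : B)) (fun i : Fin (n + 1) => b i) (fun i => (a i).2)
    (Nat.one_div_pos_of_nat (α := ℝ) (n := n))
  have hen (n : ℕ) : ‖e n‖ ≤ 1 := (CStarAlgebra.norm_le_one_iff_of_nonneg _ (he0 n)).2 (he1 n)
  refine ⟨e, fun n => ⟨heS n, he0 n, he1 n⟩, fun x hx => ?_, fun x => ?_⟩
  · refine tendsto_norm_zero_of_mem_closure (L := fun n (y : S) => e n * (y : B) - y) (C := 2)
      (s := Set.range a) (x := ⟨x, hx⟩) (fun n y z => ?_) ?_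
      (TopologicalSpace.denseRange_denseSeq S _)
    · have h1 : e n * (y : B) - y - (e n * z - z) = e n * ((y - z : S) : B) - (y - z : S) := by
        push_cast
        noncomm_ring
      have h2 : ‖e n * ((y - z : S) : B)‖ ≤ ‖y - z‖ :=
        (norm_mul_le _ _).trans (mul_le_of_le_one_left (norm_nonneg _) (hen n))
      have h3 : ‖((y - z : S) : B)‖ = ‖y - z‖ := rfl
      rw [h1]
      linarith [norm_sub_le (e n * ((y - z : S) : B)) (y - z : S)]
    · rintro _ ⟨i, rfl⟩
      refine squeeze_zero' (Eventually.of_forall fun _ => norm_nonneg _) ?_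
        (tendsto_one_div_add_atTop_nhds_zero_nat (𝕜 := ℝ))
      filter_upwards [eventually_ge_atTop i] with n hn
      exact (he n ⟨i, by lia⟩).1.le
  · refine tendsto_norm_zero_of_mem_closure (L := fun n y => e n * y - y * e n) (C := 2)
      (s := Set.range b) (fun n y z => ?_) ?_ (TopologicalSpace.denseRange_denseSeq B _)
    · have h1 : e n * y - y * e n - (e n * z - z * e n) = e n * (y - z) - (y - z) * e n := by
        noncomm_ring
      have h2 : ‖e n * (y - z)‖ ≤ ‖y - z‖ :=
        (norm_mul_le _ _).trans (mul_le_of_le_one_left (norm_nonneg _) (hen n))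
      have h3 : ‖(y - z) * e n‖ ≤ ‖y - z‖ :=
        (norm_mul_le _ _).trans (mul_le_of_le_one_right (norm_nonneg _) (hen n))
      rw [h1]
      linarith [norm_sub_le (e n * (y - z)) ((y - z) * e n)]
    · rintro _ ⟨i, rfl⟩
      refine squeeze_zero' (Eventually.of_forall fun _ => norm_nonneg _) ?_
        (tendsto_one_div_add_atTop_nhds_zero_nat (𝕜 := ℝ))
      filter_upwards [eventually_ge_atTop i] with n hn
      exact (he n ⟨i, by lia⟩).2.le

/-- The inclusion of the unit interval into the complex numbers. -/
def unitIntervalInclusion : C(unitInterval, ℂ) where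
  toFun t := ((t : ℝ) : ℂ)
  continuous_toFun := by fun_prop

theorem unitIntervalInclusion_apply (t : unitInterval) :
    unitIntervalInclusion t = ((t : ℝ) : ℂ) :=
  rfl

/-- Continuous functional calculus on the unit interval for a positive contraction. -/
theorem exists_starAlgHom_unitIntervalInclusion {B : Type*} [CStarAlgebra B] [PartialOrder B]
    [StarOrderedRing B] {x : B} (hx0 : 0 ≤ x) (hx1 : x ≤ 1) :
    ∃ β : C(unitInterval, ℂ) →⋆ₐ[ℂ] B, β unitIntervalInclusion = x := by
  have hsa : IsSelfAdjoint x := .of_nonneg hx0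
  have hreal (z : ℂ) (hz : z ∈ spectrum ℂ x) : z = (z.re : ℂ) := hsa.mem_spectrum_eq_re hz
  have hmem (z : ℂ) (hz : z ∈ spectrum ℂ x) : z.re ∈ unitInterval := by
    rw [hreal z hz] at hz
    have h1 : z.re ∈ spectrum ℝ x := (spectrum.algebraMap_mem_iff ℂ).1 hz
    exact ⟨spectrum_nonneg_of_nonneg hx0 h1, (CFC.le_one_iff x).1 hx1 _ h1⟩
  let r : C(spectrum ℂ x, unitInterval) :=
    { toFun := fun z => ⟨(z : ℂ).re, hmem z z.2⟩
      continuous_toFun := by fun_prop }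
  refine ⟨(cfcHom (R := ℂ) hsa.isStarNormal).comp (ContinuousMap.compStarAlgHom' ℂ ℂ r), ?_⟩
  have h1 : ContinuousMap.compStarAlgHom' ℂ ℂ r unitIntervalInclusion
      = (ContinuousMap.id ℂ).restrict (spectrum ℂ x) := by
    ext z
    exact (hreal z z.2).symm
  rw [StarAlgHom.comp_apply, h1]
  exact cfcHom_id _

/-- The inclusion of the unit interval into `ℂ` generates a dense star subalgebra of `C([0,1])`. -/
theorem mem_closure_adjoin_unitIntervalInclusion (h : C(unitInterval, ℂ)) :
    h ∈ closure (StarAlgebra.adjoin ℂ {unitIntervalInclusion} : Set C(unitInterval, ℂ)) := by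
  have h1 := ContinuousMap.starSubalgebra_topologicalClosure_eq_top_of_separatesPoints
    (StarAlgebra.adjoin ℂ {unitIntervalInclusion}) fun s t hst =>
      ⟨unitIntervalInclusion, ⟨unitIntervalInclusion,
        StarAlgebra.self_mem_adjoin_singleton ℂ _, rfl⟩, fun heq => hst ?_⟩
  · rw [← StarSubalgebra.topologicalClosure_coe, h1]
    trivial
  · exact Subtype.ext (Complex.ofReal_injective heq)

/-- If a separable C*-algebra sits as a closed two-sided ideal `J` inside a separable
unital C*-algebra `B`, then there is a sequence of unital *-homomorphisms
`βₙ : C([0,1]) → J⁺ ⊆ B` (where `J⁺ = J + ℂ·1` is the unitization of `J` inside `B`)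
such that `βₙ(C₀([0,1))) ⊆ J`, `‖βₙ(h)a − h(0)a‖ → 0` for `a ∈ J`, and
`‖[βₙ(h), b]‖ → 0` for `b ∈ B`. -/
theorem stmt_10 {B : Type u} [CStarAlgebra B] [TopologicalSpace.SeparableSpace B]
    (J : Set B) (hclosed : IsClosed J) (hzero : (0 : B) ∈ J)
    (hadd : ∀ x ∈ J, ∀ y ∈ J, x + y ∈ J)
    (hideal : ∀ x ∈ J, ∀ b : B, b * x ∈ J ∧ x * b ∈ J) :
    ∃ β : ℕ → (C(unitInterval, ℂ) →⋆ₐ[ℂ] B),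
      -- the `βₙ` take values in the unitization `J⁺ = J + ℂ·1_B ⊆ B`
      (∀ n (h : C(unitInterval, ℂ)), ∃ a ∈ J, ∃ c : ℂ, β n h = a + c • (1 : B)) ∧
      -- (i) `βₙ(C₀([0,1))) ⊆ J`
      (∀ n (h : C(unitInterval, ℂ)), h 1 = 0 → β n h ∈ J) ∧
      -- (ii) `‖βₙ(h)a − h(0)·a‖ → 0` for all `h` and all `a ∈ J`
      (∀ (h : C(unitInterval, ℂ)), ∀ a ∈ J,
        Tendsto (fun n => ‖β n h * a - h 0 • a‖) atTop (𝓝 (0 : ℝ))) ∧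
      -- (iii) `‖[βₙ(h), b]‖ → 0` for all `h` and all `b ∈ B`
      (∀ (h : C(unitInterval, ℂ)) (b : B),
        Tendsto (fun n => ‖β n h * b - b * β n h‖) atTop (𝓝 (0 : ℝ))) := by
  let _ := CStarAlgebra.spectralOrder B
  have := CStarAlgebra.spectralOrderedRing B
  let S : NonUnitalStarSubalgebra ℂ B :=
    { carrier := J
      add_mem' := fun hx hy => hadd _ hx _ hy
      zero_mem' := hzero
      mul_mem' := fun {x y} hx _ => (hideal x hx y).2
      smul_mem' := fun c x hx => by
        simpa using (hideal x hx (c • (1 : B))).1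
      star_mem' := fun hx => star_mem_of_isClosed_ideal hclosed hideal hx }
  obtain ⟨e, he, hunit, hcomm⟩ := exists_seq_quasicentral_approximateUnit (S := S) hclosed hideal
  choose β hβ using fun n => exists_starAlgHom_unitIntervalInclusion
    (sub_nonneg.2 (he n).2.2) (sub_le_self 1 (he n).2.1)
  have hnorm (n : ℕ) (h : C(unitInterval, ℂ)) : ‖β n h‖ ≤ ‖h‖ :=
    NonUnitalStarAlgHom.norm_apply_le (β n) h
  have hmem (n : ℕ) (h : C(unitInterval, ℂ)) : β n h - h 1 • (1 : B) ∈ S := by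
    have hcl : IsClosed {h : C(unitInterval, ℂ) | β n h - h 1 • (1 : B) ∈ S} := by
      refine IsClosed.preimage ?_ hclosed
      have h1 : Continuous (β n) :=
        AddMonoidHomClass.continuous_of_bound (β n) 1 fun g => by simpa using hnorm n g
      exact h1.sub ((continuous_eval_const 1).smul continuous_const)
    refine hcl.closure_subset_iff.2 (fun g hg => ?_) (mem_closure_adjoin_unitIntervalInclusion h)
    induction hg using StarAlgebra.adjoin_induction with
    | mem g hg =>
      obtain rfl := Set.mem_singleton_iff.1 hg
      have h1 : β n unitIntervalInclusion - unitIntervalInclusion 1 • (1 : B) = -e n := by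
        simp [hβ, unitIntervalInclusion_apply]
      rw [Set.mem_ofPred_eq, h1]
      exact neg_mem (he n).1
    | algebraMap c => simp [Algebra.algebraMap_eq_smul_one]
    | add f g _ _ hf hg =>
      have h1 : β n (f + g) - (f + g) 1 • (1 : B)
          = (β n f - f 1 • (1 : B)) + (β n g - g 1 • (1 : B)) := by
        rw [map_add, ContinuousMap.add_apply, add_smul]
        abel
      rw [Set.mem_ofPred_eq, h1]
      exact add_mem hf hg
    | mul f g _ _ hf hg =>
      have h1 : β n (f * g) - (f * g) 1 • (1 : B)
          = (β n f - f 1 • (1 : B)) * β n g + (f 1 • (1 : B)) * (β n g - g 1 • (1 : B)) := by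
        rw [map_mul, ContinuousMap.mul_apply, mul_smul]
        simp only [sub_mul, mul_sub, smul_mul_assoc, one_mul]
        abel
      rw [Set.mem_ofPred_eq, h1]
      exact add_mem (hideal _ hf _).2 (hideal _ hg _).1
    | star f _ hf =>
      rw [Set.mem_ofPred_eq] at hf
      simpa [map_star] using star_mem hf
  have hcommutator (h : C(unitInterval, ℂ)) (b : B) :
      Tendsto (fun n => ‖β n h * b - b * β n h‖) atTop (𝓝 0) := by
    refine tendsto_norm_zero_of_mem_closure (L := fun n g => β n g * b - b * β n g)
      (C := 2 * ‖b‖) (fun n f g => ?_) (fun g hg => ?_) (mem_closure_adjoin_unitIntervalInclusion h)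
    · have h1 : β n f * b - b * β n f - (β n g * b - b * β n g)
          = β n (f - g) * b - b * β n (f - g) := by
        rw [map_sub]
        noncomm_ring
      have h2 : ‖β n (f - g) * b‖ ≤ ‖f - g‖ * ‖b‖ :=
        (norm_mul_le _ _).trans (by gcongr; exact hnorm _ _)
      have h3 : ‖b * β n (f - g)‖ ≤ ‖b‖ * ‖f - g‖ :=
        (norm_mul_le _ _).trans (by gcongr; exact hnorm _ _)
      rw [h1]
      linarith [norm_sub_le (β n (f - g) * b) (b * β n (f - g))]
    · rw [← tendsto_zero_iff_norm_tendsto_zero]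
      induction hg using StarAlgebra.adjoin_induction generalizing b with
      | mem g hg =>
        obtain rfl := Set.mem_singleton_iff.1 hg
        rw [tendsto_zero_iff_norm_tendsto_zero]
        refine (hcomm b).congr fun n => ?_
        rw [hβ, ← norm_neg]
        congr 1
        noncomm_ring
      | algebraMap c => simp [Algebra.algebraMap_eq_smul_one]
      | add f g _ _ hf hg =>
        have h1 := (hf b).add (hg b)
        rw [add_zero] at h1
        refine h1.congr fun n => ?_
        rw [map_add]
        noncomm_ring
      | mul f g _ _ hf hg =>
        have h1 : Tendsto (fun n => β n f * (β n g * b - b * β n g)) atTop (𝓝 0) :=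
          isBoundedUnder_le_mul_tendsto_zero (isBoundedUnder_of ⟨‖f‖, fun n => hnorm n f⟩) (hg b)
        have h2 : Tendsto (fun n => (β n f * b - b * β n f) * β n g) atTop (𝓝 0) :=
          (hf b).zero_mul_isBoundedUnder_le (isBoundedUnder_of ⟨‖g‖, fun n => hnorm n g⟩)
        have h3 := h1.add h2
        rw [add_zero] at h3
        refine h3.congr fun n => ?_
        rw [map_mul]
        noncomm_ring
      | star f _ hf =>
        have h1 := (hf (star b)).star.neg
        rw [star_zero, neg_zero] at h1
        refine h1.congr fun n => ?_
        simp [map_star]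
  have heval (h : C(unitInterval, ℂ)) (a : B) (ha : a ∈ S) :
      Tendsto (fun n => ‖β n h * a - h 0 • a‖) atTop (𝓝 0) := by
    refine tendsto_norm_zero_of_mem_closure (L := fun n g => β n g * a - g 0 • a)
      (C := 2 * ‖a‖) (fun n f g => ?_) (fun g hg => ?_) (mem_closure_adjoin_unitIntervalInclusion h)
    · have h1 : β n f * a - f 0 • a - (β n g * a - g 0 • a)
          = β n (f - g) * a - (f - g) 0 • a := by
        rw [map_sub, ContinuousMap.sub_apply, sub_smul, sub_mul]
        abel
      have h2 : ‖β n (f - g) * a‖ ≤ ‖f - g‖ * ‖a‖ :=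
        (norm_mul_le _ _).trans (by gcongr; exact hnorm _ _)
      have h3 : ‖(f - g) 0 • a‖ ≤ ‖f - g‖ * ‖a‖ := by
        rw [norm_smul]
        gcongr
        exact (f - g).norm_coe_le_norm 0
      rw [h1]
      linarith [norm_sub_le (β n (f - g) * a) ((f - g) 0 • a)]
    · rw [← tendsto_zero_iff_norm_tendsto_zero]
      induction hg using StarAlgebra.adjoin_induction generalizing a with
      | mem g hg =>
        obtain rfl := Set.mem_singleton_iff.1 hg
        rw [tendsto_zero_iff_norm_tendsto_zero]
        refine (hunit a ha).congr fun n => ?_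
        rw [hβ, ← norm_neg]
        congr 1
        simp [unitIntervalInclusion_apply, sub_mul]
      | algebraMap c => simp [Algebra.algebraMap_eq_smul_one]
      | add f g _ _ hf hg =>
        have h1 := (hf a ha).add (hg a ha)
        rw [add_zero] at h1
        refine h1.congr fun n => ?_
        rw [map_add, ContinuousMap.add_apply, add_smul, add_mul]
        abel
      | mul f g _ _ hf hg =>
        have h1 : Tendsto (fun n => β n f * (β n g * a - g 0 • a)) atTop (𝓝 0) :=
          isBoundedUnder_le_mul_tendsto_zero (isBoundedUnder_of ⟨‖f‖, fun n => hnorm n f⟩)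
            (hg a ha)
        have h3 := h1.add ((hf a ha).const_smul (g 0))
        rw [smul_zero, add_zero] at h3
        refine h3.congr fun n => ?_
        rw [map_mul, ContinuousMap.mul_apply, mul_comm (f 0), mul_smul]
        simp only [mul_sub, mul_smul_comm, smul_sub, mul_assoc]
        abel
      | star f _ hf =>
        have h1 := (tendsto_zero_iff_norm_tendsto_zero.2 (hcommutator (star f) a)).add
          (hf (star a) (star_mem ha)).star
        rw [star_zero, add_zero] at h1
        refine h1.congr fun n => ?_
        simp [map_star]
  refine ⟨β, fun n h => ⟨_, hmem n h, h 1, (sub_add_cancel _ _).symm⟩, fun n h h1 => ?_, heval,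
    hcommutator⟩
  have h2 := hmem n h
  rw [h1, zero_smul, sub_zero] at h2
  exact h2
end
end
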